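/- arXiv:2408.15279 — 2 statements merged into one kernel-verified Lean document; each statement's English description precedes it below -/
import Mathlib

section
/- (Spatial trace estimate (A.8).) Let N ≥ 2, 1 < p < ∞ and s > −1 + 1/p. There exists C > 0, depending only on N, p, s and the Littlewood–Paley functions, such that for every Schwartz function f on ℝ_t × ℝ^{N−1}_{y'} × ℝ_η: sup_{η ∈ ℝ} ∫_ℝ ‖f(t,·,η)‖_{Ḃ^{s+2−1/p}_{p,1}(ℝ^{N−1})} dt ≤ C ‖D²f‖_{L¹(ℝ;Ḃ^s_{p,1}(ℝ^N))}, where the norm on the left uses the Littlewood–Paley decomposition on ℝ^{N−1} in y', the norm on the right uses the Littlewood–Paley decomposition on ℝ^N in (y',η), and D²f ranges over all second-order partial derivatives in (y',η). -/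
open MeasureTheory
open scoped BigOperators ENNReal

noncomputable section

namespace MHD

/-- A Littlewood–Paley function on a finite-dimensional real inner product space:
a nonnegative, smooth, radial, radially nonincreasing function equal to `1` on the unit
ball and supported in the ball of radius `2`. -/
structure LPF (V : Type*) [NormedAddCommGroup V] [InnerProductSpace ℝ V]
    [FiniteDimensional ℝ V] [MeasurableSpace V] [BorelSpace V] where
  chi : V → ℝ
  smooth : ContDiff ℝ (⊤ : ℕ∞) chi
  nonneg : ∀ x, 0 ≤ chi x
  radial : ∀ x y : V, ‖x‖ = ‖y‖ → chi x = chi y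
  radial_antitone : ∀ x y : V, ‖x‖ ≤ ‖y‖ → chi y ≤ chi x
  eq_one : ∀ x : V, ‖x‖ ≤ 1 → chi x = 1
  supp : ∀ x : V, 2 ≤ ‖x‖ → chi x = 0

variable {V : Type*} [NormedAddCommGroup V] [InnerProductSpace ℝ V]
    [FiniteDimensional ℝ V] [MeasurableSpace V] [BorelSpace V]

/-- `φ̂(ξ) = χ̂(ξ/2) − χ̂(ξ)`. -/
def LPF.phiHat (χ : LPF V) (ξ : V) : ℝ := χ.chi ((2 : ℝ)⁻¹ • ξ) - χ.chi ξ

/-- The `k`-th homogeneous Littlewood–Paley block `Δ̇_k f = 𝓕⁻¹(φ̂(2^{-k}·)·𝓕f)`. -/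
def LPF.block (χ : LPF V) (k : ℤ) (f : V → ℂ) : V → ℂ :=
  FourierTransformInv.fourierInv
    (fun ξ : V => ((χ.phiHat ((2 : ℝ) ^ (-k) • ξ) : ℝ) : ℂ) * FourierTransform.fourier f ξ)

/-- The `k`-th Littlewood–Paley kernel `𝓕⁻¹(φ̂(2^{-k}·))`. -/
def LPF.kernel (χ : LPF V) (k : ℤ) : V → ℂ :=
  FourierTransformInv.fourierInv (fun ξ : V => ((χ.phiHat ((2 : ℝ) ^ (-k) • ξ) : ℝ) : ℂ))

/-- The homogeneous Besov norm `‖f‖_{Ḃ^s_{p,1}} = ∑_{k∈ℤ} 2^{sk} ‖Δ̇_k f‖_{L^p} ∈ [0,∞]`. -/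
def besov (χ : LPF V) (s p : ℝ) (f : V → ℂ) : ℝ≥0∞ :=
  ∑' k : ℤ, ENNReal.ofReal ((2 : ℝ) ^ (s * (k : ℝ))) *
    eLpNorm (χ.block k f) (ENNReal.ofReal p) volume

/-- The space-time norm `∫_I ‖u(t,·)‖_{Ḃ^s_{p,1}} dt ∈ [0,∞]`. -/
def besovT (χ : LPF V) (s p : ℝ) (I : Set ℝ) (u : ℝ → V → ℂ) : ℝ≥0∞ :=
  ∫⁻ t in I, besov χ s p (u t)

/-- Euclidean space `ℝ^n`. -/
abbrev Euc (n : ℕ) := EuclideanSpace ℝ (Fin n)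

/-- Partial derivative `∂_i f` in the `i`-th coordinate direction. -/
def pdv {n : ℕ} {F : Type*} [NormedAddCommGroup F] [NormedSpace ℝ F]
    (i : Fin n) (f : Euc n → F) (y : Euc n) : F :=
  fderiv ℝ f y (EuclideanSpace.single i 1)

/-- `u ∈ C_c^∞((0,∞) × ℝ^N ; F)`. -/
def SmoothCpt (N : ℕ) {F : Type*} [NormedAddCommGroup F] [NormedSpace ℝ F]
    (u : ℝ → Euc N → F) : Prop :=
  ContDiff ℝ (⊤ : ℕ∞) (Function.uncurry u) ∧ HasCompactSupport (Function.uncurry u) ∧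
    ∀ t : ℝ, t ≤ 0 → ∀ y, u t y = 0

/-- `Q` is the family of cofactor polynomials: `Q i j` has zero constant term and
`adjugate (1 + M) i j = δ_{ij} + (Q i j)(M)` for every real `N × N` matrix `M`. -/
def IsCofactorPoly (N : ℕ) (Q : Fin N → Fin N → MvPolynomial (Fin N × Fin N) ℝ) : Prop :=
  ∀ i j : Fin N,
    MvPolynomial.constantCoeff (Q i j) = 0 ∧
    ∀ M : Matrix (Fin N) (Fin N) ℝ,
      Matrix.adjugate (1 + M) i j =
        (if i = j then (1 : ℝ) else 0) +
          MvPolynomial.eval (fun v : Fin N × Fin N => M v.1 v.2) (Q i j)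

/-- The matrix field `P_{ij}(t,y) = Q_{ij}(∫₀ᵗ Du(τ,y) dτ)`. -/
def Pmat {N : ℕ} (Q : Fin N → Fin N → MvPolynomial (Fin N × Fin N) ℝ)
    (u : ℝ → Euc N → Euc N) (t : ℝ) (y : Euc N) (i j : Fin N) : ℝ :=
  MvPolynomial.eval
    (fun v : Fin N × Fin N => ∫ τ in (0 : ℝ)..t, pdv v.2 (fun z => u τ z v.1) y) (Q i j)

/-- `E(u) = ‖D²u‖_{L¹(ℝ₊; Ḃ^s_{p,1}(ℝ^N))}`, summed over all components and all pairs of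
spatial derivatives. -/
def EE {N : ℕ} (χ : LPF (Euc N)) (s p : ℝ) (u : ℝ → Euc N → Euc N) : ℝ≥0∞ :=
  ∑ m : Fin N, ∑ i : Fin N, ∑ j : Fin N,
    besovT χ s p (Set.Ioi 0) (fun t y => ((pdv i (pdv j fun z => u t z m) y : ℝ) : ℂ))

/-- `‖∂_t u‖_{L¹(ℝ₊; Ḃ^s_{p,1}(ℝ^N))}`, summed over components. -/
def dtNorm {N : ℕ} (χ : LPF (Euc N)) (s p : ℝ) (u : ℝ → Euc N → Euc N) : ℝ≥0∞ :=
  ∑ m : Fin N,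
    besovT χ s p (Set.Ioi 0) (fun t y => ((deriv (fun τ => u τ y m) t : ℝ) : ℂ))

end MHD

open MHD

noncomputable section

/-- Joining tangential variables `y' ∈ ℝ^n` and the last coordinate `η ∈ ℝ` into a point
of `ℝ^{n+1}`. -/
def join {n : ℕ} (y' : Euc n) (η : ℝ) : Euc (n + 1) :=
  WithLp.toLp 2 (Fin.snoc (fun i => y' i) η)

open MeasureTheory Topology FourierTransform Module
open Filter hiding join
open scoped SchwartzMap RealInnerProductSpace

/-- **Schur test** for nonnegative kernels. -/
theorem lintegral_rpow_schur {α β : Type*} [MeasurableSpace α] [MeasurableSpace β]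
    {μ : Measure α} {ν : Measure β} [SFinite μ] [SFinite ν] {k : α → β → ℝ≥0∞}
    (hk : Measurable (Function.uncurry k)) {G : β → ℝ≥0∞} (hG : Measurable G)
    {p : ℝ} (hp : 1 < p) {A B : ℝ≥0∞} (hA : ∀ x, ∫⁻ y, k x y ∂ν ≤ A)
    (hB : ∀ y, ∫⁻ x, k x y ∂μ ≤ B) :
    ∫⁻ x, (∫⁻ y, k x y * G y ∂ν) ^ p ∂μ ≤ A ^ (p - 1) * B * ∫⁻ y, G y ^ p ∂ν := by
  have hp0 : 0 < p := by linarith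
  obtain ⟨q, hpq⟩ : ∃ q, p.HolderConjugate q := ⟨_, Real.HolderConjugate.conjExponent hp⟩
  have hkx : ∀ x, Measurable (k x) := fun x => hk.of_uncurry_left
  have hpoint : ∀ x, (∫⁻ y, k x y * G y ∂ν) ^ p ≤ A ^ (p - 1) * ∫⁻ y, k x y * G y ^ p ∂ν := by
    intro x
    have h1 : ∫⁻ y, k x y * G y ∂ν ≤
        (∫⁻ y, k x y ∂ν) ^ (1 / q) * (∫⁻ y, k x y * G y ^ p ∂ν) ^ (1 / p) := by
      have := ENNReal.lintegral_mul_le_Lp_mul_Lq ν hpq.symm (f := fun y => k x y ^ (1 / q))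
        (g := fun y => k x y ^ (1 / p) * G y) ((hkx x).pow_const _).aemeasurable
        (((hkx x).pow_const _).mul hG).aemeasurable
      have e1 : ∀ y, ((fun y => k x y ^ (1 / q)) * fun y => k x y ^ (1 / p) * G y) y
          = k x y * G y := by
        intro y
        simp only [Pi.mul_apply]
        rw [← mul_assoc, ← ENNReal.rpow_add_of_nonneg _ _ (one_div_nonneg.2 hpq.symm.nonneg)
          (one_div_nonneg.2 hpq.nonneg), one_div, one_div, add_comm, hpq.inv_add_inv_eq_one,
          ENNReal.rpow_one]
      simp_rw [e1] at this
      refine this.trans_eq ?_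
      congr 3
      · ext y
        rw [← ENNReal.rpow_mul, one_div_mul_cancel hpq.symm.ne_zero, ENNReal.rpow_one]
      · ext y
        rw [ENNReal.mul_rpow_of_nonneg _ _ hp0.le, ← ENNReal.rpow_mul,
          one_div_mul_cancel hpq.ne_zero, ENNReal.rpow_one]
    calc (∫⁻ y, k x y * G y ∂ν) ^ p
        ≤ ((∫⁻ y, k x y ∂ν) ^ (1 / q) * (∫⁻ y, k x y * G y ^ p ∂ν) ^ (1 / p)) ^ p := by gcongr
      _ = (∫⁻ y, k x y ∂ν) ^ (p - 1) * ∫⁻ y, k x y * G y ^ p ∂ν := by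
        rw [ENNReal.mul_rpow_of_nonneg _ _ hp0.le, ← ENNReal.rpow_mul, ← ENNReal.rpow_mul,
          one_div_mul_cancel hpq.ne_zero, ENNReal.rpow_one, one_div_mul_eq_div,
          hpq.div_conj_eq_sub_one]
      _ ≤ _ := by
        gcongr ?_ * _
        exact ENNReal.rpow_le_rpow (hA x) (by linarith)
  calc ∫⁻ x, (∫⁻ y, k x y * G y ∂ν) ^ p ∂μ
      ≤ ∫⁻ x, A ^ (p - 1) * ∫⁻ y, k x y * G y ^ p ∂ν ∂μ := lintegral_mono hpoint
    _ = A ^ (p - 1) * ∫⁻ x, ∫⁻ y, k x y * G y ^ p ∂ν ∂μ := by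
      rw [lintegral_const_mul]
      exact (hk.mul ((hG.pow_const p).comp measurable_snd)).lintegral_prod_right'
    _ = A ^ (p - 1) * ∫⁻ y, (∫⁻ x, k x y ∂μ) * G y ^ p ∂ν := by
      rw [lintegral_lintegral_swap]
      · congr 2
        ext y
        rw [lintegral_mul_const _ hk.of_uncurry_right]
      · exact (hk.mul ((hG.pow_const p).comp measurable_snd)).aemeasurable
    _ ≤ A ^ (p - 1) * ∫⁻ y, B * G y ^ p ∂ν := by
      gcongr with y
      exact hB y
    _ = _ := by rw [lintegral_const_mul _ (hG.pow_const p), mul_assoc]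

/-- The Schur test, as a bound between `L^p` norms. -/
theorem eLpNorm_le_of_schur {α β : Type*} [MeasurableSpace α] [MeasurableSpace β]
    {μ : Measure α} {ν : Measure β} [SFinite μ] [SFinite ν] {k : α → β → ℂ}
    (hk : Measurable (Function.uncurry k)) {F : α → ℂ} {G : β → ℂ} (hG : Measurable G)
    {p : ℝ} (hp : 1 < p) {A B : ℝ≥0∞} (hA : ∀ x, ∫⁻ y, ‖k x y‖ₑ ∂ν ≤ A)
    (hB : ∀ y, ∫⁻ x, ‖k x y‖ₑ ∂μ ≤ B) (hF : ∀ x, F x = ∫ y, k x y * G y ∂ν) :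
    eLpNorm F (ENNReal.ofReal p) μ ≤
      A ^ (1 - 1 / p) * B ^ (1 / p) * eLpNorm G (ENNReal.ofReal p) ν := by
  have hp0 : 0 < p := by linarith
  have hpne : ENNReal.ofReal p ≠ 0 := by simpa using hp0
  rw [eLpNorm_eq_lintegral_rpow_enorm_toReal hpne ENNReal.ofReal_ne_top,
    eLpNorm_eq_lintegral_rpow_enorm_toReal hpne ENNReal.ofReal_ne_top,
    ENNReal.toReal_ofReal hp0.le]
  have h1 : ∫⁻ x, ‖F x‖ₑ ^ p ∂μ ≤ A ^ (p - 1) * B * ∫⁻ y, ‖G y‖ₑ ^ p ∂ν := by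
    refine le_trans (lintegral_mono fun x => ?_)
      (lintegral_rpow_schur (k := fun x y => ‖k x y‖ₑ) hk.enorm hG.enorm hp hA hB)
    gcongr
    rw [hF]
    refine (enorm_integral_le_lintegral_enorm _).trans_eq ?_
    simp_rw [enorm_mul]
  calc (∫⁻ x, ‖F x‖ₑ ^ p ∂μ) ^ (1 / p)
      ≤ (A ^ (p - 1) * B * ∫⁻ y, ‖G y‖ₑ ^ p ∂ν) ^ (1 / p) := by gcongr
    _ = _ := by
      rw [ENNReal.mul_rpow_of_nonneg _ _ (by positivity),
        ENNReal.mul_rpow_of_nonneg _ _ (by positivity), ← ENNReal.rpow_mul]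
      congr 4
      field_simp

section Fourier

variable {V : Type*} [NormedAddCommGroup V] [InnerProductSpace ℝ V]
    [FiniteDimensional ℝ V] [MeasurableSpace V] [BorelSpace V]

theorem lintegral_comp_smul_of_pos (f : V → ℝ≥0∞) {r : ℝ} (hr : 0 < r) :
    ∫⁻ x, f (r • x) = ENNReal.ofReal ((r ^ finrank ℝ V)⁻¹) * ∫⁻ x, f x := by
  calc ∫⁻ x, f (r • x)
      = ∫⁻ y, f y ∂Measure.map (fun x => r • x) (volume : Measure V) :=
        (lintegral_map_equiv f
          (Homeomorph.smul (isUnit_iff_ne_zero.2 hr.ne').unit).toMeasurableEquiv).symm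
    _ = _ := by
      rw [Measure.map_addHaar_smul _ hr.ne', lintegral_smul_measure, smul_eq_mul,
        abs_of_pos (by positivity)]

/-- A Fourier multiplier acts as convolution with its inverse Fourier transform. -/
theorem fourierInv_mul_fourier {m f : V → ℂ} (hm : Integrable m) (hf : Integrable f) (y : V) :
    𝓕⁻ (fun ξ => m ξ * 𝓕 f ξ) y = ∫ x, 𝓕⁻ m (y - x) * f x := by
  have hg : Integrable (fun ξ : V => Real.fourierChar ⟪ξ, y⟫ • m ξ) := by
    have := (Real.fourierIntegral_convergent_iff (f := m) (-y)).2 hm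
    simpa using this
  have key := VectorFourier.integral_fourierIntegral_smul_eq_flip (μ := (volume : Measure V))
    (ν := (volume : Measure V)) (L := innerₗ V)
    Real.continuous_fourierChar (by simp only [innerₗ_apply_apply]; fun_prop) hf hg
  have e : ∀ ξ, (𝓕⁻ m) (y - ξ) = VectorFourier.fourierIntegral Real.fourierChar volume
      (innerₗ V).flip (fun ξ : V => Real.fourierChar ⟪ξ, y⟫ • m ξ) ξ := by
    intro x
    rw [Real.fourierInv_eq, VectorFourier.fourierIntegral]
    congr with ξ
    rw [smul_smul, ← AddChar.map_add_eq_mul, inner_sub_right]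
    simp only [LinearMap.flip_apply, innerₗ_apply_apply]
    rw [real_inner_comm x ξ]
    congr 2
    ring
  rw [Real.fourierInv_eq]
  calc ∫ ξ, Real.fourierChar ⟪ξ, y⟫ • (m ξ * 𝓕 f ξ)
      = ∫ ξ, 𝓕 f ξ • (Real.fourierChar ⟪ξ, y⟫ • m ξ) := by
        congr with ξ
        simp only [Circle.smul_def, smul_eq_mul]
        ring
    _ = _ := key
    _ = _ := by
      congr with x
      rw [e, smul_eq_mul, mul_comm]

theorem fourierInv_comp_inv_smul (m : V → ℂ) {r : ℝ} (hr : 0 < r) (x : V) :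
    𝓕⁻ (fun ξ => m (r⁻¹ • ξ)) x = ((r ^ finrank ℝ V : ℝ) : ℂ) * 𝓕⁻ m (r • x) := by
  simp only [Real.fourierInv_eq]
  have := Measure.integral_comp_inv_smul (volume : Measure V)
    (fun ξ => Real.fourierChar ⟪ξ, r • x⟫ • m ξ) r
  rw [abs_of_pos (by positivity), Complex.real_smul] at this
  rw [← this]
  congr with ξ
  rw [inner_smul_left, inner_smul_right]
  simp [hr.ne']

theorem lintegral_enorm_fourierInv_comp_inv_smul (m : V → ℂ) {r : ℝ} (hr : 0 < r) (y : V) :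
    ∫⁻ x, ‖𝓕⁻ (fun ξ => m (r⁻¹ • ξ)) (y - x)‖ₑ = ∫⁻ x, ‖𝓕⁻ m x‖ₑ := by
  rw [lintegral_sub_left_eq_self (fun x => ‖𝓕⁻ (fun ξ => m (r⁻¹ • ξ)) x‖ₑ) y]
  simp_rw [fourierInv_comp_inv_smul m hr, enorm_mul]
  rw [lintegral_const_mul' _ _ (by simp), lintegral_comp_smul_of_pos (fun x => ‖𝓕⁻ m x‖ₑ) hr,
    ← mul_assoc,
    ← ofReal_norm, Complex.norm_of_nonneg (by positivity),
    ← ENNReal.ofReal_mul (by positivity), mul_inv_cancel₀ (by positivity), ENNReal.ofReal_one,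
    one_mul]

theorem measurable_fourierInv {m : V → ℂ} (hm : Integrable m) : Measurable (𝓕⁻ m) :=
  Continuous.measurable <| VectorFourier.fourierIntegral_continuous Real.continuous_fourierChar
    (by simp only [LinearMap.neg_apply, innerₗ_apply_apply]; fun_prop) hm

end Fourier

section LittlewoodPaley

variable {V : Type*} [NormedAddCommGroup V] [InnerProductSpace ℝ V]
    [FiniteDimensional ℝ V] [MeasurableSpace V] [BorelSpace V]

namespace MHD.LPF

theorem chi_le_one (χ : LPF V) (ξ : V) : χ.chi ξ ≤ 1 := by
  rw [← χ.eq_one 0 (by simp)]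
  exact χ.radial_antitone _ _ (by simp)

theorem phiHat_eq_zero_of_norm_le_one (χ : LPF V) {ξ : V} (h : ‖ξ‖ ≤ 1) : χ.phiHat ξ = 0 := by
  rw [phiHat, χ.eq_one ξ h, χ.eq_one, sub_self]
  rw [norm_smul]
  norm_num
  linarith

theorem phiHat_eq_zero_of_four_le (χ : LPF V) {ξ : V} (h : 4 ≤ ‖ξ‖) : χ.phiHat ξ = 0 := by
  rw [phiHat, χ.supp ξ (by linarith), χ.supp, sub_self]
  rw [norm_smul]
  norm_num
  linarith

theorem contDiff_phiHat (χ : LPF V) : ContDiff ℝ (⊤ : ℕ∞) χ.phiHat :=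
  (χ.smooth.comp (contDiff_const_smul _)).sub χ.smooth

/-- `φ̂` as a complex-valued Schwartz function. -/
def phiSchwartz (χ : LPF V) : 𝓢(V, ℂ) :=
  HasCompactSupport.toSchwartzMap (f := fun ξ => (χ.phiHat ξ : ℂ))
    (HasCompactSupport.of_support_subset_isCompact (isCompact_closedBall (0 : V) 4) (by
      intro ξ hξ
      by_contra h
      rw [mem_closedBall_zero_iff, not_le] at h
      exact hξ (by simp [χ.phiHat_eq_zero_of_four_le h.le])))
    (Complex.ofRealCLM.contDiff.comp χ.contDiff_phiHat)

@[simp]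
theorem phiSchwartz_apply (χ : LPF V) (ξ : V) : χ.phiSchwartz ξ = (χ.phiHat ξ : ℂ) := rfl

/-- `φ̂(2^{-k}·)` as a complex-valued Schwartz function. -/
def phiSchwartzDilate (χ : LPF V) (k : ℤ) : 𝓢(V, ℂ) :=
  SchwartzMap.compCLMOfContinuousLinearEquiv ℂ
    (ContinuousLinearEquiv.smulLeft (Units.mk0 ((2 : ℝ) ^ (-k)) (by positivity))) χ.phiSchwartz

@[simp]
theorem phiSchwartzDilate_apply (χ : LPF V) (k : ℤ) (ξ : V) :
    χ.phiSchwartzDilate k ξ = (χ.phiHat ((2 : ℝ) ^ (-k) • ξ) : ℂ) := rfl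

/-- The block `Δ̇_k g` of a Schwartz function, as a Schwartz function. -/
def blockSchwartz (χ : LPF V) (k : ℤ) (g : 𝓢(V, ℂ)) : 𝓢(V, ℂ) :=
  𝓕⁻ (SchwartzMap.smulLeftCLM ℂ (χ.phiSchwartzDilate k) (𝓕 g))

theorem fourier_blockSchwartz (χ : LPF V) (k : ℤ) (g : 𝓢(V, ℂ)) (ξ : V) :
    𝓕 (χ.blockSchwartz k g) ξ = χ.phiHat ((2 : ℝ) ^ (-k) • ξ) * 𝓕 g ξ := by
  rw [blockSchwartz, FourierTransform.fourier_fourierInv_eq,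
    SchwartzMap.smulLeftCLM_apply_apply (χ.phiSchwartzDilate k).hasTemperateGrowth]
  rfl

theorem coe_blockSchwartz (χ : LPF V) (k : ℤ) (g : 𝓢(V, ℂ)) :
    ⇑(χ.blockSchwartz k g) = χ.block k g := by
  rw [blockSchwartz, SchwartzMap.fourierInv_coe,
    SchwartzMap.smulLeftCLM_apply (χ.phiSchwartzDilate k).hasTemperateGrowth]
  rfl

theorem blockSchwartz_sum {ι : Type*} (χ : LPF V) (k : ℤ) (s : Finset ι) (g : ι → 𝓢(V, ℂ)) :
    χ.blockSchwartz k (∑ i ∈ s, g i) = ∑ i ∈ s, χ.blockSchwartz k (g i) := by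
  simp only [blockSchwartz, FourierTransform.fourier_sum, map_sum,
    FourierTransform.fourierInv_sum]

theorem block_eq_integral (χ : LPF V) (k : ℤ) {f : V → ℂ} (hf : Integrable f) (y : V) :
    χ.block k f y =
      ∫ x, 𝓕⁻ (fun ξ => χ.phiSchwartz (((2 : ℝ) ^ k)⁻¹ • ξ)) (y - x) * f x := by
  rw [← fourierInv_mul_fourier _ hf, block]
  · simp only [zpow_neg, phiSchwartz_apply]
  · rw [← zpow_neg]
    exact (χ.phiSchwartzDilate k).integrable

theorem sum_range_phiHat (χ : LPF V) (a : ℤ) (m : ℕ) (ξ : V) :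
    ∑ i ∈ Finset.range m, χ.phiHat ((2 : ℝ) ^ (-(a + i)) • ξ) =
      χ.chi ((2 : ℝ) ^ (-(a + m)) • ξ) - χ.chi ((2 : ℝ) ^ (-a) • ξ) := by
  have h : ∀ i : ℕ, χ.phiHat ((2 : ℝ) ^ (-(a + i)) • ξ) =
      χ.chi ((2 : ℝ) ^ (-(a + (i + 1 : ℕ))) • ξ) - χ.chi ((2 : ℝ) ^ (-(a + i)) • ξ) := by
    intro i
    rw [phiHat, smul_smul]
    congr 3
    rw [← zpow_neg_one, ← zpow_add₀ two_ne_zero]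
    congr 1
    push_cast
    ring
  simp_rw [h]
  rw [Finset.sum_range_sub (fun i : ℕ => χ.chi ((2 : ℝ) ^ (-(a + i)) • ξ))]
  simp

/-- A Schwartz symbol inverting `-4π²|ξ|²` on the support of `φ̂`. -/
theorem exists_inverse_laplacian_symbol (χ : LPF V) :
    ∃ M : 𝓢(V, ℂ), ∀ ξ, χ.phiHat ξ ≠ 0 →
      M ξ * (-(4 * (Real.pi : ℂ) ^ 2 * ((‖ξ‖ ^ 2 : ℝ) : ℂ))) = 1 := by
  let w : V → ℝ := fun ξ =>
    (χ.chi ((4 : ℝ)⁻¹ • ξ) - χ.chi ((2 : ℝ) • ξ)) * (-(4 * Real.pi ^ 2 * ‖ξ‖ ^ 2))⁻¹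
  have hsmooth : ContDiff ℝ (⊤ : ℕ∞) w := by
    rw [contDiff_iff_contDiffAt]
    intro ξ
    by_cases h : ξ = 0
    · subst h
      refine ContDiffAt.congr_of_eventuallyEq (f := fun _ => (0 : ℝ)) contDiffAt_const ?_
      filter_upwards [Metric.ball_mem_nhds (0 : V) (ε := 1 / 2) (by norm_num)] with ξ hξ
      rw [mem_ball_zero_iff] at hξ
      simp only [w]
      rw [χ.eq_one, χ.eq_one, sub_self, zero_mul]
      · rw [norm_smul]
        norm_num
        linarith
      · rw [norm_smul]
        norm_num
        linarith
    · have hne : -(4 * Real.pi ^ 2 * ‖ξ‖ ^ 2) ≠ 0 := by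
        have : ‖ξ‖ ≠ 0 := norm_ne_zero_iff.2 h
        simp [this, Real.pi_ne_zero]
      refine ContDiffAt.mul ?_ (ContDiffAt.inv ?_ hne)
      · exact ((χ.smooth.comp (contDiff_const_smul _)).sub
          (χ.smooth.comp (contDiff_const_smul _))).contDiffAt
      · exact (contDiff_const.mul (contDiff_norm_sq ℝ)).neg.contDiffAt
  have hsupp : HasCompactSupport (fun ξ => (w ξ : ℂ)) := by
    refine HasCompactSupport.of_support_subset_isCompact (isCompact_closedBall (0 : V) 8) ?_
    intro ξ hξ
    by_contra h
    rw [mem_closedBall_zero_iff, not_le] at h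
    refine hξ ?_
    simp only [w]
    rw [χ.supp, χ.supp]
    · simp
    all_goals
      rw [norm_smul]
      norm_num
      linarith
  refine ⟨hsupp.toSchwartzMap (Complex.ofRealCLM.contDiff.comp hsmooth), fun ξ hξ => ?_⟩
  have h1 : 1 ≤ ‖ξ‖ := by
    by_contra! h
    exact hξ (χ.phiHat_eq_zero_of_norm_le_one h.le)
  have h4 : ‖ξ‖ ≤ 4 := by
    by_contra! h
    exact hξ (χ.phiHat_eq_zero_of_four_le h.le)
  have hw : w ξ = (-(4 * Real.pi ^ 2 * ‖ξ‖ ^ 2))⁻¹ := by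
    simp only [w]
    rw [χ.eq_one, χ.supp]
    · ring
    all_goals
      rw [norm_smul]
      norm_num
      linarith
  change ((w ξ : ℝ) : ℂ) * _ = 1
  rw [hw]
  have : ‖ξ‖ ≠ 0 := by positivity
  have hpi := Real.pi_ne_zero
  norm_cast
  field_simp

end MHD.LPF

end LittlewoodPaley

section Slices

variable {n : ℕ}

/-- The tangential part `ξ' ∈ ℝ^n` of `ξ ∈ ℝ^{n+1}`. -/
def tangential (n : ℕ) : Euc (n + 1) →ₗ[ℝ] Euc n where
  toFun ξ := WithLp.toLp 2 fun i => ξ i.castSucc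
  map_add' _ _ := rfl
  map_smul' _ _ := rfl

@[simp]
theorem tangential_apply (ξ : Euc (n + 1)) (i : Fin n) : tangential n ξ i = ξ i.castSucc := rfl

theorem continuous_tangential : Continuous (tangential n) :=
  (tangential n).continuous_of_finiteDimensional

theorem norm_tangential_le (ξ : Euc (n + 1)) : ‖tangential n ξ‖ ≤ ‖ξ‖ := by
  rw [EuclideanSpace.norm_eq, EuclideanSpace.norm_eq, Fin.sum_univ_castSucc]
  apply Real.sqrt_le_sqrt
  simp only [tangential_apply]
  exact le_add_of_nonneg_right (by positivity)

@[simp]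
theorem join_castSucc (y : Euc n) (η : ℝ) (i : Fin n) : join y η i.castSucc = y i := by
  simp [join]

@[simp]
theorem join_last (y : Euc n) (η : ℝ) : join y η (Fin.last n) = η := by
  simp [join]

@[simp]
theorem tangential_join (y : Euc n) (η : ℝ) : tangential n (join y η) = y := by
  ext i
  simp

theorem norm_sub_tangential_le (y : Euc n) (η : ℝ) (z : Euc (n + 1)) :
    ‖y - tangential n z‖ ≤ ‖join y η - z‖ := by
  simpa using norm_tangential_le (join y η - z)

theorem inner_join (ξ : Euc (n + 1)) (y : Euc n) (η : ℝ) :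
    ⟪ξ, join y η⟫ = ⟪tangential n ξ, y⟫ + η * ξ (Fin.last n) := by
  simp [PiLp.inner_apply, Fin.sum_univ_castSucc]

theorem continuous_join (η : ℝ) : Continuous fun y : Euc n => join y η := by
  refine (PiLp.continuous_toLp 2 _).comp (continuous_pi fun i => ?_)
  refine Fin.lastCases ?_ (fun i => ?_) i
  · simp only [Fin.snoc_last]
    fun_prop
  · simp only [Fin.snoc_castSucc]
    fun_prop

theorem SchwartzMap.exists_norm_le_one_add_norm_rpow {V : Type*} [NormedAddCommGroup V]
    [NormedSpace ℝ V] (h : 𝓢(V, ℂ)) (k : ℕ) :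
    ∃ C : ℝ, 0 ≤ C ∧ ∀ x, ‖h x‖ ≤ C * (1 + ‖x‖) ^ (-(k : ℝ)) := by
  refine ⟨2 ^ k * (Finset.Iic (k, 0)).sup (fun m => SchwartzMap.seminorm ℝ m.1 m.2) h,
    by positivity, fun x => ?_⟩
  have := SchwartzMap.one_add_le_sup_seminorm_apply (𝕜 := ℝ) (m := (k, 0)) le_rfl le_rfl h x
  rw [norm_iteratedFDeriv_zero] at this
  rw [Real.rpow_neg (by positivity), Real.rpow_natCast, ← div_eq_mul_inv,
    le_div_iff₀ (by positivity), mul_comm]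
  exact this

/-- Integrals of a dilated Schwartz function over the hyperplanes `{η = const}`. -/
theorem exists_lintegral_slice_le (h : 𝓢(Euc (n + 1), ℂ)) :
    ∃ B : ℝ≥0∞, B ≠ ⊤ ∧ ∀ (r : ℝ), 0 < r → ∀ (η : ℝ) (z : Euc (n + 1)),
      ∫⁻ y : Euc n, ‖h (r • (join y η - z))‖ₑ ≤ ENNReal.ofReal ((r ^ n)⁻¹) * B := by
  obtain ⟨C, hC, hbound⟩ := h.exists_norm_le_one_add_norm_rpow (n + 1)
  let w : Euc n → ℝ≥0∞ := fun y => ENNReal.ofReal ((1 + ‖y‖) ^ (-((n + 1 : ℕ) : ℝ)))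
  refine ⟨ENNReal.ofReal C * ∫⁻ y, w y, ?_, fun r hr η z => ?_⟩
  · refine ENNReal.mul_ne_top ENNReal.ofReal_ne_top (ne_of_lt ?_)
    apply finite_integral_one_add_norm
    simp
  · calc ∫⁻ y : Euc n, ‖h (r • (join y η - z))‖ₑ
        ≤ ∫⁻ y : Euc n, ENNReal.ofReal C * w (r • (y - tangential n z)) := by
          refine lintegral_mono fun y => ?_
          simp only [w]
          rw [← ENNReal.ofReal_mul hC, ← ofReal_norm]
          refine ENNReal.ofReal_le_ofReal ((hbound _).trans ?_)
          gcongr ?_ * ?_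
          apply Real.rpow_le_rpow_of_nonpos (by positivity)
          · rw [norm_smul, norm_smul]
            gcongr
            exact norm_sub_tangential_le y η z
          · simp only [Left.neg_nonpos_iff]
            positivity
      _ = _ := by
          rw [lintegral_const_mul' _ _ ENNReal.ofReal_ne_top,
            lintegral_sub_right_eq_self (fun y => w (r • y)), lintegral_comp_smul_of_pos _ hr,
            finrank_euclideanSpace_fin]
          ring

theorem integrable_slice (h : 𝓢(Euc (n + 1), ℂ)) (η : ℝ) :
    Integrable fun y : Euc n => h (join y η) := by
  obtain ⟨B, hB, hle⟩ := exists_lintegral_slice_le h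
  refine ⟨(h.continuous.comp (continuous_join η)).aestronglyMeasurable, ?_⟩
  have := hle 1 one_pos η 0
  simp only [sub_zero, one_smul] at this
  exact this.trans_lt (ENNReal.mul_lt_top ENNReal.ofReal_lt_top hB.lt_top)

/-- A tangential block of a slice, as a Fourier multiplier on the whole space. -/
theorem block_slice_eq (χ : LPF (Euc n)) (j : ℤ) (h : 𝓢(Euc (n + 1), ℂ)) (η : ℝ) (y : Euc n) :
    χ.block j (fun y' => h (join y' η)) y =
      ∫ ξ, (χ.phiHat ((2 : ℝ) ^ (-j) • tangential n ξ) : ℂ) *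
        (Real.fourierChar ⟪ξ, join y η⟫ • 𝓕 h ξ) := by
  let K : 𝓢(Euc n, ℂ) := 𝓕⁻ (χ.phiSchwartzDilate j)
  have hK : 𝓕 (K : Euc n → ℂ) = χ.phiSchwartzDilate j := by
    rw [← SchwartzMap.fourier_coe, FourierTransform.fourier_fourierInv_eq]
  have hK' : (K : Euc n → ℂ) = 𝓕⁻ (fun ξ => χ.phiSchwartz (((2 : ℝ) ^ j)⁻¹ • ξ)) := by
    rw [SchwartzMap.fourierInv_coe, ← zpow_neg]
    rfl
  rw [LPF.block_eq_integral χ j (integrable_slice h η), ← hK',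
    ← integral_sub_left_eq_self _ _ y]
  simp only [sub_sub_cancel]
  have hg : Integrable (fun ξ : Euc (n + 1) => Real.fourierChar ⟪ξ, join y η⟫ • 𝓕 h ξ) := by
    have := (Real.fourierIntegral_convergent_iff (f := ⇑(𝓕 h : 𝓢(Euc (n + 1), ℂ)))
      (-(join y η))).2 ((𝓕 h : 𝓢(Euc (n + 1), ℂ)).integrable (μ := volume))
    simpa using this
  have key := VectorFourier.integral_fourierIntegral_smul_eq_flip (μ := (volume : Measure (Euc n)))
    (ν := (volume : Measure (Euc (n + 1)))) (L := (innerₗ (Euc n)).compl₂ (tangential n))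
    Real.continuous_fourierChar (by
      simp only [LinearMap.compl₂_apply, innerₗ_apply_apply]
      exact continuous_fst.inner (continuous_tangential.comp continuous_snd)) K.integrable hg
  have e1 : ∀ ξ, VectorFourier.fourierIntegral Real.fourierChar volume
      ((innerₗ (Euc n)).compl₂ (tangential n)) K ξ =
        (χ.phiHat ((2 : ℝ) ^ (-j) • tangential n ξ) : ℂ) := by
    intro ξ
    exact congrFun hK (tangential n ξ)
  have e2 : ∀ x, VectorFourier.fourierIntegral Real.fourierChar volume
      ((innerₗ (Euc n)).compl₂ (tangential n)).flip
        (fun ξ : Euc (n + 1) => Real.fourierChar ⟪ξ, join y η⟫ • 𝓕 h ξ) x =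
        h (join (y - x) η) := by
    intro x
    conv_rhs => rw [← FourierTransform.fourierInv_fourier_eq (F := 𝓢(Euc (n + 1), ℂ)) h]
    rw [SchwartzMap.fourierInv_coe, Real.fourierInv_eq, VectorFourier.fourierIntegral]
    congr with ξ
    rw [smul_smul, ← AddChar.map_add_eq_mul, inner_join, inner_join, inner_sub_right]
    simp only [LinearMap.flip_apply, LinearMap.compl₂_apply, innerₗ_apply_apply]
    rw [real_inner_comm x]
    congr 2
    ring
  simp_rw [e1, e2, smul_eq_mul] at key
  exact key.symm

theorem continuous_block (χ : LPF (Euc n)) (j : ℤ) {f : Euc n → ℂ} (hf : Integrable f) :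
    Continuous (χ.block j f) := by
  refine VectorFourier.fourierIntegral_continuous Real.continuous_fourierChar
    (by simp only [LinearMap.neg_apply, innerₗ_apply_apply]; fun_prop) ?_
  have h1 : Continuous (𝓕 f) := VectorFourier.fourierIntegral_continuous
    Real.continuous_fourierChar (by simp only [innerₗ_apply_apply]; fun_prop) hf
  refine (χ.phiSchwartzDilate j).integrable.mul_bdd (c := ∫ x, ‖f x‖)
    h1.aestronglyMeasurable (Eventually.of_forall fun ξ => ?_)
  exact VectorFourier.norm_fourierIntegral_le_integral_norm _ _ _ _ _

theorem tendsto_sum_block_slice (χtan : LPF (Euc n)) (χfull : LPF (Euc (n + 1))) (j : ℤ)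
    (g : 𝓢(Euc (n + 1), ℂ)) (η : ℝ) (y : Euc n) :
    Tendsto (fun m : ℕ => ∑ i ∈ Finset.range m,
        χtan.block j (fun y' => χfull.blockSchwartz (j - 1 + i) g (join y' η)) y) atTop
      (𝓝 (χtan.block j (fun y' => g (join y' η)) y)) := by
  let a : Euc (n + 1) → ℂ := fun ξ => (χtan.phiHat ((2 : ℝ) ^ (-j) • tangential n ξ) : ℂ) *
        (Real.fourierChar ⟪ξ, join y η⟫ • 𝓕 g ξ)
  have hφ : ∃ c : ℝ, ∀ ξ, ‖(χtan.phiHat ξ : ℂ)‖ ≤ c :=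
    ⟨_, fun ξ => SchwartzMap.norm_le_seminorm ℝ χtan.phiSchwartz ξ⟩
  obtain ⟨c, hc⟩ := hφ
  have hcontφ : Continuous fun ξ : Euc (n + 1) =>
      (χtan.phiHat ((2 : ℝ) ^ (-j) • tangential n ξ) : ℂ) :=
    (χtan.phiSchwartzDilate j).continuous.comp continuous_tangential
  have hg : Integrable (fun ξ : Euc (n + 1) => Real.fourierChar ⟪ξ, join y η⟫ • 𝓕 g ξ) := by
    have := (Real.fourierIntegral_convergent_iff (f := ⇑(𝓕 g : 𝓢(Euc (n + 1), ℂ)))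
      (-(join y η))).2 ((𝓕 g : 𝓢(Euc (n + 1), ℂ)).integrable (μ := volume))
    simpa using this
  have ha : Integrable a :=
    hg.bdd_mul hcontφ.aestronglyMeasurable (Eventually.of_forall fun ξ => hc _)
  have hterm : ∀ i : ℕ, χtan.block j
      (fun y' => χfull.blockSchwartz (j - 1 + i) g (join y' η)) y =
        ∫ ξ, (χfull.phiHat ((2 : ℝ) ^ (-(j - 1 + i)) • ξ) : ℂ) * a ξ := by
    intro i
    rw [block_slice_eq]
    congr with ξ
    rw [LPF.fourier_blockSchwartz]
    simp only [a, Circle.smul_def, smul_eq_mul]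
    ring
  have hsum : ∀ m : ℕ, ∑ i ∈ Finset.range m, χtan.block j
      (fun y' => χfull.blockSchwartz (j - 1 + i) g (join y' η)) y =
        ∫ ξ, (χfull.chi ((2 : ℝ) ^ (-(j - 1 + m)) • ξ) : ℂ) * a ξ := by
    intro m
    simp_rw [hterm]
    rw [← integral_finsetSum]
    · congr with ξ
      rw [← Finset.sum_mul, ← Complex.ofReal_sum, LPF.sum_range_phiHat]
      by_cases h0 : χtan.phiHat ((2 : ℝ) ^ (-j) • tangential n ξ) = 0
      · have ha0 : a ξ = 0 := by
          simp only [a]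
          rw [h0]
          simp
        rw [ha0, mul_zero, mul_zero]
      · rw [χfull.supp ((2 : ℝ) ^ (-(j - 1)) • ξ), sub_zero]
        have h1 : 1 ≤ ‖(2 : ℝ) ^ (-j) • tangential n ξ‖ := by
          by_contra! h
          exact h0 (χtan.phiHat_eq_zero_of_norm_le_one h.le)
        rw [norm_smul, Real.norm_of_nonneg (by positivity)] at h1 ⊢
        have h2 : (2 : ℝ) ^ (-(j - 1)) = 2 * 2 ^ (-j) := by
          rw [neg_sub, sub_eq_add_neg, zpow_add₀ two_ne_zero, zpow_one]
        rw [h2, mul_assoc]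
        have h3 : (2 : ℝ) ^ (-j) * ‖tangential n ξ‖ ≤ 2 ^ (-j) * ‖ξ‖ := by
          gcongr
          exact norm_tangential_le ξ
        linarith
    · intro i _
      refine ha.bdd_mul (c := SchwartzMap.seminorm ℝ 0 0 χfull.phiSchwartz)
        (χfull.phiSchwartzDilate _).continuous.aestronglyMeasurable
        (Eventually.of_forall fun ξ => ?_)
      exact SchwartzMap.norm_le_seminorm ℝ χfull.phiSchwartz _
  simp_rw [hsum]
  rw [block_slice_eq]
  refine tendsto_integral_of_dominated_convergence (fun ξ => ‖a ξ‖) (fun m => ?_) ha.norm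
    (fun m => Eventually.of_forall fun ξ => ?_) (Eventually.of_forall fun ξ => ?_)
  · refine (Continuous.aestronglyMeasurable ?_).mul ha.1
    exact Complex.continuous_ofReal.comp (χfull.smooth.continuous.comp (continuous_const_smul _))
  · rw [norm_mul, Complex.norm_of_nonneg (χfull.nonneg _)]
    exact mul_le_of_le_one_left (norm_nonneg _) (χfull.chi_le_one _)
  · refine tendsto_const_nhds.congr' ?_
    have hlim : Tendsto (fun m : ℕ => (2 : ℝ) ^ (-(j - 1)) * (1 / 2) ^ m * ‖ξ‖) atTop (𝓝 0) := by
      have := ((tendsto_pow_atTop_nhds_zero_of_lt_one (r := (1 / 2 : ℝ)) (by norm_num)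
        (by norm_num)).const_mul ((2 : ℝ) ^ (-(j - 1)))).mul_const ‖ξ‖
      simpa using this
    filter_upwards [hlim.eventually_le_const one_pos] with m hm
    rw [χfull.eq_one, Complex.ofReal_one, one_mul]
    rw [norm_smul, Real.norm_of_nonneg (by positivity), neg_add, zpow_add₀ two_ne_zero,
      zpow_neg _ (m : ℤ), zpow_natCast]
    simpa using hm

end Slices

section Bernstein

open scoped Laplacian LineDeriv

variable {n : ℕ}

theorem SchwartzMap.lintegral_enorm_lt_top {V : Type*} [NormedAddCommGroup V]
    [InnerProductSpace ℝ V] [FiniteDimensional ℝ V] [MeasurableSpace V] [BorelSpace V]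
    (h : 𝓢(V, ℂ)) : ∫⁻ x, ‖h x‖ₑ < ⊤ :=
  h.integrable.2

theorem fourier_laplacian_apply (g : 𝓢(Euc n, ℂ)) (ξ : Euc n) :
    𝓕 (Δ g) ξ = -(4 * (Real.pi : ℂ) ^ 2 * ((‖ξ‖ ^ 2 : ℝ) : ℂ)) * 𝓕 g ξ := by
  have hd : ∀ (v : Euc n) (u : 𝓢(Euc n, ℂ)),
      𝓕 (∂_{v} u) ξ = 2 * Real.pi * Complex.I * (⟪ξ, v⟫ : ℝ) * 𝓕 u ξ := by
    intro v u
    have hv : (inner ℝ · v : Euc n → ℝ).HasTemperateGrowth :=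
      ((innerSL ℝ).flip v).hasTemperateGrowth
    rw [SchwartzMap.fourier_lineDerivOp_eq, smul_apply,
      SchwartzMap.smulLeftCLM_apply_apply hv]
    simp only [smul_eq_mul, Complex.real_smul]
    ring
  rw [SchwartzMap.laplacian_eq_sum (EuclideanSpace.basisFun (Fin n) ℝ),
    FourierTransform.fourier_sum, sum_apply]
  simp only [hd]
  rw [EuclideanSpace.norm_sq_eq, Complex.ofReal_sum, Finset.mul_sum, ← Finset.sum_neg_distrib,
    Finset.sum_mul]
  refine Finset.sum_congr rfl fun i _ => ?_
  simp only [EuclideanSpace.basisFun_apply, EuclideanSpace.inner_single_right,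
    Real.norm_eq_abs, sq_abs]
  simp
  ring_nf
  simp

theorem exists_eLpNorm_block_slice_le (χ : LPF (Euc n)) {p : ℝ} (hp : 1 < p) :
    ∃ C : ℝ≥0∞, C ≠ ⊤ ∧ ∀ (j : ℤ) (f : Euc n → ℂ), Integrable f → Continuous f →
      eLpNorm (χ.block j f) (ENNReal.ofReal p) volume ≤
        C * eLpNorm f (ENNReal.ofReal p) volume := by
  let A : ℝ≥0∞ := ∫⁻ x, ‖𝓕⁻ (χ.phiSchwartz : Euc n → ℂ) x‖ₑ
  have hA : A ≠ ⊤ := by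
    simp only [A]
    rw [← SchwartzMap.fourierInv_coe]
    exact (SchwartzMap.lintegral_enorm_lt_top _).ne
  have hp1 : 0 ≤ 1 / p := by positivity
  have hp2 : 0 ≤ 1 - 1 / p := by
    rw [sub_nonneg, div_le_one (by linarith)]
    exact hp.le
  refine ⟨A ^ (1 - 1 / p) * A ^ (1 / p), ?_, fun j f hf hfc => ?_⟩
  · exact ENNReal.mul_ne_top (ENNReal.rpow_ne_top_of_nonneg hp2 hA)
      (ENNReal.rpow_ne_top_of_nonneg hp1 hA)
  · refine eLpNorm_le_of_schur
      (k := fun y x => 𝓕⁻ (fun ξ => χ.phiSchwartz (((2 : ℝ) ^ j)⁻¹ • ξ)) (y - x)) ?_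
      hfc.measurable hp (fun y => ?_) (fun x => ?_) (LPF.block_eq_integral χ j hf)
    · refine (measurable_fourierInv ?_).comp (measurable_fst.sub measurable_snd)
      rw [← zpow_neg]
      exact (χ.phiSchwartzDilate j).integrable
    · exact (lintegral_enorm_fourierInv_comp_inv_smul _ (by positivity) y).le
    · rw [lintegral_sub_right_eq_self
        (fun y => ‖𝓕⁻ (fun ξ => χ.phiSchwartz (((2 : ℝ) ^ j)⁻¹ • ξ)) y‖ₑ) x]
      have := lintegral_enorm_fourierInv_comp_inv_smul χ.phiSchwartz
        (r := (2 : ℝ) ^ j) (by positivity) 0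
      rw [lintegral_sub_left_eq_self
        (fun y => ‖𝓕⁻ (fun ξ => χ.phiSchwartz (((2 : ℝ) ^ j)⁻¹ • ξ)) y‖ₑ)] at this
      exact this.le

/-- Bernstein inequality: restricting a Littlewood–Paley block to a hyperplane costs `1/p`
derivatives in `L^p`, and inverting the Laplacian gains two. -/
theorem exists_eLpNorm_slice_block_le (χ : LPF (Euc (n + 1))) {p : ℝ} (hp : 1 < p) :
    ∃ C : ℝ≥0∞, C ≠ ⊤ ∧ ∀ (k : ℤ) (g : 𝓢(Euc (n + 1), ℂ)) (η : ℝ),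
      eLpNorm (fun y => χ.blockSchwartz k g (join y η)) (ENNReal.ofReal p) volume ≤
        C * (ENNReal.ofReal ((2 : ℝ) ^ ((1 / p - 2) * (k : ℝ))) *
          eLpNorm (χ.blockSchwartz k (Δ g)) (ENNReal.ofReal p) volume) := by
  obtain ⟨M, hM⟩ := χ.exists_inverse_laplacian_symbol
  obtain ⟨B, hB, hBle⟩ := exists_lintegral_slice_le (𝓕⁻ M : 𝓢(Euc (n + 1), ℂ))
  rw [SchwartzMap.fourierInv_coe] at hBle
  let A : ℝ≥0∞ := ∫⁻ x, ‖𝓕⁻ (M : Euc (n + 1) → ℂ) x‖ₑ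
  have hA : A ≠ ⊤ := by
    simp only [A]
    rw [← SchwartzMap.fourierInv_coe]
    exact (SchwartzMap.lintegral_enorm_lt_top _).ne
  have hp1 : 0 ≤ 1 / p := by positivity
  have hp2 : 0 ≤ 1 - 1 / p := by
    rw [sub_nonneg, div_le_one (by linarith)]
    exact hp.le
  refine ⟨A ^ (1 - 1 / p) * B ^ (1 / p), ?_, fun k g η => ?_⟩
  · exact ENNReal.mul_ne_top (ENNReal.rpow_ne_top_of_nonneg hp2 hA)
      (ENNReal.rpow_ne_top_of_nonneg hp1 hB)
  · obtain ⟨r, hrk⟩ : ∃ r : ℝ, r = 2 ^ k := ⟨_, rfl⟩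
    have hr : 0 < r := by rw [hrk]; positivity
    have hm : Integrable fun ξ => M (r⁻¹ • ξ) := by
      rw [integrable_comp_smul_iff _ _ (by positivity)]
      exact M.integrable
    have hrep : ∀ x, χ.blockSchwartz k g x = ((r ^ 2 : ℝ) : ℂ)⁻¹ *
        ∫ z, 𝓕⁻ (fun ξ => M (r⁻¹ • ξ)) (x - z) * χ.blockSchwartz k (Δ g) z := by
      intro x
      rw [← fourierInv_mul_fourier hm (SchwartzMap.integrable _)]
      conv_lhs => rw [← FourierTransform.fourierInv_fourier_eq (F := 𝓢(Euc (n + 1), ℂ))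
        (χ.blockSchwartz k g)]
      rw [SchwartzMap.fourierInv_coe, Real.fourierInv_eq, Real.fourierInv_eq,
        ← integral_const_mul]
      congr with ξ
      rw [mul_smul_comm, ← SchwartzMap.fourier_coe, LPF.fourier_blockSchwartz,
        LPF.fourier_blockSchwartz, fourier_laplacian_apply]
      congr 1
      have hk : (2 : ℝ) ^ (-k) • ξ = r⁻¹ • ξ := by rw [hrk, zpow_neg]
      rw [hk]
      by_cases h0 : χ.phiHat (r⁻¹ • ξ) = 0
      · simp [h0]
      · have h1 := hM _ h0
        have h2 : ‖ξ‖ ^ 2 = r ^ 2 * ‖r⁻¹ • ξ‖ ^ 2 := by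
          rw [norm_smul, Real.norm_of_nonneg (by positivity)]
          field_simp
        have h3 : ((r ^ 2 : ℝ) : ℂ) ≠ 0 := by
          rw [Complex.ofReal_ne_zero]
          positivity
        rw [h2, Complex.ofReal_mul, eq_inv_mul_iff_mul_eq₀ h3]
        linear_combination (-((r ^ 2 : ℝ) : ℂ) * (χ.phiHat (r⁻¹ • ξ) : ℂ) * 𝓕 g ξ) * h1
    have hschur : eLpNorm (fun y => ∫ z, 𝓕⁻ (fun ξ => M (r⁻¹ • ξ)) (join y η - z) *
          χ.blockSchwartz k (Δ g) z) (ENNReal.ofReal p) volume ≤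
        A ^ (1 - 1 / p) * (ENNReal.ofReal r * B) ^ (1 / p) *
          eLpNorm (χ.blockSchwartz k (Δ g)) (ENNReal.ofReal p) volume := by
      refine eLpNorm_le_of_schur
        (k := fun y z => 𝓕⁻ (fun ξ => M (r⁻¹ • ξ)) (join y η - z)) ?_
        (χ.blockSchwartz k (Δ g)).continuous.measurable hp (fun y => ?_) (fun z => ?_)
        (fun _ => rfl)
      · exact (measurable_fourierInv hm).comp
          (((continuous_join η).measurable.comp measurable_fst).sub measurable_snd)
      · exact (lintegral_enorm_fourierInv_comp_inv_smul _ hr _).le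
      · simp_rw [fourierInv_comp_inv_smul _ hr, enorm_mul]
        rw [lintegral_const_mul' _ _ (by simp)]
        refine (mul_le_mul_right (hBle r hr η z) _).trans_eq ?_
        rw [← mul_assoc, ← ofReal_norm, Complex.norm_of_nonneg (by positivity),
          ← ENNReal.ofReal_mul (by positivity), finrank_euclideanSpace_fin, pow_succ]
        congr 2
        field_simp
    simp_rw [hrep]
    have hconst := eLpNorm_const_smul (((r ^ 2 : ℝ) : ℂ)⁻¹)
      (fun y : Euc n => ∫ z, 𝓕⁻ (fun ξ => M (r⁻¹ • ξ)) (join y η - z) *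
          χ.blockSchwartz k (Δ g) z) (ENNReal.ofReal p) volume
    refine hconst.trans_le ((mul_le_mul_right hschur _).trans_eq ?_)
    rw [ENNReal.mul_rpow_of_nonneg _ _ hp1, ENNReal.ofReal_rpow_of_pos hr, ← ofReal_norm,
      norm_inv, Complex.norm_of_nonneg (by positivity)]
    have hpow : (2 : ℝ) ^ ((1 / p - 2) * (k : ℝ)) = (r ^ 2)⁻¹ * r ^ (1 / p) := by
      rw [hrk, ← Real.rpow_intCast, ← Real.rpow_natCast, ← Real.rpow_mul (by norm_num),
        ← Real.rpow_mul (by norm_num), ← Real.rpow_neg (by norm_num),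
        ← Real.rpow_add (by norm_num)]
      congr 1
      push_cast
      ring
    rw [hpow, ENNReal.ofReal_mul (by positivity)]
    ring

theorem eLpNorm_block_laplacian_le (χ : LPF (Euc n)) {p : ℝ} (hp : 1 ≤ p) (k : ℤ)
    (g : 𝓢(Euc n, ℂ)) :
    eLpNorm (χ.blockSchwartz k (Δ g)) (ENNReal.ofReal p) volume ≤
      ∑ i : Fin n, eLpNorm (χ.blockSchwartz k
        (∂_{EuclideanSpace.single i (1 : ℝ)} (∂_{EuclideanSpace.single i (1 : ℝ)} g)))
        (ENNReal.ofReal p) volume := by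
  rw [SchwartzMap.laplacian_eq_sum (EuclideanSpace.basisFun (Fin n) ℝ), LPF.blockSchwartz_sum]
  simp only [EuclideanSpace.basisFun_apply]
  have hcoe : ∀ u : Fin n → 𝓢(Euc n, ℂ), ⇑(∑ i, u i) = ∑ i, ⇑(u i) := by
    intro u
    ext x
    rw [sum_apply, Finset.sum_apply]
  rw [hcoe]
  exact eLpNorm_sum_le (fun i _ => (SchwartzMap.continuous _).aestronglyMeasurable)
    (by simpa using hp)

end Bernstein

section PointwiseInTime

open scoped Laplacian LineDeriv

variable {n : ℕ}

/-- A discrete Young inequality against the geometric weights `2^{σ(1-i)}`, `i ∈ ℕ`. -/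
theorem exists_tsum_weight_mul_tsum_le {σ : ℝ} (hσ : 0 < σ) :
    ∃ C : ℝ≥0∞, C ≠ ⊤ ∧ ∀ b : ℤ → ℝ≥0∞,
      ∑' j : ℤ, ENNReal.ofReal ((2 : ℝ) ^ (σ * (j : ℝ))) * ∑' i : ℕ, b (j - 1 + i) ≤
        C * ∑' k : ℤ, ENNReal.ofReal ((2 : ℝ) ^ (σ * (k : ℝ))) * b k := by
  let c : ℕ → ℝ≥0∞ := fun i => ENNReal.ofReal ((2 : ℝ) ^ σ) * ENNReal.ofReal ((2 : ℝ) ^ (-σ)) ^ i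
  refine ⟨∑' i, c i, ?_, fun b => le_of_eq ?_⟩
  · simp only [c]
    rw [ENNReal.tsum_mul_left, ENNReal.tsum_geometric]
    refine ENNReal.mul_ne_top ENNReal.ofReal_ne_top (ENNReal.inv_ne_top.2 ?_)
    rw [← pos_iff_ne_zero, tsub_pos_iff_lt, ENNReal.ofReal_lt_one]
    exact Real.rpow_lt_one_of_one_lt_of_neg one_lt_two (by linarith)
  · have hw : ∀ (j : ℤ) (i : ℕ), ENNReal.ofReal ((2 : ℝ) ^ (σ * (j : ℝ))) =
        c i * ENNReal.ofReal ((2 : ℝ) ^ (σ * ((j - 1 + i : ℤ) : ℝ))) := by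
      intro j i
      simp only [c]
      rw [← ENNReal.ofReal_pow (by positivity), ← ENNReal.ofReal_mul (by positivity),
        ← ENNReal.ofReal_mul (by positivity), ← Real.rpow_natCast,
        ← Real.rpow_mul (by norm_num), ← Real.rpow_add (by norm_num),
        ← Real.rpow_add (by norm_num)]
      congr 2
      push_cast
      ring
    calc ∑' j : ℤ, ENNReal.ofReal ((2 : ℝ) ^ (σ * (j : ℝ))) * ∑' i : ℕ, b (j - 1 + i)
        = ∑' (j : ℤ) (i : ℕ), c i *
            (ENNReal.ofReal ((2 : ℝ) ^ (σ * ((j - 1 + i : ℤ) : ℝ))) * b (j - 1 + i)) := by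
          refine tsum_congr fun j => ?_
          rw [← ENNReal.tsum_mul_left]
          exact tsum_congr fun i => by rw [hw j i, mul_assoc]
      _ = ∑' (i : ℕ) (j : ℤ), c i *
            (ENNReal.ofReal ((2 : ℝ) ^ (σ * ((j - 1 + i : ℤ) : ℝ))) * b (j - 1 + i)) :=
          ENNReal.tsum_comm
      _ = ∑' i : ℕ, c i * ∑' k : ℤ, ENNReal.ofReal ((2 : ℝ) ^ (σ * (k : ℝ))) * b k := by
          refine tsum_congr fun i => ?_
          rw [ENNReal.tsum_mul_left]
          congr 1
          exact ((Equiv.subRight (1 : ℤ)).trans (Equiv.addRight (i : ℤ))).tsum_eq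
            fun k : ℤ => ENNReal.ofReal ((2 : ℝ) ^ (σ * (k : ℝ))) * b k
      _ = _ := ENNReal.tsum_mul_right

theorem eLpNorm_block_slice_le_tsum (χtan : LPF (Euc n)) (χfull : LPF (Euc (n + 1))) {p : ℝ}
    (hp : 1 ≤ p) (j : ℤ) (g : 𝓢(Euc (n + 1), ℂ)) (η : ℝ) :
    eLpNorm (χtan.block j fun y' => g (join y' η)) (ENNReal.ofReal p) volume ≤
      ∑' i : ℕ, eLpNorm (χtan.block j fun y' => χfull.blockSchwartz (j - 1 + i) g (join y' η))
        (ENNReal.ofReal p) volume := by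
  have hmeas : ∀ i : ℕ, AEStronglyMeasurable
      (χtan.block j fun y' => χfull.blockSchwartz (j - 1 + i) g (join y' η)) volume :=
    fun i => (continuous_block χtan j (integrable_slice _ η)).aestronglyMeasurable
  refine (Lp.eLpNorm_lim_le_liminf_eLpNorm (f := fun m : ℕ => ∑ i ∈ Finset.range m,
    χtan.block j fun y' => χfull.blockSchwartz (j - 1 + i) g (join y' η))
    (fun m => Finset.aestronglyMeasurable_sum _ fun i _ => hmeas i) _
    (Eventually.of_forall fun y => ?_)).trans ?_
  · simp only [Finset.sum_apply]
    exact tendsto_sum_block_slice χtan χfull j g η y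
  · refine liminf_le_of_le (by isBoundedDefault) fun b hb => ?_
    obtain ⟨m, hm⟩ := hb.exists
    exact hm.trans ((eLpNorm_sum_le (fun i _ => hmeas i) (by simpa using hp)).trans
      (ENNReal.sum_le_tsum _))

/-- The trace estimate at a fixed time. -/
theorem exists_besov_slice_le (χtan : LPF (Euc n)) (χfull : LPF (Euc (n + 1))) {p s : ℝ}
    (hp : 1 < p) (hs : -1 + 1 / p < s) :
    ∃ C : ℝ≥0∞, C ≠ ⊤ ∧ ∀ (g : 𝓢(Euc (n + 1), ℂ)) (η : ℝ),
      besov χtan (s + 2 - 1 / p) p (fun y' => g (join y' η)) ≤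
        C * ∑ i : Fin (n + 1), besov χfull s p
          (∂_{EuclideanSpace.single i (1 : ℝ)} (∂_{EuclideanSpace.single i (1 : ℝ)} g) :
            𝓢(Euc (n + 1), ℂ)) := by
  obtain ⟨C₁, hC₁, hblock⟩ := exists_eLpNorm_block_slice_le χtan hp
  obtain ⟨C₂, hC₂, hbern⟩ := exists_eLpNorm_slice_block_le χfull hp
  obtain ⟨C₃, hC₃, hsum⟩ := exists_tsum_weight_mul_tsum_le (σ := s + 2 - 1 / p) (by linarith)
  refine ⟨C₁ * C₂ * C₃, ENNReal.mul_ne_top (ENNReal.mul_ne_top hC₁ hC₂) hC₃, fun g η => ?_⟩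
  let b : ℤ → ℝ≥0∞ := fun k => ENNReal.ofReal ((2 : ℝ) ^ ((1 / p - 2) * (k : ℝ))) *
    ∑ i : Fin (n + 1), eLpNorm (χfull.blockSchwartz k
      (∂_{EuclideanSpace.single i (1 : ℝ)} (∂_{EuclideanSpace.single i (1 : ℝ)} g)))
        (ENNReal.ofReal p) volume
  have hterm : ∀ j : ℤ, eLpNorm (χtan.block j fun y' => g (join y' η)) (ENNReal.ofReal p) volume ≤
      C₁ * C₂ * ∑' i : ℕ, b (j - 1 + i) := by
    intro j
    refine (eLpNorm_block_slice_le_tsum χtan χfull hp.le j g η).trans ?_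
    rw [← ENNReal.tsum_mul_left]
    refine ENNReal.tsum_le_tsum fun i => ?_
    refine (hblock j _ (integrable_slice _ η)
      ((SchwartzMap.continuous _).comp (continuous_join η))).trans ?_
    rw [mul_assoc]
    gcongr
    refine (hbern _ g η).trans ?_
    exact mul_le_mul_right (mul_le_mul_right (eLpNorm_block_laplacian_le χfull hp.le _ g) _) _
  calc besov χtan (s + 2 - 1 / p) p (fun y' => g (join y' η))
      ≤ ∑' j : ℤ, ENNReal.ofReal ((2 : ℝ) ^ ((s + 2 - 1 / p) * (j : ℝ))) *
          (C₁ * C₂ * ∑' i : ℕ, b (j - 1 + i)) := by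
        refine ENNReal.tsum_le_tsum fun j => ?_
        gcongr
        exact hterm j
    _ = C₁ * C₂ * ∑' j : ℤ, ENNReal.ofReal ((2 : ℝ) ^ ((s + 2 - 1 / p) * (j : ℝ))) *
          ∑' i : ℕ, b (j - 1 + i) := by
        rw [← ENNReal.tsum_mul_left]
        exact tsum_congr fun j => mul_left_comm _ _ _
    _ ≤ C₁ * C₂ * (C₃ * ∑' k : ℤ,
          ENNReal.ofReal ((2 : ℝ) ^ ((s + 2 - 1 / p) * (k : ℝ))) * b k) := by
        gcongr
        exact hsum b
    _ = _ := by
        rw [← mul_assoc]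
        congr 1
        simp only [besov]
        rw [← Summable.tsum_finsetSum fun _ _ => ENNReal.summable]
        refine tsum_congr fun k => ?_
        rw [← Finset.mul_sum]
        simp only [b, LPF.coe_blockSchwartz]
        rw [← mul_assoc, ← ENNReal.ofReal_mul (by positivity), ← Real.rpow_add (by norm_num)]
        congr 4
        ring

end PointwiseInTime

section TimeSlices

open scoped LineDeriv

variable {n : ℕ}

theorem measurable_besov_slice (χ : LPF (Euc n)) (s : ℝ) {p : ℝ} (hp : 1 < p)
    (f : 𝓢(ℝ × Euc n, ℂ)) : Measurable fun t : ℝ => besov χ s p fun y => f (t, y) := by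
  have hp0 : 0 < p := by linarith
  have hchar : Continuous fun q : (ℝ × Euc n) × Euc n => Real.fourierChar ⟪q.2, q.1.2⟫ :=
    Real.continuous_fourierChar.comp
      (continuous_snd.inner (continuous_snd.comp continuous_fst))
  have hchar' : Continuous fun q : (ℝ × Euc n) × Euc n => Real.fourierChar (-⟪q.2, q.1.2⟫) :=
    Real.continuous_fourierChar.comp
      (continuous_snd.inner (continuous_snd.comp continuous_fst)).neg
  have hF : StronglyMeasurable fun q : ℝ × Euc n => 𝓕 (fun y => f (q.1, y)) q.2 := by
    simp only [Real.fourier_eq]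
    refine StronglyMeasurable.integral_prod_right' (f := fun q : (ℝ × Euc n) × Euc n =>
      Real.fourierChar (-⟪q.2, q.1.2⟫) • f (q.1.1, q.2)) ?_
    exact (hchar'.smul (f.continuous.comp (by fun_prop))).stronglyMeasurable
  have hB : ∀ k : ℤ, StronglyMeasurable fun q : ℝ × Euc n =>
      χ.block k (fun y => f (q.1, y)) q.2 := by
    intro k
    simp only [LPF.block, Real.fourierInv_eq]
    refine StronglyMeasurable.integral_prod_right' (f := fun q : (ℝ × Euc n) × Euc n =>
      Real.fourierChar ⟪q.2, q.1.2⟫ • ((χ.phiHat ((2 : ℝ) ^ (-k) • q.2) : ℂ) *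
        𝓕 (fun y => f (q.1.1, y)) q.2)) ?_
    refine StronglyMeasurable.smul (𝕜 := Circle) hchar.stronglyMeasurable
      (StronglyMeasurable.mul (Continuous.stronglyMeasurable ?_) ?_)
    · exact (χ.phiSchwartzDilate k).continuous.comp continuous_snd
    · exact hF.comp_measurable (g := fun q : (ℝ × Euc n) × Euc n => (q.1.1, q.2)) (by fun_prop)
  refine Measurable.tsum fun k => Measurable.const_mul ?_ _
  simp_rw [eLpNorm_eq_lintegral_rpow_enorm_toReal (p := ENNReal.ofReal p) (by simpa using hp0)
    ENNReal.ofReal_ne_top]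
  exact (Measurable.lintegral_prod_right' (f := fun q : ℝ × Euc n =>
    ‖χ.block k (fun y => f (q.1, y)) q.2‖ₑ ^ (ENNReal.ofReal p).toReal)
    ((hB k).enorm.pow_const _)).pow_const _

theorem pdv_slice (i : Fin n) (f : 𝓢(ℝ × Euc n, ℂ)) (t : ℝ) :
    pdv i (fun z => f (t, z)) =
      fun y => ∂_{((0 : ℝ), EuclideanSpace.single i (1 : ℝ))} f (t, y) := by
  ext y
  have h := (f.differentiableAt (x := (t, y))).hasFDerivAt.comp y (hasFDerivAt_prodMk_right t y)
  rw [SchwartzMap.lineDerivOp_apply_eq_fderiv, pdv]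
  exact congrArg (· (EuclideanSpace.single i (1 : ℝ))) h.fderiv

/-- The slice `f(t,·)` of a Schwartz function, as a Schwartz function. -/
theorem exists_schwartzMap_slice (f : 𝓢(ℝ × Euc n, ℂ)) (t : ℝ) :
    ∃ g : 𝓢(Euc n, ℂ), ∀ y, g y = f (t, y) := by
  have hg : (fun y : Euc n => (t, y)).HasTemperateGrowth := by
    convert (Function.HasTemperateGrowth.const ((t, 0) : ℝ × Euc n)).add
      (ContinuousLinearMap.inr ℝ ℝ (Euc n)).hasTemperateGrowth using 1
    ext y <;> simp
  have hanti : AntilipschitzWith 1 fun y : Euc n => (t, y) :=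
    AntilipschitzWith.of_le_mul_dist fun x y => by simp [Prod.dist_eq]
  exact ⟨SchwartzMap.compCLMOfAntilipschitz ℂ hg hanti f, fun _ => rfl⟩

end TimeSlices
/-- **spatial trace estimate (A.8).**
With `N = n + 1 ≥ 2`, `1 < p < ∞` and `s > −1 + 1/p`, for every Schwartz function
`f = f(t, y', η)`:
`sup_η ∫_ℝ ‖f(t,·,η)‖_{Ḃ^{s+2−1/p}_{p,1}(ℝ^n)} dt ≤ C ‖D²f‖_{L¹(ℝ;Ḃ^s_{p,1}(ℝ^{n+1}))}`. -/
theorem spatial_trace_estimate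
    (n : ℕ) (hn : 1 ≤ n) (p s : ℝ) (hp : 1 < p) (hs : -1 + 1 / p < s)
    (χtan : LPF (Euc n)) (χfull : LPF (Euc (n + 1))) :
    ∃ C : ℝ, 0 < C ∧
      ∀ f : SchwartzMap (ℝ × Euc (n + 1)) ℂ,
        (⨆ η : ℝ,
          ∫⁻ t : ℝ, besov χtan (s + 2 - 1 / p) p (fun y' : Euc n => f (t, join y' η))) ≤
        ENNReal.ofReal C *
          ∑ i : Fin (n + 1), ∑ j : Fin (n + 1),
            besovT χfull s p Set.univ
              (fun t y => pdv i (pdv j fun z : Euc (n + 1) => f (t, z)) y) := by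
  obtain ⟨C, hC, hle⟩ := exists_besov_slice_le χtan χfull hp hs
  refine ⟨C.toReal + 1, by positivity, fun f => iSup_le fun η => ?_⟩
  have hmeas : ∀ i : Fin (n + 1), Measurable fun t : ℝ =>
      besov χfull s p (pdv i (pdv i fun z : Euc (n + 1) => f (t, z))) := by
    intro i
    simp only [pdv_slice]
    exact measurable_besov_slice χfull s hp _
  have htime : ∀ t : ℝ, besov χtan (s + 2 - 1 / p) p (fun y' : Euc n => f (t, join y' η)) ≤
      C * ∑ i : Fin (n + 1),
        besov χfull s p (pdv i (pdv i fun z : Euc (n + 1) => f (t, z))) := by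
    intro t
    obtain ⟨g, hg⟩ := exists_schwartzMap_slice f t
    simp only [← hg]
    exact hle g η
  calc ∫⁻ t : ℝ, besov χtan (s + 2 - 1 / p) p (fun y' : Euc n => f (t, join y' η))
      ≤ ∫⁻ t : ℝ, C * ∑ i : Fin (n + 1),
          besov χfull s p (pdv i (pdv i fun z : Euc (n + 1) => f (t, z))) :=
        lintegral_mono htime
    _ = C * ∑ i : Fin (n + 1), ∫⁻ t : ℝ,
          besov χfull s p (pdv i (pdv i fun z : Euc (n + 1) => f (t, z))) := by
        rw [lintegral_const_mul' _ _ hC, lintegral_finsetSum _ fun i _ => hmeas i]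
    _ ≤ _ := by
        gcongr with i
        · rw [ENNReal.le_ofReal_iff_toReal_le hC (by positivity)]
          linarith
        · refine le_trans ?_ (Finset.single_le_sum (fun _ _ => zero_le) (Finset.mem_univ i))
          rw [besovT, Measure.restrict_univ]
end
end
end

section
/- (Estimate (3.5).) Let N ≥ 2 and N ≤ p < 2N − 1. There exists C > 0, depending only on N, p and the Littlewood–Paley function, such that for every u ∈ C_c^∞((0,∞)×ℝ^N; ℝ^N), the nonlinear term V₁(u) := ∑_{i,j,k=1}^N P_{ik} ∂_i( P_{jk} ∂_j u ) + ∑_{i,j=1}^N P_{ij} ∂_i ∂_j u + ∑_{i,j=1}^N ∂_i( P_{ji} ∂_j u ) satisfies ‖V₁(u)‖_{L¹(ℝ₊;Ḃ^{−1+N/p}_{p,1}(ℝ^N))} ≤ C ∑_{r=2}^{2N−1} E(u)^r. -/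
open MeasureTheory
open scoped BigOperators ENNReal

noncomputable section

open MHD

noncomputable section

set_option linter.unusedSectionVars false

namespace MHD

open SchwartzMap FourierTransform Convolution
open scoped NNReal

section Kernel

/-- Jensen's inequality with respect to a weight `w`. -/
theorem lintegral_mul_rpow_le {α : Type*} [MeasurableSpace α] {μ : Measure α} {q : ℝ}
    (hq : 1 ≤ q) {w h : α → ℝ≥0∞} (hw : AEMeasurable w μ) (hh : AEMeasurable h μ) :
    (∫⁻ a, w a * h a ∂μ) ^ q ≤ (∫⁻ a, w a ∂μ) ^ (q - 1) * ∫⁻ a, w a * h a ^ q ∂μ := by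
  have hq0 : 0 < q := by linarith
  have hq1 : q⁻¹ ≤ 1 := inv_le_one_of_one_le₀ hq
  have key := ENNReal.lintegral_mul_norm_pow_le hw (hw.mul (hh.pow_const q))
    (p := 1 - q⁻¹) (q := q⁻¹) (by linarith) (by positivity) (by ring)
  have e : ∀ a, w a ^ (1 - q⁻¹) * (w a * h a ^ q) ^ q⁻¹ = w a * h a := by
    intro a
    rw [ENNReal.mul_rpow_of_nonneg _ _ (by positivity), ← ENNReal.rpow_mul,
      mul_inv_cancel₀ hq0.ne', ENNReal.rpow_one, ← mul_assoc,
      ← ENNReal.rpow_add_of_nonneg _ _ (by linarith) (by positivity)]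
    simp
  simp only [Pi.mul_apply, e] at key
  calc (∫⁻ a, w a * h a ∂μ) ^ q
      ≤ ((∫⁻ a, w a ∂μ) ^ (1 - q⁻¹) * (∫⁻ a, w a * h a ^ q ∂μ) ^ q⁻¹) ^ q := by gcongr
    _ = _ := by
      rw [ENNReal.mul_rpow_of_nonneg _ _ hq0.le, ← ENNReal.rpow_mul, ← ENNReal.rpow_mul,
        inv_mul_cancel₀ hq0.ne', ENNReal.rpow_one]
      congr 2
      field_simp

variable {V : Type*} [NormedAddCommGroup V] [InnerProductSpace ℝ V]
    [FiniteDimensional ℝ V] [MeasurableSpace V] [BorelSpace V]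

/-- The dilation `m(2^{-k}·)` of a Schwartz function. -/
def dil (k : ℤ) (m : 𝓢(V, ℂ)) : 𝓢(V, ℂ) :=
  compCLMOfContinuousLinearEquiv ℂ
    (ContinuousLinearEquiv.smulLeft (R₁ := ℝ) (M₁ := V)
      (Units.mk0 ((2 : ℝ) ^ (-k)) (by positivity))) m

@[simp]
theorem dil_apply (k : ℤ) (m : 𝓢(V, ℂ)) (ξ : V) : dil k m ξ = m ((2 : ℝ) ^ (-k) • ξ) := rfl

/-- The Fourier multiplier with symbol `m(2^{-k}·)`. -/
def mulOp (m : 𝓢(V, ℂ)) (k : ℤ) (f : 𝓢(V, ℂ)) : 𝓢(V, ℂ) := fourierMultiplierCLM ℂ (dil k m) f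

theorem fourier_mulOp (m : 𝓢(V, ℂ)) (k : ℤ) (f : 𝓢(V, ℂ)) (ξ : V) :
    𝓕 (mulOp m k f) ξ = m ((2 : ℝ) ^ (-k) • ξ) * 𝓕 f ξ := by
  rw [mulOp, fourierMultiplierCLM_apply, FourierTransform.fourier_fourierInv_eq,
    smulLeftCLM_apply_apply (dil k m).hasTemperateGrowth]
  simp

theorem mulOp_eq_integral (m : 𝓢(V, ℂ)) (k : ℤ) (f : 𝓢(V, ℂ)) (x : V) :
    mulOp m k f x = ∫ t, 𝓕⁻ (dil k m) t * f (x - t) := by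
  have : mulOp m k f = convolution (ContinuousLinearMap.mul ℂ ℂ) (𝓕⁻ (dil k m)) f := by
    rw [← FourierTransform.fourierInv_fourier_eq (E := 𝓢(V, ℂ)) (F := 𝓢(V, ℂ))
      (convolution (ContinuousLinearMap.mul ℂ ℂ) (𝓕⁻ (dil k m)) f), fourier_convolution,
      FourierTransform.fourier_fourierInv_eq, mulOp, fourierMultiplierCLM_apply]
    congr 1
    ext ξ
    rw [smulLeftCLM_apply_apply (dil k m).hasTemperateGrowth]
    simp
  rw [this, convolution_apply]
  rfl

theorem fourierInv_dil (m : 𝓢(V, ℂ)) (k : ℤ) (x : V) :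
    𝓕⁻ (dil k m) x =
      (((2 : ℝ) ^ k) ^ Module.finrank ℝ V : ℝ) • 𝓕⁻ m ((2 : ℝ) ^ k • x) := by
  rw [fourierInv_coe, fourierInv_coe, Real.fourierInv_eq, Real.fourierInv_eq]
  have := Measure.integral_comp_smul (volume : Measure V)
    (fun v => Real.fourierChar (inner ℝ v ((2 : ℝ) ^ k • x)) • m v) ((2 : ℝ) ^ (-k))
  have e : ∀ v : V, Real.fourierChar (inner ℝ ((2 : ℝ) ^ (-k) • v) ((2 : ℝ) ^ k • x)) =
      Real.fourierChar (inner ℝ v x) := by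
    intro v
    rw [inner_smul_left, inner_smul_right, ← mul_assoc]
    congr 1
    rw [zpow_neg, RCLike.conj_to_real, inv_mul_cancel₀ (by positivity), one_mul]
  simp only [e] at this
  simp only [dil_apply, this]
  congr 1
  rw [zpow_neg, inv_pow, inv_inv, abs_of_nonneg (by positivity)]

theorem lintegral_comp_smul {f : V → ℝ≥0∞} (hf : Measurable f) {r : ℝ} (hr : r ≠ 0) :
    ∫⁻ x, f (r • x) = ENNReal.ofReal |(r ^ Module.finrank ℝ V)⁻¹| * ∫⁻ x, f x := by
  rw [← lintegral_map hf (measurable_const_smul r), Measure.map_addHaar_smul _ hr,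
    lintegral_smul_measure, smul_eq_mul]

theorem exists_kernel_bound (m : 𝓢(V, ℂ)) : ∃ C : ℝ≥0, ∀ k : ℤ,
    ∫⁻ t, ‖𝓕⁻ (dil k m) t‖ₑ ≤ C ∧
    ∀ t, ‖𝓕⁻ (dil k m) t‖ₑ ≤ C * (2 : ℝ≥0∞) ^ ((k : ℝ) * Module.finrank ℝ V) := by
  obtain ⟨B, hB⟩ : ∃ B : ℝ≥0, ∀ x, ‖(𝓕⁻ m : 𝓢(V, ℂ)) x‖ₑ ≤ B := by
    refine ⟨Real.toNNReal (SchwartzMap.seminorm ℝ 0 0 (𝓕⁻ m)), fun x => ?_⟩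
    rw [← ofReal_norm]
    exact ENNReal.ofReal_le_ofReal (norm_le_seminorm ℝ _ x)
  have hI : ∫⁻ t, ‖(𝓕⁻ m : 𝓢(V, ℂ)) t‖ₑ < ∞ := (𝓕⁻ m : 𝓢(V, ℂ)).integrable.2
  have h2 : ∀ k : ℤ, ‖(((2 : ℝ) ^ k) ^ Module.finrank ℝ V : ℝ)‖ₑ =
      (2 : ℝ≥0∞) ^ ((k : ℝ) * Module.finrank ℝ V) := by
    intro k
    rw [← ofReal_norm, Real.norm_of_nonneg (by positivity), ENNReal.rpow_mul,
      ENNReal.rpow_natCast, ENNReal.rpow_intCast, ENNReal.ofReal_pow (by positivity)]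
    congr 1
    rw [← Real.rpow_intCast, ← ENNReal.ofReal_rpow_of_pos (by norm_num), ENNReal.rpow_intCast]
    simp
  refine ⟨B + (∫⁻ t, ‖(𝓕⁻ m : 𝓢(V, ℂ)) t‖ₑ).toNNReal, fun k => ⟨?_, fun t => ?_⟩⟩
  · simp only [fourierInv_dil, enorm_smul]
    rw [lintegral_const_mul' _ _ (by simp)]
    rw [lintegral_comp_smul (by fun_prop : Measurable fun v => ‖(𝓕⁻ m : 𝓢(V, ℂ)) v‖ₑ)
      (by positivity : (2 : ℝ) ^ k ≠ 0), ← mul_assoc, ← ofReal_norm, ← ENNReal.ofReal_mul (by positivity),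
      Real.norm_of_nonneg (by positivity), abs_of_nonneg (by positivity),
      mul_inv_cancel₀ (by positivity)]
    simp [ENNReal.coe_toNNReal hI.ne]
  · rw [fourierInv_dil, enorm_smul, h2, mul_comm]
    gcongr
    refine (hB _).trans ?_
    push_cast
    exact le_self_add

theorem enorm_mulOp_rpow_le (m : 𝓢(V, ℂ)) (k : ℤ) (f : 𝓢(V, ℂ)) {q : ℝ} (hq : 1 ≤ q) (x : V) :
    ‖mulOp m k f x‖ₑ ^ q ≤ (∫⁻ t, ‖𝓕⁻ (dil k m) t‖ₑ) ^ (q - 1) *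
      ∫⁻ t, ‖𝓕⁻ (dil k m) t‖ₑ * ‖f (x - t)‖ₑ ^ q := by
  rw [mulOp_eq_integral]
  calc _ ≤ (∫⁻ t, ‖𝓕⁻ (dil k m) t‖ₑ * ‖f (x - t)‖ₑ) ^ q := by
        gcongr
        simpa only [enorm_mul] using enorm_integral_le_lintegral_enorm
          (fun t => 𝓕⁻ (dil k m) t * f (x - t))
    _ ≤ _ := lintegral_mul_rpow_le hq (by fun_prop) (by fun_prop)

theorem eLpNorm_ofReal {q : ℝ} (hq : 0 < q) (f : V → ℂ) :
    eLpNorm f (ENNReal.ofReal q) volume = (∫⁻ x, ‖f x‖ₑ ^ q) ^ q⁻¹ := by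
  rw [eLpNorm_eq_lintegral_rpow_enorm_toReal (by simpa using hq) (by simp),
    ENNReal.toReal_ofReal hq.le, one_div]

theorem exists_eLpNorm_mulOp_le (m : 𝓢(V, ℂ)) : ∃ C : ℝ≥0, ∀ (q : ℝ), 1 ≤ q → ∀ (k : ℤ)
    (f : 𝓢(V, ℂ)),
    eLpNorm (mulOp m k f) (ENNReal.ofReal q) volume ≤ C * eLpNorm f (ENNReal.ofReal q) volume ∧
    (∀ x, ‖mulOp m k f x‖ₑ ≤ C * (2 : ℝ≥0∞) ^ ((k : ℝ) * (Module.finrank ℝ V / q)) *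
      eLpNorm f (ENNReal.ofReal q) volume) ∧
    eLpNorm (mulOp m k f) (ENNReal.ofReal (2 * q)) volume ≤
      C * (2 : ℝ≥0∞) ^ ((k : ℝ) * (Module.finrank ℝ V / (2 * q))) *
        eLpNorm f (ENNReal.ofReal q) volume := by
  obtain ⟨C, hC⟩ := exists_kernel_bound m
  refine ⟨C, fun q hq k f => ?_⟩
  have hq0 : 0 < q := by linarith
  obtain ⟨hC1, hC2⟩ := hC k
  set d := (Module.finrank ℝ V : ℝ)
  have hCq : (C : ℝ≥0∞) ^ (q - 1) * C = (C : ℝ≥0∞) ^ q := by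
    nth_rewrite 2 [← ENNReal.rpow_one (C : ℝ≥0∞)]
    rw [← ENNReal.rpow_add_of_nonneg _ _ (by linarith) zero_le_one]
    simp
  have hint : ∫⁻ x, ‖mulOp m k f x‖ₑ ^ q ≤ (C : ℝ≥0∞) ^ q * ∫⁻ x, ‖f x‖ₑ ^ q := by
    calc ∫⁻ x, ‖mulOp m k f x‖ₑ ^ q
        ≤ ∫⁻ x, (C : ℝ≥0∞) ^ (q - 1) * ∫⁻ t, ‖𝓕⁻ (dil k m) t‖ₑ * ‖f (x - t)‖ₑ ^ q := by
          refine lintegral_mono fun x => (enorm_mulOp_rpow_le m k f hq x).trans ?_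
          gcongr
      _ = (C : ℝ≥0∞) ^ (q - 1) * ∫⁻ t, ∫⁻ x, ‖𝓕⁻ (dil k m) t‖ₑ * ‖f (x - t)‖ₑ ^ q := by
          rw [lintegral_const_mul' _ _ (by simp; intro; linarith), lintegral_lintegral_swap]
          apply Measurable.aemeasurable
          fun_prop
      _ = (C : ℝ≥0∞) ^ (q - 1) * ∫⁻ t, ‖𝓕⁻ (dil k m) t‖ₑ * ∫⁻ x, ‖f x‖ₑ ^ q := by
          congr 1
          refine lintegral_congr fun t => ?_
          rw [lintegral_const_mul' _ _ (by simp),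
            lintegral_sub_right_eq_self (fun x => ‖f x‖ₑ ^ q) t]
      _ ≤ (C : ℝ≥0∞) ^ (q - 1) * (C * ∫⁻ x, ‖f x‖ₑ ^ q) := by
          rw [lintegral_mul_const _ (by fun_prop)]
          gcongr
      _ = _ := by rw [← mul_assoc, hCq]
  have hsup : ∀ x, ‖mulOp m k f x‖ₑ ≤ C * (2 : ℝ≥0∞) ^ ((k : ℝ) * (d / q)) *
      eLpNorm f (ENNReal.ofReal q) volume := by
    intro x
    rw [eLpNorm_ofReal hq0, ← ENNReal.rpow_le_rpow_iff hq0,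
      ENNReal.mul_rpow_of_nonneg _ _ hq0.le, ENNReal.mul_rpow_of_nonneg _ _ hq0.le,
      ← ENNReal.rpow_mul, ← ENNReal.rpow_mul, inv_mul_cancel₀ hq0.ne', ENNReal.rpow_one,
      show (k : ℝ) * (d / q) * q = k * d by field_simp]
    calc _ ≤ _ := enorm_mulOp_rpow_le m k f hq x
      _ ≤ (C : ℝ≥0∞) ^ (q - 1) *
          ∫⁻ t, (C * (2 : ℝ≥0∞) ^ ((k : ℝ) * d)) * ‖f (x - t)‖ₑ ^ q := by
          gcongr with t
          exact hC2 t
      _ = _ := by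
          have hm : Measurable fun t => ‖f (x - t)‖ₑ ^ q :=
            (f.continuous.comp (continuous_const.sub continuous_id)).enorm.measurable.pow_const q
          rw [lintegral_const_mul _ hm, lintegral_sub_left_eq_self (fun x => ‖f x‖ₑ ^ q) x, ← mul_assoc, ← mul_assoc, hCq]
  refine ⟨?_, hsup, ?_⟩
  · rw [eLpNorm_ofReal hq0, eLpNorm_ofReal hq0]
    calc _ ≤ ((C : ℝ≥0∞) ^ q * ∫⁻ x, ‖f x‖ₑ ^ q) ^ q⁻¹ := by gcongr
      _ = _ := by
        rw [ENNReal.mul_rpow_of_nonneg _ _ (by positivity), ← ENNReal.rpow_mul,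
          mul_inv_cancel₀ hq0.ne', ENNReal.rpow_one]
  · rw [eLpNorm_ofReal (by positivity)]
    set F := eLpNorm f (ENNReal.ofReal q) volume with hF
    have hFq : ∫⁻ x, ‖f x‖ₑ ^ q = F ^ q := by
      rw [hF, eLpNorm_ofReal hq0, ← ENNReal.rpow_mul, inv_mul_cancel₀ hq0.ne', ENNReal.rpow_one]
    have : ∫⁻ x, ‖mulOp m k f x‖ₑ ^ (2 * q) ≤
        (C * (2 : ℝ≥0∞) ^ ((k : ℝ) * (d / (2 * q))) * F) ^ (2 * q) := by
      calc _ ≤ ∫⁻ x, (C * (2 : ℝ≥0∞) ^ ((k : ℝ) * (d / q)) * F) ^ q *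
            ‖mulOp m k f x‖ₑ ^ q := by
            refine lintegral_mono fun x => ?_
            dsimp only
            rw [two_mul, ENNReal.rpow_add_of_nonneg _ _ hq0.le hq0.le]
            gcongr
            exact hsup x
        _ ≤ (C * (2 : ℝ≥0∞) ^ ((k : ℝ) * (d / q)) * F) ^ q * ((C : ℝ≥0∞) ^ q * F ^ q) := by
            rw [lintegral_const_mul _ (by fun_prop), ← hFq]
            gcongr
        _ = _ := by
            have h22 : ((2 : ℝ≥0∞) ^ ((k : ℝ) * (d / q))) ^ q =
                ((2 : ℝ≥0∞) ^ ((k : ℝ) * (d / (2 * q)))) ^ (2 * q) := by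
              rw [← ENNReal.rpow_mul, ← ENNReal.rpow_mul]
              congr 1
              field_simp
            simp only [ENNReal.mul_rpow_of_nonneg _ _ hq0.le,
              ENNReal.mul_rpow_of_nonneg _ _ (by positivity : 0 ≤ 2 * q), h22]
            rw [two_mul, ENNReal.rpow_add_of_nonneg (x := (C : ℝ≥0∞)) _ _ hq0.le hq0.le,
              ENNReal.rpow_add_of_nonneg (x := F) _ _ hq0.le hq0.le]
            ring
    calc _ ≤ ((C * (2 : ℝ≥0∞) ^ ((k : ℝ) * (d / (2 * q))) * F) ^ (2 * q)) ^ (2 * q)⁻¹ := by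
          gcongr
      _ = _ := by
          rw [← ENNReal.rpow_mul, mul_inv_cancel₀ (by positivity), ENNReal.rpow_one]

end Kernel

end MHD

namespace MHD

open SchwartzMap FourierTransform Convolution LineDeriv
open scoped NNReal

section Block

variable {V : Type*} [NormedAddCommGroup V] [InnerProductSpace ℝ V]
    [FiniteDimensional ℝ V] [MeasurableSpace V] [BorelSpace V]

theorem ext_fourier {f g : 𝓢(V, ℂ)} (h : ∀ ξ, 𝓕 f ξ = 𝓕 g ξ) : f = g := by
  have : 𝓕 f = 𝓕 g := by ext ξ; exact h ξ
  rw [← FourierTransform.fourierInv_fourier_eq (E := 𝓢(V, ℂ)) (F := 𝓢(V, ℂ)) f, this,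
    FourierTransform.fourierInv_fourier_eq]

theorem LPF.phiHat_eq_zero_of_le (χ : LPF V) {ξ : V} (h : ‖ξ‖ ≤ 1) : χ.phiHat ξ = 0 := by
  rw [LPF.phiHat, χ.eq_one ξ h, χ.eq_one, sub_self]
  rw [norm_smul]
  norm_num
  linarith

theorem LPF.phiHat_eq_zero_of_ge (χ : LPF V) {ξ : V} (h : 4 ≤ ‖ξ‖) : χ.phiHat ξ = 0 := by
  rw [LPF.phiHat, χ.supp ξ (by linarith), χ.supp, sub_self]
  rw [norm_smul]
  norm_num
  linarith

/-- A smooth function equal to `1` on the support of `φ̂` and vanishing near the origin. -/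
def LPF.fatHat (χ : LPF V) (ξ : V) : ℝ := χ.chi ((4 : ℝ)⁻¹ • ξ) - χ.chi ((2 : ℝ) • ξ)

theorem LPF.fatHat_eq_one (χ : LPF V) {ξ : V} (h1 : 1 ≤ ‖ξ‖) (h4 : ‖ξ‖ ≤ 4) :
    χ.fatHat ξ = 1 := by
  rw [LPF.fatHat, χ.eq_one, χ.supp, sub_zero] <;>
  · rw [norm_smul]
    norm_num
    linarith

theorem LPF.fatHat_eq_zero_of_le (χ : LPF V) {ξ : V} (h : ‖ξ‖ ≤ 1 / 2) : χ.fatHat ξ = 0 := by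
  rw [LPF.fatHat, χ.eq_one, χ.eq_one, sub_self] <;>
  · rw [norm_smul]
    norm_num
    linarith

theorem LPF.fatHat_eq_zero_of_ge (χ : LPF V) {ξ : V} (h : 8 ≤ ‖ξ‖) : χ.fatHat ξ = 0 := by
  rw [LPF.fatHat, χ.supp, χ.supp, sub_self] <;>
  · rw [norm_smul]
    norm_num
    linarith

theorem LPF.fatHat_mul_phiHat (χ : LPF V) (ξ : V) :
    χ.fatHat ξ * χ.phiHat ξ = χ.phiHat ξ := by
  by_cases h : 1 ≤ ‖ξ‖ ∧ ‖ξ‖ ≤ 4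
  · rw [χ.fatHat_eq_one h.1 h.2, one_mul]
  · have : χ.phiHat ξ = 0 := by
      by_cases h1 : ‖ξ‖ ≤ 1
      · exact χ.phiHat_eq_zero_of_le h1
      · exact χ.phiHat_eq_zero_of_ge (by grind)
    rw [this, mul_zero]

theorem LPF.contDiff_phiHat_s12 (χ : LPF V) : ContDiff ℝ (⊤ : ℕ∞) χ.phiHat :=
  (χ.smooth.comp (contDiff_const_smul _)).sub χ.smooth

theorem LPF.contDiff_fatHat (χ : LPF V) : ContDiff ℝ (⊤ : ℕ∞) χ.fatHat :=
  (χ.smooth.comp (contDiff_const_smul _)).sub (χ.smooth.comp (contDiff_const_smul _))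

/-- A smooth function vanishing outside the ball of radius `8`, as a Schwartz function. -/
def symbolOf (f : V → ℂ) (hf : ContDiff ℝ (⊤ : ℕ∞) f) (h : ∀ x, 8 < ‖x‖ → f x = 0) : 𝓢(V, ℂ) :=
  HasCompactSupport.toSchwartzMap (f := f)
    (HasCompactSupport.intro (isCompact_closedBall (0 : V) 8)
      (fun x hx => h x (by simpa using hx))) hf

/-- The symbol `φ̂`. -/
def LPF.phi (χ : LPF V) : 𝓢(V, ℂ) :=
  symbolOf (fun ξ => (χ.phiHat ξ : ℂ)) (Complex.ofRealCLM.contDiff.comp χ.contDiff_phiHat_s12)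
    fun ξ hξ => by rw [χ.phiHat_eq_zero_of_ge (by linarith), Complex.ofReal_zero]

/-- The symbol `fatHat`. -/
def LPF.fat (χ : LPF V) : 𝓢(V, ℂ) :=
  symbolOf (fun ξ => (χ.fatHat ξ : ℂ)) (Complex.ofRealCLM.contDiff.comp χ.contDiff_fatHat)
    fun ξ hξ => by rw [χ.fatHat_eq_zero_of_ge hξ.le, Complex.ofReal_zero]

/-- The localized symbol of the derivative in direction `e`. -/
def LPF.dsym (χ : LPF V) (e : V) : 𝓢(V, ℂ) :=
  symbolOf (fun ξ => 2 * Real.pi * Complex.I * ((inner ℝ ξ e * χ.fatHat ξ : ℝ) : ℂ))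
    (contDiff_const.mul (Complex.ofRealCLM.contDiff.comp
      ((contDiff_id.inner ℝ contDiff_const).mul χ.contDiff_fatHat)))
    fun ξ hξ => by simp [χ.fatHat_eq_zero_of_ge hξ.le]

/-- The localized symbol inverting the gradient, in direction `e`. -/
def LPF.isym (χ : LPF V) (e : V) : 𝓢(V, ℂ) :=
  symbolOf (fun ξ => (2 * Real.pi * Complex.I)⁻¹ *
      ((inner ℝ ξ e * χ.fatHat ξ / ‖ξ‖ ^ 2 : ℝ) : ℂ))
    (by
      refine contDiff_const.mul (Complex.ofRealCLM.contDiff.comp ?_)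
      rw [contDiff_iff_contDiffAt]
      intro ξ
      by_cases hξ : ξ = 0
      · refine (contDiffAt_const (c := (0 : ℝ))).congr_of_eventuallyEq ?_
        filter_upwards [Metric.ball_mem_nhds ξ (by norm_num : (0 : ℝ) < 1 / 2)] with x hx
        rw [hξ, mem_ball_zero_iff] at hx
        change inner ℝ x e * χ.fatHat x / ‖x‖ ^ 2 = 0
        rw [χ.fatHat_eq_zero_of_le hx.le]
        simp
      · exact ((contDiffAt_id.inner ℝ contDiffAt_const).mul χ.contDiff_fatHat.contDiffAt).div
          (contDiff_norm_sq ℝ).contDiffAt (by simpa using hξ))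
    fun ξ hξ => by simp [χ.fatHat_eq_zero_of_ge hξ.le]

theorem LPF.block_eq (χ : LPF V) (k : ℤ) (f : 𝓢(V, ℂ)) : χ.block k f = mulOp χ.phi k f := by
  rw [LPF.block, mulOp, fourierMultiplierCLM_apply, fourierInv_coe]
  congr 1
  ext ξ
  rw [smulLeftCLM_apply_apply (dil k χ.phi).hasTemperateGrowth, ← fourier_coe]
  rfl

theorem mulOp_fat (χ : LPF V) (k : ℤ) (f : 𝓢(V, ℂ)) :
    mulOp χ.fat k (mulOp χ.phi k f) = mulOp χ.phi k f := by
  refine ext_fourier fun ξ => ?_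
  rw [fourier_mulOp, fourier_mulOp, ← mul_assoc]
  congr 1
  change ((χ.fatHat _ : ℝ) : ℂ) * ((χ.phiHat _ : ℝ) : ℂ) = ((χ.phiHat _ : ℝ) : ℂ)
  rw [← Complex.ofReal_mul, χ.fatHat_mul_phiHat]

theorem fourier_lineDeriv (f : 𝓢(V, ℂ)) (e ξ : V) :
    𝓕 (∂_{e} f) ξ = 2 * Real.pi * Complex.I * ((inner ℝ ξ e : ℝ) : ℂ) * 𝓕 f ξ := by
  have h : (inner ℝ · e : V → ℝ).HasTemperateGrowth :=
    ((innerSL ℝ).flip e).hasTemperateGrowth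
  rw [fourier_lineDerivOp_eq, smul_apply, smulLeftCLM_apply_apply h]
  simp [mul_assoc]

theorem mulOp_phi_lineDeriv (χ : LPF V) (k : ℤ) (f : 𝓢(V, ℂ)) (e : V) :
    mulOp χ.phi k (∂_{e} f) = ((2 : ℂ) ^ k) • mulOp (χ.dsym e) k (mulOp χ.phi k f) := by
  refine ext_fourier fun ξ => ?_
  rw [FourierTransform.fourier_smul, smul_apply, fourier_mulOp, fourier_mulOp, fourier_mulOp,
    fourier_lineDeriv]
  change ((χ.phiHat ((2 : ℝ) ^ (-k) • ξ) : ℝ) : ℂ) * _ = _ • ((2 * Real.pi * Complex.I *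
    ((inner ℝ ((2 : ℝ) ^ (-k) • ξ) e * χ.fatHat ((2 : ℝ) ^ (-k) • ξ) : ℝ) : ℂ)) *
    (((χ.phiHat ((2 : ℝ) ^ (-k) • ξ) : ℝ) : ℂ) * _))
  nth_rewrite 1 [← χ.fatHat_mul_phiHat]
  rw [inner_smul_left]
  have : (2 : ℂ) ^ k ≠ 0 := zpow_ne_zero _ two_ne_zero
  simp
  field_simp

theorem mulOp_phi_eq_sum {ι : Type*} [Fintype ι] (b : OrthonormalBasis ι ℝ V) (χ : LPF V) (k : ℤ)
    (f : 𝓢(V, ℂ)) :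
    mulOp χ.phi k f =
      ∑ i, ((2 : ℂ) ^ (-k)) • mulOp (χ.isym (b i)) k (mulOp χ.phi k (∂_{b i} f)) := by
  refine ext_fourier fun ξ => ?_
  rw [FourierTransform.fourier_sum, sum_apply]
  simp only [FourierTransform.fourier_smul, smul_apply, fourier_mulOp, fourier_lineDeriv]
  change ((χ.phiHat ((2 : ℝ) ^ (-k) • ξ) : ℝ) : ℂ) * _ = ∑ i, _ • (((2 * Real.pi * Complex.I)⁻¹ *
    ((inner ℝ ((2 : ℝ) ^ (-k) • ξ) (b i) * χ.fatHat ((2 : ℝ) ^ (-k) • ξ) /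
      ‖(2 : ℝ) ^ (-k) • ξ‖ ^ 2 : ℝ) : ℂ)) *
    (((χ.phiHat ((2 : ℝ) ^ (-k) • ξ) : ℝ) : ℂ) * _))
  by_cases hξ : ξ = 0
  · have h0 : χ.phiHat ((2 : ℝ) ^ (-k) • ξ) = 0 :=
      χ.phiHat_eq_zero_of_le (by rw [hξ, smul_zero, norm_zero]; norm_num)
    simp only [h0, Complex.ofReal_zero, zero_mul, mul_zero, smul_zero, Finset.sum_const_zero]
  · have hn : (‖ξ‖ : ℂ) ≠ 0 := by simpa using hξ
    have e : ∀ i, ((2 : ℂ) ^ (-k)) • (((2 * Real.pi * Complex.I)⁻¹ *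
        ((inner ℝ ((2 : ℝ) ^ (-k) • ξ) (b i) * χ.fatHat ((2 : ℝ) ^ (-k) • ξ) /
          ‖(2 : ℝ) ^ (-k) • ξ‖ ^ 2 : ℝ) : ℂ)) *
        (((χ.phiHat ((2 : ℝ) ^ (-k) • ξ) : ℝ) : ℂ) *
          (2 * Real.pi * Complex.I * ((inner ℝ ξ (b i) : ℝ) : ℂ) * 𝓕 f ξ))) =
        ((inner ℝ ξ (b i) ^ 2 : ℝ) : ℂ) *
          (((χ.phiHat ((2 : ℝ) ^ (-k) • ξ) : ℝ) : ℂ) * 𝓕 f ξ / ((‖ξ‖ : ℂ)) ^ 2) := by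
      intro i
      nth_rewrite 2 [← χ.fatHat_mul_phiHat]
      rw [inner_smul_left, norm_smul]
      have h2 : (2 : ℂ) ^ k ≠ 0 := zpow_ne_zero _ two_ne_zero
      have hpi : (Real.pi : ℂ) ≠ 0 := by simp [Real.pi_ne_zero]
      simp
      field_simp
      rw [Complex.I_sq]
      ring
    rw [Finset.sum_congr rfl fun i _ => e i, ← Finset.sum_mul, ← Complex.ofReal_sum,
      b.sum_sq_inner_left]
    push_cast
    field_simp

theorem phi_dil_ne_zero (χ : LPF V) {k : ℤ} {ξ : V} (h : χ.phi ((2 : ℝ) ^ (-k) • ξ) ≠ 0) :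
    (2 : ℝ) ^ k < ‖ξ‖ ∧ ‖ξ‖ < (2 : ℝ) ^ (k + 2) := by
  have h' : χ.phiHat ((2 : ℝ) ^ (-k) • ξ) ≠ 0 := by
    intro h0
    exact h (by change ((χ.phiHat _ : ℝ) : ℂ) = 0; rw [h0, Complex.ofReal_zero])
  have h1 : 1 < ‖(2 : ℝ) ^ (-k) • ξ‖ := by
    by_contra! hh
    exact h' (χ.phiHat_eq_zero_of_le hh)
  have h2 : ‖(2 : ℝ) ^ (-k) • ξ‖ < 4 := by
    by_contra! hh
    exact h' (χ.phiHat_eq_zero_of_ge hh)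
  have hk : (0 : ℝ) < 2 ^ k := by positivity
  rw [norm_smul, zpow_neg, norm_inv, Real.norm_of_nonneg hk.le] at h1 h2
  rw [inv_mul_eq_div, one_lt_div hk] at h1
  rw [inv_mul_eq_div, div_lt_iff₀ hk] at h2
  refine ⟨h1, ?_⟩
  rw [zpow_add₀ (by norm_num)]
  norm_num
  linarith

/-- The pointwise product of Schwartz functions. -/
def sprod (f g : 𝓢(V, ℂ)) : 𝓢(V, ℂ) := pairing (ContinuousLinearMap.mul ℂ ℂ) f g

@[simp]
theorem sprod_apply (f g : 𝓢(V, ℂ)) (x : V) : sprod f g x = f x * g x := rfl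

theorem fourier_sprod (f g : 𝓢(V, ℂ)) (ξ : V) :
    𝓕 (sprod f g) ξ = ∫ t, 𝓕 f (-t) * 𝓕 g (ξ + t) := by
  have h1 : sprod f g = 𝓕 (SchwartzMap.convolution (ContinuousLinearMap.mul ℂ ℂ) (𝓕⁻ f) (𝓕⁻ g)) := by
    rw [fourier_convolution, FourierTransform.fourier_fourierInv_eq,
      FourierTransform.fourier_fourierInv_eq]
    rfl
  have h2 : ∀ (h : 𝓢(V, ℂ)) (x : V), 𝓕⁻ h x = 𝓕 h (-x) := fun h x => by
    rw [fourierInv_apply_eq]; rfl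
  have h3 : 𝓕 (sprod f g) ξ = 𝓕⁻ (sprod f g) (-ξ) := by rw [h2, neg_neg]
  rw [h3, h1, FourierTransform.fourierInv_fourier_eq, convolution_apply]
  refine integral_congr_ae (.of_forall fun t => ?_)
  change 𝓕⁻ f t * 𝓕⁻ g (-ξ - t) = _
  rw [h2, h2]
  congr 2
  abel

theorem block_sprod_eq_zero (χ : LPF V) (f g : 𝓢(V, ℂ)) {j l k : ℤ}
    (h : (j + 3 ≤ k ∧ l + 3 ≤ k) ∨ (j + 3 ≤ l ∧ k + 3 ≤ l)) :
    mulOp χ.phi k (sprod (mulOp χ.phi j f) (mulOp χ.phi l g)) = 0 := by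
  refine ext_fourier fun ξ => ?_
  rw [fourier_mulOp, FourierTransform.fourier_zero, zero_apply]
  by_contra! hne
  have hk := phi_dil_ne_zero χ (left_ne_zero_of_mul hne)
  rw [fourier_sprod] at hne
  obtain ⟨t, ht⟩ : ∃ t, 𝓕 (mulOp χ.phi j f) (-t) * 𝓕 (mulOp χ.phi l g) (ξ + t) ≠ 0 := by
    by_contra! hz
    exact right_ne_zero_of_mul hne (by simp [hz])
  rw [fourier_mulOp, fourier_mulOp] at ht
  have hj := phi_dil_ne_zero χ (left_ne_zero_of_mul (left_ne_zero_of_mul ht))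
  have hl := phi_dil_ne_zero χ (left_ne_zero_of_mul (right_ne_zero_of_mul ht))
  rw [norm_neg] at hj
  have hmono : ∀ {a b : ℤ}, a ≤ b → (2 : ℝ) ^ a ≤ 2 ^ b :=
    fun hab => zpow_le_zpow_right₀ (by norm_num) hab
  have hdbl : ∀ a : ℤ, (2 : ℝ) ^ (a + 1) = 2 * 2 ^ a := fun a => by
    rw [zpow_add₀ (by norm_num), zpow_one, mul_comm]
  rcases h with ⟨h1, h2⟩ | ⟨h1, h2⟩
  · have e1 := hmono (show j + 2 ≤ k - 1 by omega)
    have e2 := hmono (show l + 2 ≤ k - 1 by omega)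
    have e3 := hdbl (k - 1)
    rw [sub_add_cancel] at e3
    have := norm_sub_le (ξ + t) t
    rw [add_sub_cancel_right] at this
    linarith
  · have e1 := hmono (show j + 2 ≤ l - 1 by omega)
    have e2 := hmono (show k + 2 ≤ l - 1 by omega)
    have e3 := hdbl (l - 1)
    rw [sub_add_cancel] at e3
    have := norm_add_le ξ t
    linarith

end Block

end MHD

namespace MHD

open SchwartzMap FourierTransform LineDeriv
open scoped NNReal

section Estimates

variable {V : Type*} [NormedAddCommGroup V] [InnerProductSpace ℝ V]
    [FiniteDimensional ℝ V] [MeasurableSpace V] [BorelSpace V]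

theorem coe_smul' (c : ℂ) (f : 𝓢(V, ℂ)) : ⇑(c • f) = c • ⇑f := rfl

theorem coe_sum' {ι : Type*} (s : Finset ι) (f : ι → 𝓢(V, ℂ)) :
    ⇑(∑ i ∈ s, f i) = ∑ i ∈ s, ⇑(f i) := by
  ext x
  simp [sum_apply]

theorem besov_eq (χ : LPF V) (s p : ℝ) (f : 𝓢(V, ℂ)) :
    besov χ s p f = ∑' k : ℤ, (2 : ℝ≥0∞) ^ (s * (k : ℝ)) *
      eLpNorm (mulOp χ.phi k f) (ENNReal.ofReal p) volume := by
  refine tsum_congr fun k => ?_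
  rw [χ.block_eq, ← ENNReal.ofReal_rpow_of_pos (by norm_num)]
  simp

theorem two_rpow_add (a b : ℝ) : (2 : ℝ≥0∞) ^ (a + b) = 2 ^ a * 2 ^ b :=
  ENNReal.rpow_add _ _ (by norm_num) (by norm_num)

theorem enorm_two_zpow (k : ℤ) : ‖(2 : ℂ) ^ k‖ₑ = (2 : ℝ≥0∞) ^ (k : ℝ) := by
  rw [← ofReal_norm, norm_zpow, Complex.norm_ofNat, ← Real.rpow_intCast,
    ← ENNReal.ofReal_rpow_of_pos (by norm_num)]
  simp

theorem exists_besov_lineDeriv_le (χ : LPF V) (s : ℝ) {p : ℝ} (hp : 1 ≤ p) (e : V) :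
    ∃ C : ℝ≥0, ∀ f : 𝓢(V, ℂ),
      besov χ s p (∂_{e} f : 𝓢(V, ℂ)) ≤ C * besov χ (s + 1) p f := by
  obtain ⟨C, hC⟩ := exists_eLpNorm_mulOp_le (χ.dsym e)
  refine ⟨C, fun f => ?_⟩
  rw [besov_eq, besov_eq, ← ENNReal.tsum_mul_left]
  refine ENNReal.tsum_le_tsum fun k => ?_
  rw [mulOp_phi_lineDeriv]
  have h1 : eLpNorm (((2 : ℂ) ^ k) • mulOp (χ.dsym e) k (mulOp χ.phi k f) : 𝓢(V, ℂ))
      (ENNReal.ofReal p) volume ≤ (2 : ℝ≥0∞) ^ (k : ℝ) *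
        (C * eLpNorm (mulOp χ.phi k f) (ENNReal.ofReal p) volume) := by
    rw [coe_smul', eLpNorm_const_smul, enorm_two_zpow]
    gcongr
    exact (hC p hp k _).1
  calc _ ≤ (2 : ℝ≥0∞) ^ (s * (k : ℝ)) * ((2 : ℝ≥0∞) ^ (k : ℝ) *
        (C * eLpNorm (mulOp χ.phi k f) (ENNReal.ofReal p) volume)) := by gcongr
    _ = _ := by
      rw [add_mul, two_rpow_add, one_mul]
      ring

theorem exists_besov_le_sum_lineDeriv {ι : Type*} [Fintype ι] (b : OrthonormalBasis ι ℝ V)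
    (χ : LPF V) (s : ℝ) {p : ℝ} (hp : 1 ≤ p) :
    ∃ C : ℝ≥0, ∀ f : 𝓢(V, ℂ),
      besov χ (s + 1) p f ≤ C * ∑ i, besov χ s p (∂_{b i} f : 𝓢(V, ℂ)) := by
  choose C hC using fun i => exists_eLpNorm_mulOp_le (χ.isym (b i))
  refine ⟨∑ i, C i, fun f => ?_⟩
  simp only [besov_eq]
  rw [← Summable.tsum_finsetSum fun i _ => ENNReal.summable, ← ENNReal.tsum_mul_left]
  refine ENNReal.tsum_le_tsum fun k => ?_
  have h1 : eLpNorm (mulOp χ.phi k f) (ENNReal.ofReal p) volume ≤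
      ∑ i, (2 : ℝ≥0∞) ^ (-(k : ℝ)) * (C i *
        eLpNorm (mulOp χ.phi k (∂_{b i} f)) (ENNReal.ofReal p) volume) := by
    rw [mulOp_phi_eq_sum b, coe_sum']
    refine (eLpNorm_sum_le (fun i _ => (SchwartzMap.continuous _).aestronglyMeasurable)
      (by simpa using hp)).trans ?_
    gcongr with i
    rw [coe_smul', eLpNorm_const_smul, enorm_two_zpow, Int.cast_neg]
    gcongr
    exact (hC i p hp k _).1
  calc _ ≤ (2 : ℝ≥0∞) ^ ((s + 1) * (k : ℝ)) * ∑ i, (2 : ℝ≥0∞) ^ (-(k : ℝ)) * (C i *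
        eLpNorm (mulOp χ.phi k (∂_{b i} f)) (ENNReal.ofReal p) volume) := by gcongr
    _ = ∑ i, C i * ((2 : ℝ≥0∞) ^ (s * (k : ℝ)) *
        eLpNorm (mulOp χ.phi k (∂_{b i} f)) (ENNReal.ofReal p) volume) := by
      rw [Finset.mul_sum]
      refine Finset.sum_congr rfl fun i _ => ?_
      rw [← mul_assoc, ← two_rpow_add, show (s + 1) * (k : ℝ) + -(k : ℝ) = s * k by ring]
      ring
    _ ≤ _ := by
      rw [Finset.mul_sum]
      gcongr with i
      exact Finset.single_le_sum (f := C) (fun _ _ => zero_le) (Finset.mem_univ i)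

theorem exists_enorm_block_le (χ : LPF V) : ∃ C : ℝ≥0, ∀ (p : ℝ), 1 ≤ p → ∀ (k : ℤ)
    (f : 𝓢(V, ℂ)) (x : V), ‖mulOp χ.phi k f x‖ₑ ≤
      C * ((2 : ℝ≥0∞) ^ (Module.finrank ℝ V / p * (k : ℝ)) *
        eLpNorm (mulOp χ.phi k f) (ENNReal.ofReal p) volume) := by
  obtain ⟨C, hC⟩ := exists_eLpNorm_mulOp_le χ.fat
  refine ⟨C, fun p hp k f x => ?_⟩
  have := (hC p hp k (mulOp χ.phi k f)).2.1 x
  rwa [mulOp_fat, mul_assoc, mul_comm (k : ℝ)] at this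

theorem eLpNorm_sprod_le_of_bound {p : ℝ} (f g : 𝓢(V, ℂ)) (M : ℝ≥0∞)
    (hM : ∀ x, ‖f x‖ₑ ≤ M) :
    eLpNorm (sprod f g) (ENNReal.ofReal p) volume ≤
      M * eLpNorm g (ENNReal.ofReal p) volume := by
  refine (eLpNorm_smul_le_mul_eLpNorm (p := ∞) (q := ENNReal.ofReal p) (r := ENNReal.ofReal p) (φ := f) (f := g)
    g.continuous.aestronglyMeasurable f.continuous.aestronglyMeasurable).trans ?_
  gcongr
  rw [eLpNorm_exponent_top]
  exact eLpNormEssSup_le_of_ae_enorm_bound (.of_forall hM)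

theorem eLpNorm_sprod_half_le {q : ℝ} (hq : 0 < q) (f g : 𝓢(V, ℂ)) :
    eLpNorm (sprod f g) (ENNReal.ofReal q) volume ≤
      eLpNorm f (ENNReal.ofReal (2 * q)) volume * eLpNorm g (ENNReal.ofReal (2 * q)) volume := by
  have : ENNReal.HolderTriple (ENNReal.ofReal (2 * q)) (ENNReal.ofReal (2 * q))
      (ENNReal.ofReal q) := by
    constructor
    rw [← ENNReal.ofReal_inv_of_pos (by positivity), ← ENNReal.ofReal_inv_of_pos hq,
      ← ENNReal.ofReal_add (by positivity) (by positivity)]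
    congr 1
    field_simp
    norm_num
  exact eLpNorm_smul_le_mul_eLpNorm (φ := f) (f := g)
    g.continuous.aestronglyMeasurable f.continuous.aestronglyMeasurable

theorem exists_geometric_sum_le {a : ℝ} (ha : 0 < a) : ∃ C : ℝ≥0, ∀ M : ℤ,
    ∑' k : ℤ, (if k ≤ M then (2 : ℝ≥0∞) ^ (a * (k : ℝ)) else 0) ≤
      C * (2 : ℝ≥0∞) ^ (a * (M : ℝ)) := by
  have hfin : ∑' n : ℕ, ((2 : ℝ≥0∞) ^ (-a)) ^ n ≠ ∞ := by
    rw [ENNReal.tsum_geometric]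
    simp only [ne_eq, ENNReal.inv_eq_top, tsub_eq_zero_iff_le, not_le]
    exact ENNReal.rpow_lt_one_of_one_lt_of_neg (by norm_num) (by linarith)
  refine ⟨(∑' n : ℕ, ((2 : ℝ≥0∞) ^ (-a)) ^ n).toNNReal, fun M => ?_⟩
  rw [ENNReal.coe_toNNReal hfin, ← ENNReal.tsum_mul_right,
    ← (Equiv.subLeft M).tsum_eq]
  rw [← Function.Injective.tsum_eq (Nat.cast_injective (R := ℤ))]
  · refine ENNReal.tsum_le_tsum fun n => ?_
    simp only [Equiv.subLeft_apply, sub_le_self_iff, Nat.cast_nonneg, if_true]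
    rw [← ENNReal.rpow_natCast, ← ENNReal.rpow_mul, ← two_rpow_add]
    push_cast
    apply le_of_eq
    congr 1
    ring
  · intro k hk
    simp only [Equiv.subLeft_apply, sub_le_self_iff, Function.mem_support, ne_eq,
      ite_eq_right_iff, Classical.not_imp] at hk
    exact ⟨k.toNat, by simpa using hk.1⟩

theorem sprod_comm (f g : 𝓢(V, ℂ)) : sprod f g = sprod g f := by
  ext x
  simp [mul_comm]

theorem exists_besov_sprod_block_le (χ : LPF V) {p : ℝ} (hp : 1 ≤ p)
    (hd : 0 < Module.finrank ℝ V) :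
    ∃ C : ℝ≥0, ∀ (j l : ℤ) (f g : 𝓢(V, ℂ)),
      besov χ (Module.finrank ℝ V / p) p (sprod (mulOp χ.phi j f) (mulOp χ.phi l g)) ≤
        C * ((2 : ℝ≥0∞) ^ (Module.finrank ℝ V / p * (j : ℝ)) *
            eLpNorm (mulOp χ.phi j f) (ENNReal.ofReal p) volume) *
          ((2 : ℝ≥0∞) ^ (Module.finrank ℝ V / p * (l : ℝ)) *
            eLpNorm (mulOp χ.phi l g) (ENNReal.ofReal p) volume) := by
  have ha : 0 < (Module.finrank ℝ V : ℝ) / p := by positivity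
  set a := (Module.finrank ℝ V : ℝ) / p with ha'
  obtain ⟨C₁, hC₁⟩ := exists_eLpNorm_mulOp_le χ.phi
  obtain ⟨C₂, hC₂⟩ := exists_enorm_block_le χ
  obtain ⟨C₃, hC₃⟩ := exists_geometric_sum_le ha
  have main : ∀ (j l : ℤ) (f g : 𝓢(V, ℂ)), l ≤ j →
      besov χ a p (sprod (mulOp χ.phi j f) (mulOp χ.phi l g)) ≤
        (C₃ * C₁ * C₂ * (2 : ℝ≥0∞) ^ (a * 2)) * ((2 : ℝ≥0∞) ^ (a * (j : ℝ)) *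
            eLpNorm (mulOp χ.phi j f) (ENNReal.ofReal p) volume) *
          ((2 : ℝ≥0∞) ^ (a * (l : ℝ)) *
            eLpNorm (mulOp χ.phi l g) (ENNReal.ofReal p) volume) := by
    intro j l f g hjl
    set F := eLpNorm (mulOp χ.phi j f) (ENNReal.ofReal p) volume
    set G := eLpNorm (mulOp χ.phi l g) (ENNReal.ofReal p) volume
    rw [besov_eq]
    calc _ ≤ ∑' k : ℤ, (if k ≤ j + 2 then (2 : ℝ≥0∞) ^ (a * (k : ℝ)) else 0) *
          (C₁ * ((C₂ * ((2 : ℝ≥0∞) ^ (a * (l : ℝ)) * G)) * F)) := by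
          refine ENNReal.tsum_le_tsum fun k => ?_
          split_ifs with hk
          · gcongr
            refine ((hC₁ p hp k _).1).trans ?_
            gcongr
            rw [sprod_comm]
            exact eLpNorm_sprod_le_of_bound _ _ _ (hC₂ p hp l g)
          · rw [block_sprod_eq_zero χ f g (Or.inl ⟨by omega, by omega⟩)]
            simp
      _ ≤ (C₃ * (2 : ℝ≥0∞) ^ (a * ((j + 2 : ℤ) : ℝ))) *
          (C₁ * ((C₂ * ((2 : ℝ≥0∞) ^ (a * (l : ℝ)) * G)) * F)) := by
          rw [ENNReal.tsum_mul_right]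
          gcongr
          exact hC₃ _
      _ = _ := by
          push_cast
          rw [mul_add, two_rpow_add]
          ring
  have hfin : (C₃ * C₁ * C₂ * (2 : ℝ≥0∞) ^ (a * 2)) ≠ ∞ := by
    have : (2 : ℝ≥0∞) ^ (a * 2) ≠ ∞ := ENNReal.rpow_ne_top_of_nonneg (by positivity) (by simp)
    finiteness
  refine ⟨(C₃ * C₁ * C₂ * (2 : ℝ≥0∞) ^ (a * 2)).toNNReal, fun j l f g => ?_⟩
  rw [ENNReal.coe_toNNReal hfin]
  rcases le_total l j with h | h
  · exact main j l f g h
  · rw [sprod_comm]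
    refine (main l j g f h).trans (le_of_eq ?_)
    ring

theorem exists_besov_sprod_block_le_of_nonpos (χ : LPF V) {p s : ℝ} (hp : 2 ≤ p)
    (hs : s ≤ 0) (hs' : 0 < s + Module.finrank ℝ V / p) :
    ∃ C : ℝ≥0, ∀ (j l : ℤ) (f g : 𝓢(V, ℂ)),
      besov χ s p (sprod (mulOp χ.phi j f) (mulOp χ.phi l g)) ≤
        C * ((2 : ℝ≥0∞) ^ (Module.finrank ℝ V / p * (j : ℝ)) *
            eLpNorm (mulOp χ.phi j f) (ENNReal.ofReal p) volume) *
          ((2 : ℝ≥0∞) ^ (s * (l : ℝ)) *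
            eLpNorm (mulOp χ.phi l g) (ENNReal.ofReal p) volume) := by
  set a := (Module.finrank ℝ V : ℝ) / p with ha'
  obtain ⟨C₁, hC₁⟩ := exists_eLpNorm_mulOp_le χ.phi
  obtain ⟨C₂, hC₂⟩ := exists_enorm_block_le χ
  obtain ⟨C₃, hC₃⟩ := exists_geometric_sum_le hs'
  have hp1 : 1 ≤ p := by linarith
  have hne : ∀ b : ℝ, (2 : ℝ≥0∞) ^ b ≠ ∞ := fun b =>
    ENNReal.rpow_ne_top_of_ne_zero (by simp) (by simp)
  have hmono : ∀ {b c : ℝ}, b ≤ c → (2 : ℝ≥0∞) ^ b ≤ 2 ^ c := fun h =>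
    ENNReal.rpow_le_rpow_of_exponent_le (by norm_num) h
  set D₁ : ℝ≥0∞ := C₃ * C₁ * 2 ^ ((s + a) * 4) * 2 ^ (s * (-2)) with hD₁
  set D₂ : ℝ≥0∞ := 5 * (C₁ * C₂) * 2 ^ (s * (-2)) with hD₂
  have hfin : D₁ + D₂ ≠ ∞ := by
    have h1 := hne ((s + a) * 4)
    have h2 := hne (s * (-2))
    finiteness
  refine ⟨(D₁ + D₂).toNNReal, fun j l f g => ?_⟩
  rw [ENNReal.coe_toNNReal hfin]
  set F := eLpNorm (mulOp χ.phi j f) (ENNReal.ofReal p) volume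
  set G := eLpNorm (mulOp χ.phi l g) (ENNReal.ofReal p) volume
  rw [besov_eq]
  by_cases hjl : l ≤ j + 2
  · calc _ ≤ ∑' k : ℤ, (if k ≤ j + 4 then (2 : ℝ≥0∞) ^ ((s + a) * (k : ℝ)) else 0) *
          (C₁ * (F * G)) := by
          refine ENNReal.tsum_le_tsum fun k => ?_
          split_ifs with hk
          · have h1 := ((hC₁ (p / 2) (by linarith) k
              (sprod (mulOp χ.phi j f) (mulOp χ.phi l g))).2.2).trans
              (mul_le_mul_right (eLpNorm_sprod_half_le (by linarith) _ _) _)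
            rw [show 2 * (p / 2) = p by ring, ← ha', mul_comm (k : ℝ) a] at h1
            calc _ ≤ (2 : ℝ≥0∞) ^ (s * (k : ℝ)) *
                  (C₁ * (2 : ℝ≥0∞) ^ (a * (k : ℝ)) * (F * G)) := by gcongr
              _ = _ := by rw [add_mul, two_rpow_add]; ring
          · rw [block_sprod_eq_zero χ f g (Or.inl ⟨by omega, by omega⟩)]
            simp
      _ ≤ (C₃ * (2 : ℝ≥0∞) ^ ((s + a) * ((j + 4 : ℤ) : ℝ))) * (C₁ * (F * G)) := by
          rw [ENNReal.tsum_mul_right]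
          gcongr
          exact hC₃ _
      _ = C₃ * C₁ * 2 ^ ((s + a) * 4) * (2 ^ (a * (j : ℝ)) * F) * (2 ^ (s * (j : ℝ)) * G) := by
          push_cast
          rw [mul_add, two_rpow_add, add_mul, two_rpow_add]
          ring
      _ ≤ C₃ * C₁ * 2 ^ ((s + a) * 4) * (2 ^ (a * (j : ℝ)) * F) *
            (2 ^ (s * (-2) + s * (l : ℝ)) * G) := by
          gcongr
          · norm_num
          have : (l : ℝ) ≤ j + 2 := by exact_mod_cast hjl
          nlinarith
      _ = D₁ * (2 ^ (a * (j : ℝ)) * F) * (2 ^ (s * (l : ℝ)) * G) := by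
          rw [two_rpow_add, hD₁]
          ring
      _ ≤ _ := by
          gcongr
          exact le_self_add
  · calc _ ≤ ∑' k : ℤ, (if k ∈ Finset.Icc (l - 2) (l + 2) then
            (2 : ℝ≥0∞) ^ (s * (-2) + s * (l : ℝ)) *
          (C₁ * ((C₂ * ((2 : ℝ≥0∞) ^ (a * (j : ℝ)) * F)) * G)) else 0) := by
          refine ENNReal.tsum_le_tsum fun k => ?_
          split_ifs with hk
          · rw [Finset.mem_Icc] at hk
            gcongr
            · norm_num
            · have : (l : ℝ) - 2 ≤ k := by exact_mod_cast hk.1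
              nlinarith
            refine ((hC₁ p hp1 k _).1).trans ?_
            gcongr
            exact eLpNorm_sprod_le_of_bound _ _ _ (hC₂ p hp1 j f)
          · rw [Finset.mem_Icc] at hk
            rw [block_sprod_eq_zero χ f g (by omega)]
            simp
      _ = 5 * ((2 : ℝ≥0∞) ^ (s * (-2) + s * (l : ℝ)) *
          (C₁ * ((C₂ * ((2 : ℝ≥0∞) ^ (a * (j : ℝ)) * F)) * G))) := by
          rw [tsum_eq_sum (s := Finset.Icc (l - 2) (l + 2)) (by intro b hb; simp [hb]),
            Finset.sum_ite_of_true (by simp), Finset.sum_const, Int.card_Icc, nsmul_eq_mul,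
            show (l + 2 + 1 - (l - 2)).toNat = 5 by omega]
          norm_num
      _ = D₂ * (2 ^ (a * (j : ℝ)) * F) * (2 ^ (s * (l : ℝ)) * G) := by
          rw [two_rpow_add, hD₂]
          ring
      _ ≤ _ := by
          gcongr
          exact le_add_self

end Estimates

end MHD

namespace MHD

open SchwartzMap FourierTransform Filter Topology
open scoped NNReal

section Product

variable {V : Type*} [NormedAddCommGroup V] [InnerProductSpace ℝ V]
    [FiniteDimensional ℝ V] [MeasurableSpace V] [BorelSpace V]

/-- The truncated Littlewood–Paley expansion `∑_{-n ≤ j < n} Δ̇_j f`. -/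
def partialBlocks (χ : LPF V) (n : ℕ) (f : 𝓢(V, ℂ)) : 𝓢(V, ℂ) :=
  ∑ i ∈ Finset.range (2 * n), mulOp χ.phi (i - n) f

theorem phi_dil_eq (χ : LPF V) (k : ℤ) (ξ : V) :
    χ.phi ((2 : ℝ) ^ (-k) • ξ) =
      ((χ.chi ((2 : ℝ) ^ (-(k + 1)) • ξ) - χ.chi ((2 : ℝ) ^ (-k) • ξ) : ℝ) : ℂ) := by
  change ((χ.phiHat _ : ℝ) : ℂ) = _
  rw [LPF.phiHat, smul_smul, neg_add, zpow_add₀ (by norm_num) (-k) (-1), mul_comm (2 ^ (-k) : ℝ)]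
  simp

theorem fourier_partialBlocks (χ : LPF V) (n : ℕ) (f : 𝓢(V, ℂ)) (ξ : V) :
    𝓕 (partialBlocks χ n f) ξ =
      ((χ.chi ((2 : ℝ) ^ (-(n : ℤ)) • ξ) - χ.chi ((2 : ℝ) ^ (n : ℤ) • ξ) : ℝ) : ℂ) * 𝓕 f ξ := by
  rw [partialBlocks, FourierTransform.fourier_sum, sum_apply]
  simp only [fourier_mulOp, phi_dil_eq]
  rw [← Finset.sum_mul, ← Complex.ofReal_sum]
  have := Finset.sum_range_sub
    (fun i : ℕ => χ.chi ((2 : ℝ) ^ (-((i : ℤ) - n)) • ξ)) (2 * n)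
  simp only [Nat.cast_add, Nat.cast_one, Nat.cast_mul, Nat.cast_ofNat, Nat.cast_zero] at this
  rw [show -(2 * (n : ℤ) - n) = -n by ring, show -(0 - (n : ℤ)) = n by ring] at this
  rw [← this]
  simp only [show ∀ i : ℕ, (i : ℤ) + 1 - n = i - n + 1 by intro i; ring]

theorem LPF.chi_le_one_s12 (χ : LPF V) (ξ : V) : χ.chi ξ ≤ 1 :=
  (χ.radial_antitone 0 ξ (by simp)).trans (χ.eq_one 0 (by simp)).le

theorem norm_fourier_partialBlocks_le (χ : LPF V) (n : ℕ) (f : 𝓢(V, ℂ)) (ξ : V) :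
    ‖𝓕 (partialBlocks χ n f) ξ‖ ≤ ‖𝓕 f ξ‖ := by
  rw [fourier_partialBlocks, norm_mul, Complex.norm_real, Real.norm_eq_abs]
  refine mul_le_of_le_one_left (norm_nonneg _) (abs_le.2 ⟨?_, ?_⟩) <;>
  · have := χ.nonneg ((2 : ℝ) ^ (-(n : ℤ)) • ξ)
    have := χ.nonneg ((2 : ℝ) ^ (n : ℤ) • ξ)
    have := χ.chi_le_one_s12 ((2 : ℝ) ^ (-(n : ℤ)) • ξ)
    have := χ.chi_le_one_s12 ((2 : ℝ) ^ (n : ℤ) • ξ)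
    linarith

theorem tendsto_fourier_partialBlocks (χ : LPF V) (f : 𝓢(V, ℂ)) {ξ : V} (hξ : ξ ≠ 0) :
    Tendsto (fun n => 𝓕 (partialBlocks χ n f) ξ) atTop (𝓝 (𝓕 f ξ)) := by
  have h0 : 0 < ‖ξ‖ := norm_pos_iff.2 hξ
  obtain ⟨a, ha⟩ := pow_unbounded_of_one_lt ‖ξ‖ (one_lt_two (α := ℝ))
  obtain ⟨b, hb⟩ := pow_unbounded_of_one_lt (2 / ‖ξ‖) (one_lt_two (α := ℝ))
  refine tendsto_const_nhds.congr' ?_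
  filter_upwards [eventually_ge_atTop a, eventually_ge_atTop b] with n hna hnb
  rw [fourier_partialBlocks, χ.eq_one, χ.supp]
  · simp
  · rw [norm_smul, norm_zpow, Real.norm_ofNat, zpow_natCast, ← div_le_iff₀ h0]
    exact hb.le.trans (pow_le_pow_right₀ one_le_two hnb)
  · rw [norm_smul, norm_zpow, Real.norm_ofNat, zpow_neg, zpow_natCast,
      inv_mul_le_one₀ (by positivity)]
    exact ha.le.trans (pow_le_pow_right₀ one_le_two hna)

theorem eq_integral_fourier (f : 𝓢(V, ℂ)) (x : V) :
    f x = ∫ ξ, Real.fourierChar (inner ℝ ξ x) • 𝓕 f ξ := by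
  conv_lhs => rw [← FourierTransform.fourierInv_fourier_eq (E := 𝓢(V, ℂ)) (F := 𝓢(V, ℂ)) f]
  rw [fourierInv_coe, Real.fourierInv_eq]

theorem norm_partialBlocks_le (χ : LPF V) (n : ℕ) (f : 𝓢(V, ℂ)) (x : V) :
    ‖partialBlocks χ n f x‖ ≤ ∫ ξ, ‖𝓕 f ξ‖ := by
  rw [eq_integral_fourier]
  refine norm_integral_le_of_norm_le (𝓕 f).integrable.norm (.of_forall fun ξ => ?_)
  rw [Circle.norm_smul]
  exact norm_fourier_partialBlocks_le χ n f ξ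

theorem tendsto_partialBlocks (χ : LPF V) [Nontrivial V] (f : 𝓢(V, ℂ)) (x : V) :
    Tendsto (fun n => partialBlocks χ n f x) atTop (𝓝 (f x)) := by
  rw [eq_integral_fourier f x]
  simp only [eq_integral_fourier (partialBlocks χ _ f) x]
  refine tendsto_integral_of_dominated_convergence (fun ξ => ‖𝓕 f ξ‖) (fun n => ?_)
    (𝓕 f).integrable.norm (fun n => .of_forall fun ξ => ?_) ?_
  · refine Continuous.aestronglyMeasurable ?_
    have := (𝓕 (partialBlocks χ n f)).continuous
    fun_prop
  · rw [Circle.norm_smul]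
    exact norm_fourier_partialBlocks_le χ n f ξ
  · have : ∀ᵐ ξ : V, ξ ≠ 0 := by simp [ae_iff]
    filter_upwards [this] with ξ hξ
    exact (tendsto_fourier_partialBlocks χ f hξ).const_smul _

theorem tendsto_mulOp_sprod_partialBlocks (χ : LPF V) [Nontrivial V] (m f g : 𝓢(V, ℂ)) (k : ℤ)
    (x : V) :
    Tendsto (fun n => mulOp m k (sprod (partialBlocks χ n f) (partialBlocks χ n g)) x) atTop
      (𝓝 (mulOp m k (sprod f g) x)) := by
  simp only [mulOp_eq_integral]
  refine tendsto_integral_of_dominated_convergence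
    (fun t => ‖(𝓕⁻ (dil k m) : 𝓢(V, ℂ)) t‖ * ((∫ ξ, ‖𝓕 f ξ‖) * ∫ ξ, ‖𝓕 g ξ‖)) (fun n => ?_)
    ((𝓕⁻ (dil k m) : 𝓢(V, ℂ)).integrable.norm.mul_const _)
    (fun n => .of_forall fun t => ?_) (.of_forall fun t => ?_)
  · refine Continuous.aestronglyMeasurable ?_
    have := (sprod (partialBlocks χ n f) (partialBlocks χ n g)).continuous
    have := (𝓕⁻ (dil k m) : 𝓢(V, ℂ)).continuous
    fun_prop
  · rw [norm_mul, sprod_apply, norm_mul]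
    gcongr
    · exact norm_partialBlocks_le χ n f _
    · exact norm_partialBlocks_le χ n g _
  · simp only [sprod_apply]
    exact ((tendsto_partialBlocks χ f _).mul (tendsto_partialBlocks χ g _)).const_mul _

theorem mulOp_sprod_partialBlocks (χ : LPF V) (m f g : 𝓢(V, ℂ)) (k : ℤ) (n : ℕ) :
    mulOp m k (sprod (partialBlocks χ n f) (partialBlocks χ n g)) =
      ∑ i ∈ Finset.range (2 * n), ∑ j ∈ Finset.range (2 * n),
        mulOp m k (sprod (mulOp χ.phi (i - n) f) (mulOp χ.phi (j - n) g)) := by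
  have : sprod (partialBlocks χ n f) (partialBlocks χ n g) =
      ∑ i ∈ Finset.range (2 * n), ∑ j ∈ Finset.range (2 * n),
        sprod (mulOp χ.phi (i - n) f) (mulOp χ.phi (j - n) g) := by
    ext x
    simp only [sprod_apply, partialBlocks, sum_apply, Finset.sum_mul_sum]
  rw [this]
  simp only [mulOp, map_sum]

theorem eLpNorm_mulOp_sprod_le (χ : LPF V) [Nontrivial V] {p : ℝ} (hp : 1 ≤ p)
    (m f g : 𝓢(V, ℂ)) (k : ℤ) :
    eLpNorm (mulOp m k (sprod f g)) (ENNReal.ofReal p) volume ≤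
      ∑' (j : ℤ) (l : ℤ), eLpNorm (mulOp m k (sprod (mulOp χ.phi j f) (mulOp χ.phi l g)))
        (ENNReal.ofReal p) volume := by
  refine Lp.eLpNorm_le_of_ae_tendsto (u := atTop)
    (f := fun n : ℕ => mulOp m k (sprod (partialBlocks χ n f) (partialBlocks χ n g)))
    (.of_forall fun n => ?_) (fun n => (SchwartzMap.continuous _).aestronglyMeasurable)
    (.of_forall fun x => tendsto_mulOp_sprod_partialBlocks χ m f g k x)
  have hinj : Function.Injective fun i : ℕ => (i : ℤ) - n := fun a b h => by simpa using h
  have hle : ∀ a : ℤ → ℝ≥0∞, ∑ i ∈ Finset.range (2 * n), a (i - n) ≤ ∑' j, a j := fun a =>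
    (ENNReal.sum_le_tsum _).trans (ENNReal.tsum_comp_le_tsum_of_injective hinj a)
  have hp' : 1 ≤ ENNReal.ofReal p := by simpa using hp
  rw [mulOp_sprod_partialBlocks, coe_sum']
  refine (eLpNorm_sum_le (fun i _ => (SchwartzMap.continuous _).aestronglyMeasurable) hp').trans ?_
  refine le_trans (Finset.sum_le_sum fun i _ => ?_) (hle _)
  rw [coe_sum']
  refine (eLpNorm_sum_le (fun i _ => (SchwartzMap.continuous _).aestronglyMeasurable) hp').trans ?_
  exact hle fun l => eLpNorm (mulOp m k (sprod (mulOp χ.phi (i - n) f) (mulOp χ.phi l g)))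
        (ENNReal.ofReal p) volume

theorem besov_sprod_le (χ : LPF V) [Nontrivial V] {s a b p : ℝ} (hp : 1 ≤ p) (C : ℝ≥0∞)
    (hC : ∀ (j l : ℤ) (f g : 𝓢(V, ℂ)),
      besov χ s p (sprod (mulOp χ.phi j f) (mulOp χ.phi l g)) ≤
        C * ((2 : ℝ≥0∞) ^ (a * (j : ℝ)) *
            eLpNorm (mulOp χ.phi j f) (ENNReal.ofReal p) volume) *
          ((2 : ℝ≥0∞) ^ (b * (l : ℝ)) *
            eLpNorm (mulOp χ.phi l g) (ENNReal.ofReal p) volume)) (f g : 𝓢(V, ℂ)) :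
    besov χ s p (sprod f g) ≤ C * besov χ a p f * besov χ b p g := by
  calc _ ≤ ∑' k : ℤ, ∑' (j : ℤ) (l : ℤ), (2 : ℝ≥0∞) ^ (s * (k : ℝ)) *
        eLpNorm (mulOp χ.phi k (sprod (mulOp χ.phi j f) (mulOp χ.phi l g)))
        (ENNReal.ofReal p) volume := by
        rw [besov_eq]
        refine ENNReal.tsum_le_tsum fun k => ?_
        simp only [ENNReal.tsum_mul_left]
        gcongr
        exact eLpNorm_mulOp_sprod_le χ hp _ _ _ _
    _ = ∑' (j : ℤ) (l : ℤ), besov χ s p (sprod (mulOp χ.phi j f) (mulOp χ.phi l g)) := by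
        rw [ENNReal.tsum_comm]
        refine tsum_congr fun j => ?_
        rw [ENNReal.tsum_comm]
        exact tsum_congr fun l => (besov_eq _ _ _ _).symm
    _ ≤ ∑' (j : ℤ) (l : ℤ), C * ((2 : ℝ≥0∞) ^ (a * (j : ℝ)) *
            eLpNorm (mulOp χ.phi j f) (ENNReal.ofReal p) volume) *
          ((2 : ℝ≥0∞) ^ (b * (l : ℝ)) *
            eLpNorm (mulOp χ.phi l g) (ENNReal.ofReal p) volume) :=
        ENNReal.tsum_le_tsum fun j => ENNReal.tsum_le_tsum fun l => hC j l f g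
    _ = _ := by
        simp only [ENNReal.tsum_mul_left, ENNReal.tsum_mul_right, besov_eq]

end Product

end MHD

namespace MHD

open SchwartzMap FourierTransform LineDeriv
open scoped NNReal

/-- Smooth compactly supported real functions. -/
def IsTest {V : Type*} [NormedAddCommGroup V] [NormedSpace ℝ V] (f : V → ℝ) : Prop :=
  ContDiff ℝ (⊤ : ℕ∞) f ∧ HasCompactSupport f

section General

variable {V : Type*} [NormedAddCommGroup V] [InnerProductSpace ℝ V]
    [FiniteDimensional ℝ V] [MeasurableSpace V] [BorelSpace V]

namespace IsTest

/-- The complexification of a test function, as a Schwartz function. -/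
def toSchwartz {f : V → ℝ} (hf : IsTest f) : 𝓢(V, ℂ) :=
  HasCompactSupport.toSchwartzMap (f := fun y => (f y : ℂ))
    (hf.2.comp_left (g := fun x : ℝ => (x : ℂ)) Complex.ofReal_zero)
    (Complex.ofRealCLM.contDiff.comp hf.1)

@[simp]
theorem toSchwartz_apply {f : V → ℝ} (hf : IsTest f) (x : V) : hf.toSchwartz x = f x := rfl

theorem coe_toSchwartz {f : V → ℝ} (hf : IsTest f) : ⇑hf.toSchwartz = fun y => (f y : ℂ) := rfl

theorem mul {f g : V → ℝ} (hf : IsTest f) (hg : IsTest g) : IsTest fun x => f x * g x :=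
  ⟨hf.1.mul hg.1, hf.2.mul_right⟩

theorem const_mul (c : ℝ) {f : V → ℝ} (hf : IsTest f) : IsTest fun x => c * f x :=
  ⟨contDiff_const.mul hf.1, hf.2.mul_left⟩

theorem zero : IsTest fun _ : V => (0 : ℝ) := ⟨contDiff_const, HasCompactSupport.zero⟩

theorem add {f g : V → ℝ} (hf : IsTest f) (hg : IsTest g) : IsTest fun x => f x + g x :=
  ⟨hf.1.add hg.1, hf.2.add hg.2⟩

theorem sum {ι : Type*} {s : Finset ι} {f : ι → V → ℝ} (hf : ∀ i ∈ s, IsTest (f i)) :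
    IsTest fun x => ∑ i ∈ s, f i x := by
  classical
  induction s using Finset.induction_on with
  | empty => simpa using zero
  | insert i s hi ih =>
    simp only [Finset.sum_insert hi]
    exact (hf i (by simp)).add (ih fun j hj => hf j (by simp [hj]))

end IsTest

theorem besov_add_le (χ : LPF V) (s : ℝ) {p : ℝ} (hp : 1 ≤ p) {f g : V → ℝ} (hf : IsTest f)
    (hg : IsTest g) :
    besov χ s p (fun x => ((f x + g x : ℝ) : ℂ)) ≤
      besov χ s p (fun x => (f x : ℂ)) + besov χ s p (fun x => (g x : ℂ)) := by
  rw [← hf.coe_toSchwartz, ← hg.coe_toSchwartz, ← (hf.add hg).coe_toSchwartz, besov_eq, besov_eq,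
    besov_eq, ← ENNReal.tsum_add]
  refine ENNReal.tsum_le_tsum fun k => ?_
  have : (hf.add hg).toSchwartz = hf.toSchwartz + hg.toSchwartz := by
    ext x
    simp
  rw [← mul_add, this, mulOp, map_add]
  gcongr
  exact eLpNorm_add_le (SchwartzMap.continuous _).aestronglyMeasurable
    (SchwartzMap.continuous _).aestronglyMeasurable (by simpa using hp)

theorem besov_zero (χ : LPF V) (s p : ℝ) : besov χ s p (fun _ => ((0 : ℝ) : ℂ)) = 0 := by
  have : (fun _ : V => ((0 : ℝ) : ℂ)) = ⇑(0 : 𝓢(V, ℂ)) := by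
    ext
    simp
  rw [this, besov_eq]
  simp [mulOp]

theorem besov_sum_le (χ : LPF V) (s : ℝ) {p : ℝ} (hp : 1 ≤ p) {ι : Type*} {t : Finset ι}
    {f : ι → V → ℝ} (hf : ∀ i ∈ t, IsTest (f i)) :
    besov χ s p (fun x => ((∑ i ∈ t, f i x : ℝ) : ℂ)) ≤
      ∑ i ∈ t, besov χ s p (fun x => (f i x : ℂ)) := by
  classical
  induction t using Finset.induction_on with
  | empty => simpa using (besov_zero χ s p).le
  | insert i t hi ih =>
    simp only [Finset.sum_insert hi]
    refine (besov_add_le χ s hp (hf i (by simp))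
      (IsTest.sum fun j hj => hf j (by simp [hj]))).trans ?_
    gcongr
    exact ih fun j hj => hf j (by simp [hj])

theorem besov_const_mul (χ : LPF V) (s p c : ℝ) {f : V → ℝ} (hf : IsTest f) :
    besov χ s p (fun x => ((c * f x : ℝ) : ℂ)) = ‖c‖ₑ * besov χ s p (fun x => (f x : ℂ)) := by
  rw [← hf.coe_toSchwartz, ← (hf.const_mul c).coe_toSchwartz, besov_eq, besov_eq,
    ← ENNReal.tsum_mul_left]
  refine tsum_congr fun k => ?_
  have : (hf.const_mul c).toSchwartz = (c : ℂ) • hf.toSchwartz := by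
    ext x
    simp
  rw [this, mulOp, map_smul, coe_smul', eLpNorm_const_smul, ← mulOp, ← ofReal_norm (c : ℂ),
    Complex.norm_real, ofReal_norm]
  ring

end General

theorem IsTest.pdv {N : ℕ} {f : Euc N → ℝ} (hf : IsTest f) (i : Fin N) : IsTest (pdv i f) :=
  ⟨(hf.1.fderiv_right (m := (⊤ : ℕ∞)) le_rfl).clm_apply contDiff_const,
    (hf.2.fderiv ℝ).comp_left (g := fun L : Euc N →L[ℝ] ℝ => L (EuclideanSpace.single i 1)) rfl⟩

theorem lineDeriv_toSchwartz {N : ℕ} {f : Euc N → ℝ} (hf : IsTest f) (i : Fin N) :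
    (∂_{EuclideanSpace.single i (1 : ℝ)} hf.toSchwartz : 𝓢(Euc N, ℂ)) =
      (hf.pdv i).toSchwartz := by
  ext x
  rw [lineDerivOp_apply_eq_fderiv, IsTest.toSchwartz_apply, IsTest.coe_toSchwartz]
  have := (Complex.ofRealCLM.hasFDerivAt.comp x
    (hf.1.differentiable (by simp)).differentiableAt.hasFDerivAt).fderiv
  change fderiv ℝ (Complex.ofRealCLM ∘ f) x _ = _
  rw [this]
  rfl

theorem exists_besov_estimates {N : ℕ} (hN : 2 ≤ N) {p : ℝ} (hp1 : (N : ℝ) ≤ p)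
    (hp2 : p < 2 * N) (χ : LPF (Euc N)) :
    ∃ C : ℝ≥0, 1 ≤ C ∧
      (∀ f g : Euc N → ℝ, IsTest f → IsTest g →
        besov χ (N / p) p (fun x => ((f x * g x : ℝ) : ℂ)) ≤
          C * besov χ (N / p) p (fun x => (f x : ℂ)) * besov χ (N / p) p (fun x => (g x : ℂ))) ∧
      (∀ f g : Euc N → ℝ, IsTest f → IsTest g →
        besov χ (-1 + N / p) p (fun x => ((f x * g x : ℝ) : ℂ)) ≤
          C * besov χ (N / p) p (fun x => (f x : ℂ)) *
            besov χ (-1 + N / p) p (fun x => (g x : ℂ))) ∧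
      (∀ (f : Euc N → ℝ) (i : Fin N), IsTest f →
        besov χ (-1 + N / p) p (fun x => ((pdv i f x : ℝ) : ℂ)) ≤
          C * besov χ (N / p) p (fun x => (f x : ℂ))) ∧
      (∀ f : Euc N → ℝ, IsTest f →
        besov χ (N / p) p (fun x => (f x : ℂ)) ≤
          C * ∑ i, besov χ (-1 + N / p) p (fun x => ((pdv i f x : ℝ) : ℂ))) := by
  have hN' : (2 : ℝ) ≤ N := by exact_mod_cast hN
  have hp : 2 ≤ p := hN'.trans hp1
  have hp' : 1 ≤ p := by linarith
  have hfr : Module.finrank ℝ (Euc N) = N := by simp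
  have : NeZero N := ⟨by omega⟩
  have hs : -1 + (N : ℝ) / p ≤ 0 := by
    have : (N : ℝ) / p ≤ 1 := div_le_one_of_le₀ hp1 (by linarith)
    linarith
  have hs' : 0 < -1 + (N : ℝ) / p + N / p := by
    have : 1 / 2 < (N : ℝ) / p := by rw [lt_div_iff₀ (by linarith)]; linarith
    linarith
  obtain ⟨C₁, h₁⟩ := exists_besov_sprod_block_le χ hp' (by omega)
  obtain ⟨C₂, h₂⟩ := exists_besov_sprod_block_le_of_nonpos χ hp hs (by rwa [hfr])
  choose C₃ h₃ using fun i : Fin N =>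
    exists_besov_lineDeriv_le χ (-1 + N / p) hp' (EuclideanSpace.single i (1 : ℝ))
  obtain ⟨C₄, h₄⟩ := exists_besov_le_sum_lineDeriv (EuclideanSpace.basisFun (Fin N) ℝ) χ
    (-1 + N / p) hp'
  rw [hfr] at h₁ h₂
  rw [neg_add_cancel_comm] at h₄
  simp only [neg_add_cancel_comm] at h₃
  refine ⟨1 + C₁ + C₂ + ∑ i, C₃ i + C₄, ?_, fun f g hf hg => ?_, fun f g hf hg => ?_,
    fun f i hf => ?_, fun f hf => ?_⟩
  · simp only [add_assoc]
    exact le_self_add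
  · have h : (hf.mul hg).toSchwartz = sprod hf.toSchwartz hg.toSchwartz := by ext; simp
    have := besov_sprod_le χ hp' C₁ h₁ hf.toSchwartz hg.toSchwartz
    rw [← h] at this
    simp only [IsTest.coe_toSchwartz] at this
    refine this.trans ?_
    gcongr
    exact (le_add_self.trans le_self_add).trans (le_self_add.trans le_self_add)
  · have h : (hf.mul hg).toSchwartz = sprod hf.toSchwartz hg.toSchwartz := by ext; simp
    have := besov_sprod_le χ hp' C₂ h₂ hf.toSchwartz hg.toSchwartz
    rw [← h] at this
    simp only [IsTest.coe_toSchwartz] at this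
    refine this.trans ?_
    gcongr
    exact le_add_self.trans (le_self_add.trans le_self_add)
  · have := h₃ i hf.toSchwartz
    rw [lineDeriv_toSchwartz] at this
    simp only [IsTest.coe_toSchwartz] at this
    refine this.trans ?_
    gcongr
    exact ((Finset.single_le_sum (f := C₃) (fun _ _ => zero_le) (Finset.mem_univ i)).trans
      le_add_self).trans le_self_add
  · have := h₄ hf.toSchwartz
    simp only [EuclideanSpace.basisFun_apply, lineDeriv_toSchwartz] at this
    simp only [IsTest.coe_toSchwartz] at this
    refine this.trans ?_
    gcongr
    exact le_add_self

end MHD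

namespace MHD

open SchwartzMap FourierTransform Filter Topology Set
open scoped NNReal

/-- Minkowski's integral inequality. -/
theorem lintegral_rpow_lintegral_le {α β : Type*} [MeasurableSpace α] [MeasurableSpace β]
    {ν : Measure α} [SFinite ν] {μ : Measure β} [IsFiniteMeasure μ] {q : ℝ} (hq : 1 ≤ q)
    {g : α → β → ℝ≥0∞} (hg : Measurable (Function.uncurry g)) :
    (∫⁻ x, (∫⁻ t, g x t ∂μ) ^ q ∂ν) ^ q⁻¹ ≤ ∫⁻ t, (∫⁻ x, g x t ^ q ∂ν) ^ q⁻¹ ∂μ := by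
  have hq0 : 0 < q := by linarith
  set w : β → ℝ≥0∞ := fun t => (∫⁻ x, g x t ^ q ∂ν) ^ q⁻¹
  have hgq : Measurable (Function.uncurry fun x t => g x t ^ q) := hg.pow_const q
  have hw : Measurable w := (Measurable.lintegral_prod_left' hgq).pow_const _
  have key : ∀ ε : ℝ≥0∞, ε ≠ 0 → ε ≠ ∞ → ∫⁻ t, w t ∂μ ≠ ∞ →
      (∫⁻ x, (∫⁻ t, g x t ∂μ) ^ q ∂ν) ^ q⁻¹ ≤ ∫⁻ t, (w t + ε) ∂μ := by
    intro ε hε hε' hW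
    have hv : Measurable fun t => w t + ε := hw.add_const ε
    have hfin : ∀ᵐ t ∂μ, w t + ε ≠ ∞ := by
      filter_upwards [ae_lt_top hw hW] with t ht
      finiteness
    have h1 : ∀ x, (∫⁻ t, g x t ∂μ) ^ q ≤ (∫⁻ t, (w t + ε) ∂μ) ^ (q - 1) *
        ∫⁻ t, (w t + ε) * (g x t / (w t + ε)) ^ q ∂μ := by
      intro x
      have : ∫⁻ t, g x t ∂μ = ∫⁻ t, (w t + ε) * (g x t / (w t + ε)) ∂μ := by
        refine lintegral_congr_ae ?_
        filter_upwards [hfin] with t ht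
        rw [ENNReal.mul_div_cancel (by simp [hε]) ht]
      rw [this]
      exact lintegral_mul_rpow_le hq hv.aemeasurable
        ((hg.comp measurable_prodMk_left).div hv).aemeasurable
    have hmeas : Measurable (Function.uncurry fun x t =>
        (w t + ε) * (g x t / (w t + ε)) ^ q) :=
      (hv.comp measurable_snd).mul ((hg.div (hv.comp measurable_snd)).pow_const q)
    have h2 : ∫⁻ x, (∫⁻ t, g x t ∂μ) ^ q ∂ν ≤ (∫⁻ t, (w t + ε) ∂μ) ^ q := by
      calc _ ≤ ∫⁻ x, (∫⁻ t, (w t + ε) ∂μ) ^ (q - 1) *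
              ∫⁻ t, (w t + ε) * (g x t / (w t + ε)) ^ q ∂μ ∂ν := lintegral_mono h1
        _ = (∫⁻ t, (w t + ε) ∂μ) ^ (q - 1) *
              ∫⁻ t, ∫⁻ x, (w t + ε) * (g x t / (w t + ε)) ^ q ∂ν ∂μ := by
            have hm : Measurable fun x =>
                ∫⁻ t, (w t + ε) * (g x t / (w t + ε)) ^ q ∂μ := hmeas.lintegral_prod_right'
            rw [lintegral_const_mul _ hm,
              lintegral_lintegral_swap hmeas.aemeasurable]
        _ ≤ (∫⁻ t, (w t + ε) ∂μ) ^ (q - 1) * ∫⁻ t, (w t + ε) ∂μ := by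
            gcongr with t
            have hm : Measurable fun x => g x t ^ q := hgq.comp measurable_prodMk_right
            have e : ∀ x, (w t + ε) * (g x t / (w t + ε)) ^ q =
                (w t + ε) * ((w t + ε) ^ q)⁻¹ * g x t ^ q := fun x => by
              rw [ENNReal.div_rpow_of_nonneg _ _ hq0.le, div_eq_mul_inv]
              ring
            simp only [e]
            rw [lintegral_const_mul _ hm,
              show ∫⁻ x, g x t ^ q ∂ν = w t ^ q by simp [w, ENNReal.rpow_inv_rpow hq0.ne'],
              mul_assoc, mul_comm (_⁻¹)]
            refine mul_le_of_le_one_right zero_le ?_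
            rw [← div_eq_mul_inv]
            refine ENNReal.div_le_of_le_mul ?_
            rw [one_mul]
            gcongr
            exact le_self_add
        _ = _ := by
            conv_lhs => rw [← ENNReal.rpow_one (∫⁻ t, (w t + ε) ∂μ), ← ENNReal.rpow_mul,
              one_mul, ← ENNReal.rpow_add_of_nonneg _ _ (by linarith) zero_le_one]
            simp
    calc _ ≤ ((∫⁻ t, (w t + ε) ∂μ) ^ q) ^ q⁻¹ := by gcongr
      _ = _ := ENNReal.rpow_rpow_inv hq0.ne' _
  refine ENNReal.le_of_forall_pos_le_add fun ε hε hW => ?_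
  have h3 := key (ε / (μ univ + 1)) (by simp [hε.ne']) (by
    have : μ univ + 1 ≠ 0 := by simp
    finiteness) hW.ne
  refine h3.trans ?_
  rw [lintegral_add_right _ measurable_const, lintegral_const]
  gcongr
  rw [div_eq_mul_inv, mul_assoc, mul_comm (_⁻¹), ← div_eq_mul_inv]
  exact mul_le_of_le_one_right zero_le (ENNReal.div_le_of_le_mul (by simp))

/-- Smooth compactly supported real functions of time and space. -/
def IsTimeTest {V : Type*} [NormedAddCommGroup V] [NormedSpace ℝ V] (h : ℝ → V → ℝ) : Prop :=
  IsTest (Function.uncurry h)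

section Time

variable {V : Type*} [NormedAddCommGroup V] [InnerProductSpace ℝ V]
    [FiniteDimensional ℝ V] [MeasurableSpace V] [BorelSpace V]

namespace IsTimeTest

variable {h : ℝ → V → ℝ}

theorem isTest (hh : IsTimeTest h) (t : ℝ) : IsTest (h t) := by
  refine ⟨hh.1.comp (contDiff_const.prodMk contDiff_id), ?_⟩
  refine HasCompactSupport.intro (hh.2.isCompact.image continuous_snd) fun x hx => ?_
  by_contra hne
  exact hx ⟨(t, x), subset_tsupport _ hne, rfl⟩

theorem exists_bound (hh : IsTimeTest h) : ∃ M, ∀ t x, ‖h t x‖ ≤ M := by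
  obtain ⟨M, hM⟩ := hh.2.exists_bound_of_continuous hh.1.continuous
  exact ⟨M, fun t x => hM (t, x)⟩

theorem continuous_mulOp (hh : IsTimeTest h) (m : 𝓢(V, ℂ)) (k : ℤ) :
    Continuous fun q : ℝ × V => mulOp m k (hh.isTest q.1).toSchwartz q.2 := by
  obtain ⟨M, hM⟩ := hh.exists_bound
  have hK := (𝓕⁻ (dil k m) : 𝓢(V, ℂ)).continuous
  have hc := hh.1.continuous
  simp only [mulOp_eq_integral, IsTest.toSchwartz_apply]
  refine continuous_of_dominated (bound := fun z => ‖(𝓕⁻ (dil k m) : 𝓢(V, ℂ)) z‖ * M)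
    (fun q => ?_) (fun q => .of_forall fun z => ?_)
    ((𝓕⁻ (dil k m) : 𝓢(V, ℂ)).integrable.norm.mul_const _) (.of_forall fun z => ?_)
  · have : Continuous fun z => h q.1 (q.2 - z) := hc.comp (by fun_prop : Continuous fun z => (q.1, q.2 - z))
    exact (by fun_prop : Continuous fun z => (𝓕⁻ (dil k m) : 𝓢(V, ℂ)) z * (h q.1 (q.2 - z) : ℂ)).aestronglyMeasurable
  · rw [norm_mul, Complex.norm_real]
    gcongr
    exact hM _ _
  · have : Continuous fun q : ℝ × V => h q.1 (q.2 - z) := hc.comp (by fun_prop : Continuous fun q : ℝ × V => (q.1, q.2 - z))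
    fun_prop

theorem measurable_eLpNorm_mulOp (hh : IsTimeTest h) (m : 𝓢(V, ℂ)) (k : ℤ) {p : ℝ} (hp : 1 ≤ p) :
    Measurable fun t => eLpNorm (mulOp m k (hh.isTest t).toSchwartz) (ENNReal.ofReal p) volume := by
  simp only [eLpNorm_ofReal (by linarith : 0 < p)]
  exact (Measurable.lintegral_prod_right'
    ((hh.continuous_mulOp m k).measurable.enorm.pow_const p)).pow_const _

theorem measurable_besov (hh : IsTimeTest h) (χ : LPF V) (s : ℝ) {p : ℝ} (hp : 1 ≤ p) :
    Measurable fun t => besov χ s p (fun x => (h t x : ℂ)) := by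
  have : ∀ t, besov χ s p (fun x => (h t x : ℂ)) = _ := fun t => besov_eq χ s p (hh.isTest t).toSchwartz
  simp only [this]
  exact Measurable.tsum fun k => (hh.measurable_eLpNorm_mulOp χ.phi k hp).const_mul _

theorem isTest_integral (hh : IsTimeTest h) {t : ℝ} (ht : 0 ≤ t) :
    IsTest fun x => ∫ τ in (0 : ℝ)..t, h τ x := by
  constructor
  · have hk : IsCompact ((fun q : ℝ × V => -q.1) '' tsupport (Function.uncurry h)) :=
      hh.2.isCompact.image (by fun_prop)
    have := contDiffOn_convolution_right_with_param (𝕜 := ℝ) (μ := volume) (n := (⊤ : ℕ∞))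
      (f := (Ioc 0 t).indicator fun _ : ℝ => (1 : ℝ)) (ContinuousLinearMap.mul ℝ ℝ)
      (g := fun (x : V) (r : ℝ) => h (-r) x) (s := univ) isOpen_univ hk (fun x r _ hr => by
        by_contra hne
        refine hr ⟨(-r, x), subset_tsupport _ hne, by simp⟩)
      (((integrable_indicator_iff measurableSet_Ioc).2 (by simp)).locallyIntegrable)
      ((hh.1.comp (by fun_prop : ContDiff ℝ (⊤ : ℕ∞) fun q : V × ℝ => (-q.2, q.1))).contDiffOn)
    rw [univ_prod_univ, contDiffOn_univ] at this
    have h2 := this.comp (by fun_prop : ContDiff ℝ (⊤ : ℕ∞) fun x : V => (x, (0 : ℝ)))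
    convert h2 using 2 with x
    simp only [Function.comp_def, MeasureTheory.convolution, ContinuousLinearMap.mul_apply', zero_sub, neg_neg]
    rw [intervalIntegral.integral_of_le ht, ← integral_indicator measurableSet_Ioc]
    congr 1
    ext τ
    by_cases hτ : τ ∈ Ioc 0 t <;> simp [hτ]
  · refine HasCompactSupport.intro (hh.2.isCompact.image continuous_snd) fun x hx => ?_
    have : ∀ τ, h τ x = 0 := fun τ => by
      by_contra hne
      exact hx ⟨(τ, x), subset_tsupport _ hne, rfl⟩
    simp [this]

theorem mulOp_integral (hh : IsTimeTest h) (m : 𝓢(V, ℂ)) (k : ℤ) {t : ℝ} (ht : 0 ≤ t) (x : V) :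
    mulOp m k (hh.isTest_integral ht).toSchwartz x =
      ∫ τ in Ioc 0 t, mulOp m k (hh.isTest τ).toSchwartz x := by
  obtain ⟨M, hM⟩ := hh.exists_bound
  simp only [mulOp_eq_integral, IsTest.toSchwartz_apply]
  rw [integral_integral_swap]
  · refine integral_congr_ae (.of_forall fun z => ?_)
    simp only
    rw [intervalIntegral.integral_of_le ht, ← integral_complex_ofReal, integral_const_mul]
  · have hK := (𝓕⁻ (dil k m) : 𝓢(V, ℂ)).integrable (μ := volume)
    have hc := hh.1.continuous
    have hc' : Continuous fun q : ℝ × V => h q.1 (x - q.2) :=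
      hc.comp (by fun_prop : Continuous fun q : ℝ × V => (q.1, x - q.2))
    have := (integrable_const (M : ℝ) (μ := volume.restrict (Ioc 0 t))).mul_prod hK.norm
    refine this.mono' ?_ (.of_forall fun q => ?_)
    · have := (𝓕⁻ (dil k m) : 𝓢(V, ℂ)).continuous
      exact (by fun_prop : Continuous fun q : ℝ × V => (𝓕⁻ (dil k m) : 𝓢(V, ℂ)) q.2 * (h q.1 (x - q.2) : ℂ)).aestronglyMeasurable
    · simp only [Function.uncurry]
      rw [norm_mul, Complex.norm_real, mul_comm]
      gcongr
      exact hM _ _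

theorem eLpNorm_mulOp_integral_le (hh : IsTimeTest h) (m : 𝓢(V, ℂ)) (k : ℤ) {p : ℝ} (hp : 1 ≤ p)
    {t : ℝ} (ht : 0 ≤ t) :
    eLpNorm (mulOp m k (hh.isTest_integral ht).toSchwartz) (ENNReal.ofReal p) volume ≤
      ∫⁻ τ in Ioc 0 t,
        eLpNorm (mulOp m k (hh.isTest τ).toSchwartz) (ENNReal.ofReal p) volume := by
  have hp0 : 0 < p := by linarith
  set G : V → ℝ → ℝ≥0∞ := fun x τ => ‖mulOp m k (hh.isTest τ).toSchwartz x‖ₑ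
  have hGm : Measurable (Function.uncurry G) :=
    ((hh.continuous_mulOp m k).comp continuous_swap).enorm.measurable
  have h1 := lintegral_rpow_lintegral_le (μ := volume.restrict (Ioc 0 t)) (ν := volume) hp hGm
  simp only [eLpNorm_ofReal hp0]
  refine le_trans (ENNReal.rpow_le_rpow (lintegral_mono fun x => ?_) (by positivity)) h1
  refine ENNReal.rpow_le_rpow ?_ hp0.le
  rw [hh.mulOp_integral m k ht x]
  exact enorm_integral_le_lintegral_enorm _

theorem besov_integral_le (hh : IsTimeTest h) (χ : LPF V) (s : ℝ) {p : ℝ} (hp : 1 ≤ p) {t : ℝ}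
    (ht : 0 ≤ t) :
    besov χ s p (fun x => ((∫ τ in (0 : ℝ)..t, h τ x : ℝ) : ℂ)) ≤
      ∫⁻ τ in Ioi 0, besov χ s p (fun x => (h τ x : ℂ)) := by
  have hp0 : 0 < p := by linarith
  calc _ = besov χ s p (hh.isTest_integral ht).toSchwartz := rfl
    _ ≤ ∑' k : ℤ, ∫⁻ τ in Ioc 0 t, (2 : ℝ≥0∞) ^ (s * (k : ℝ)) *
        eLpNorm (mulOp χ.phi k (hh.isTest τ).toSchwartz) (ENNReal.ofReal p) volume := by
        rw [besov_eq]
        refine ENNReal.tsum_le_tsum fun k => ?_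
        rw [lintegral_const_mul _ (hh.measurable_eLpNorm_mulOp χ.phi k hp)]
        gcongr
        exact hh.eLpNorm_mulOp_integral_le χ.phi k hp ht
    _ = ∫⁻ τ in Ioc 0 t, besov χ s p (fun x => (h τ x : ℂ)) := by
        rw [← lintegral_tsum fun k =>
          ((hh.measurable_eLpNorm_mulOp χ.phi k hp).const_mul _).aemeasurable]
        exact lintegral_congr fun τ => (besov_eq χ s p (hh.isTest τ).toSchwartz).symm
    _ ≤ _ := lintegral_mono_set Ioc_subset_Ioi_self

end IsTimeTest

end Time

theorem IsTimeTest.pdv {N : ℕ} {h : ℝ → Euc N → ℝ} (hh : IsTimeTest h) (i : Fin N) :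
    IsTimeTest fun t => pdv i (h t) := by
  have : (Function.uncurry fun t => MHD.pdv i (h t)) =
      fun q => fderiv ℝ (Function.uncurry h) q (0, EuclideanSpace.single i 1) := by
    ext ⟨t, x⟩
    have h1 : HasFDerivAt (fun x : Euc N => (t, x))
        (ContinuousLinearMap.inr ℝ ℝ (Euc N)) x := hasFDerivAt_prodMk_right t x
    have := ((hh.1.differentiable (by simp)).differentiableAt.hasFDerivAt.comp x h1).fderiv
    change fderiv ℝ (Function.uncurry h ∘ fun x => (t, x)) x _ = _
    rw [this]
    simp
  rw [IsTimeTest, this]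
  exact ⟨(hh.1.fderiv_right (m := (⊤ : ℕ∞)) le_rfl).clm_apply contDiff_const,
    (hh.2.fderiv ℝ).comp_left (g := fun L : ℝ × Euc N →L[ℝ] ℝ =>
      L (0, EuclideanSpace.single i 1)) rfl⟩

theorem SmoothCpt.isTimeTest {N : ℕ} {u : ℝ → Euc N → Euc N} (hu : SmoothCpt N u) (m : Fin N) :
    IsTimeTest fun t z => u t z m :=
  ⟨(EuclideanSpace.proj m : Euc N →L[ℝ] ℝ).contDiff.comp hu.1,
    hu.2.1.comp_left (g := fun z : Euc N => z m) rfl⟩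

end MHD

namespace MHD

open scoped NNReal

theorem totalDegree_det_le {σ : Type*} {n : ℕ} (M : Matrix (Fin n) (Fin n) (MvPolynomial σ ℝ))
    (hM : ∀ i j, (M i j).totalDegree ≤ 1) : M.det.totalDegree ≤ n := by
  rw [Matrix.det_apply]
  refine MvPolynomial.totalDegree_finsetSum_le fun τ _ => ?_
  refine (MvPolynomial.totalDegree_smul_le _ _).trans ?_
  refine (MvPolynomial.totalDegree_finsetProd _ _).trans ?_
  refine (Finset.sum_le_sum fun i _ => hM (τ i) i).trans ?_
  simp

theorem totalDegree_adjugate_le {σ : Type*} {n : ℕ}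
    (M : Matrix (Fin (n + 1)) (Fin (n + 1)) (MvPolynomial σ ℝ))
    (hM : ∀ i j, (M i j).totalDegree ≤ 1) (i j : Fin (n + 1)) :
    (M.adjugate i j).totalDegree ≤ n := by
  rw [Matrix.adjugate_fin_succ_eq_det_submatrix]
  refine (MvPolynomial.totalDegree_mul _ _).trans ?_
  have h1 : ((-1 : MvPolynomial σ ℝ) ^ (j + i : ℕ)).totalDegree = 0 := by
    rcases neg_one_pow_eq_or (MvPolynomial σ ℝ) (j + i : ℕ) with h | h <;> simp [h]
  rw [h1, zero_add]
  exact totalDegree_det_le _ fun _ _ => hM _ _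

theorem IsCofactorPoly.totalDegree_le {N : ℕ}
    {Q : Fin N → Fin N → MvPolynomial (Fin N × Fin N) ℝ} (hQ : IsCofactorPoly N Q) (i j : Fin N) :
    (Q i j).totalDegree ≤ N - 1 := by
  obtain _ | n := N
  · exact i.elim0
  set M : Matrix (Fin (n + 1)) (Fin (n + 1)) (MvPolynomial (Fin (n + 1) × Fin (n + 1)) ℝ) :=
    1 + Matrix.of fun a b => MvPolynomial.X (a, b) with hM
  have hQ' : Q i j = M.adjugate i j - MvPolynomial.C (if i = j then (1 : ℝ) else 0) := by
    refine MvPolynomial.funext fun x => ?_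
    have h1 := (hQ i j).2 (Matrix.of fun a b => x (a, b))
    have h2 := congrFun (congrFun (RingHom.map_adjugate (MvPolynomial.eval x) M) i) j
    rw [RingHom.mapMatrix_apply, Matrix.map_apply] at h2
    rw [map_sub, h2, MvPolynomial.eval_C, eq_sub_iff_add_eq', hM, map_add, map_one]
    refine h1.symm.trans (congrFun (congrFun (congrArg _ ?_) i) j)
    congr 1
    ext a b
    simp
  have hdeg : ∀ a b, (M a b).totalDegree ≤ 1 := fun a b => by
    rw [hM, Matrix.add_apply, Matrix.one_apply]
    refine (MvPolynomial.totalDegree_add _ _).trans (max_le ?_ (by simp))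
    split_ifs <;> simp
  rw [hQ']
  refine (MvPolynomial.totalDegree_sub _ _).trans (max_le ?_ ?_)
  · exact totalDegree_adjugate_le M hdeg i j
  · exact (MvPolynomial.totalDegree_C _).le.trans (Nat.zero_le _)

section Algebra

variable {V : Type*} [NormedAddCommGroup V] [InnerProductSpace ℝ V]
    [FiniteDimensional ℝ V] [MeasurableSpace V] [BorelSpace V]

theorem besov_monomial_le {σ : Type*} (χ : LPF V) {a p : ℝ} {K : ℝ≥0∞}
    (hK : ∀ f g : V → ℝ, IsTest f → IsTest g → besov χ a p (fun x => ((f x * g x : ℝ) : ℂ)) ≤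
      K * besov χ a p (fun x => (f x : ℂ)) * besov χ a p (fun x => (g x : ℂ)))
    {x : σ → V → ℝ} (hx : ∀ v, IsTest (x v)) {A : ℝ≥0∞}
    (hA : ∀ v, besov χ a p (fun y => (x v y : ℂ)) ≤ A) (d : σ →₀ ℕ) (hd : d ≠ 0) :
    IsTest (fun y => d.prod fun v k => x v y ^ k) ∧
      K * besov χ a p (fun y => ((d.prod fun v k => x v y ^ k : ℝ) : ℂ)) ≤
        (K * A) ^ d.degree := by
  have hadd : ∀ d₁ d₂ : σ →₀ ℕ,
      (d₁ ≠ 0 → IsTest (fun y => d₁.prod fun v k => x v y ^ k) ∧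
        K * besov χ a p (fun y => ((d₁.prod fun v k => x v y ^ k : ℝ) : ℂ)) ≤
          (K * A) ^ d₁.degree) →
      (d₂ ≠ 0 → IsTest (fun y => d₂.prod fun v k => x v y ^ k) ∧
        K * besov χ a p (fun y => ((d₂.prod fun v k => x v y ^ k : ℝ) : ℂ)) ≤
          (K * A) ^ d₂.degree) →
      (d₁ + d₂ ≠ 0 → IsTest (fun y => (d₁ + d₂).prod fun v k => x v y ^ k) ∧
        K * besov χ a p (fun y => (((d₁ + d₂).prod fun v k => x v y ^ k : ℝ) : ℂ)) ≤
          (K * A) ^ (d₁ + d₂).degree) := by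
    intro d₁ d₂ h₁ h₂ h
    rcases eq_or_ne d₁ 0 with rfl | hd₁
    · simpa using h₂ (by simpa using h)
    rcases eq_or_ne d₂ 0 with rfl | hd₂
    · simpa using h₁ hd₁
    obtain ⟨t₁, b₁⟩ := h₁ hd₁
    obtain ⟨t₂, b₂⟩ := h₂ hd₂
    have e : ∀ y, ((d₁ + d₂).prod fun v k => x v y ^ k) =
        (d₁.prod fun v k => x v y ^ k) * d₂.prod fun v k => x v y ^ k := fun y =>
      Finsupp.prod_add_index' (by simp) (fun _ _ _ => pow_add _ _ _)
    simp only [e]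
    refine ⟨t₁.mul t₂, ?_⟩
    rw [map_add, pow_add]
    refine le_trans ?_ (mul_le_mul' b₁ b₂)
    refine (mul_le_mul_right (hK _ _ t₁ t₂) K).trans (le_of_eq ?_)
    ring
  have hsingle : ∀ (v : σ) (n : ℕ), Finsupp.single v n ≠ 0 →
      IsTest (fun y => (Finsupp.single v n).prod fun v k => x v y ^ k) ∧
        K * besov χ a p (fun y => (((Finsupp.single v n).prod fun v k => x v y ^ k : ℝ) : ℂ)) ≤
          (K * A) ^ (Finsupp.single v n).degree := by
    intro v n
    induction n with
    | zero => simp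
    | succ n ih =>
      rw [Finsupp.single_add]
      refine hadd _ _ ih fun _ => ?_
      simp only [Finsupp.prod_single_index, pow_zero, pow_one, Finsupp.degree_single]
      exact ⟨hx v, mul_le_mul_right (hA v) K⟩
  induction d using Finsupp.induction_linear with
  | zero => exact absurd rfl hd
  | add d₁ d₂ h₁ h₂ => exact hadd d₁ d₂ h₁ h₂ hd
  | single v n => exact hsingle v n hd

theorem exists_besov_eval_le {σ : Type*} (χ : LPF V) {a p : ℝ} (hp : 1 ≤ p) {K : ℝ≥0}
    (hK1 : 1 ≤ K)
    (hK : ∀ f g : V → ℝ, IsTest f → IsTest g → besov χ a p (fun x => ((f x * g x : ℝ) : ℂ)) ≤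
      K * besov χ a p (fun x => (f x : ℂ)) * besov χ a p (fun x => (g x : ℂ)))
    {q : MvPolynomial σ ℝ} (h0 : MvPolynomial.constantCoeff q = 0) {n : ℕ}
    (hn : q.totalDegree ≤ n) :
    ∃ C : ℝ≥0, ∀ x : σ → V → ℝ, (∀ v, IsTest (x v)) →
      IsTest (fun y => MvPolynomial.eval (fun v => x v y) q) ∧ ∀ A : ℝ≥0∞,
      (∀ v, besov χ a p (fun y => (x v y : ℂ)) ≤ A) →
      besov χ a p (fun y => ((MvPolynomial.eval (fun v => x v y) q : ℝ) : ℂ)) ≤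
        C * ∑ r ∈ Finset.Icc 1 n, A ^ r := by
  have hne : ∀ d ∈ q.support, d ≠ 0 := by
    rintro d hd rfl
    exact MvPolynomial.mem_support_iff.1 hd h0
  refine ⟨∑ d ∈ q.support, ‖q.coeff d‖₊ * K ^ n, fun x hx => ?_⟩
  have ht : ∀ d ∈ q.support, IsTest fun y => d.prod fun v k => x v y ^ k := fun d hd =>
    (besov_monomial_le χ hK hx (A := ∞) (by simp) d (hne d hd)).1
  simp only [MvPolynomial.eval_eq]
  refine ⟨IsTest.sum fun d hd => (ht d hd).const_mul _, fun A hA => ?_⟩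
  refine (besov_sum_le χ a hp fun d hd => (ht d hd).const_mul _).trans ?_
  rw [ENNReal.ofNNReal_finsetSum, Finset.sum_mul]
  refine Finset.sum_le_sum fun d hd => ?_
  have hdn : d.degree ≤ n := (MvPolynomial.le_totalDegree hd).trans hn
  have hd1 : 1 ≤ d.degree := by
    rw [Nat.one_le_iff_ne_zero, ne_eq, Finsupp.degree_eq_zero_iff]
    exact hne d hd
  have hK1' : (1 : ℝ≥0∞) ≤ K := by exact_mod_cast hK1
  rw [ENNReal.coe_mul, ENNReal.coe_pow, mul_assoc]
  refine (besov_const_mul χ a p (q.coeff d) (ht d hd)).le.trans ?_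
  rw [enorm_eq_nnnorm]
  gcongr
  calc besov χ a p (fun y => ((d.prod fun v k => x v y ^ k : ℝ) : ℂ))
      ≤ K * besov χ a p (fun y => ((d.prod fun v k => x v y ^ k : ℝ) : ℂ)) :=
        le_mul_of_one_le_left zero_le hK1'
    _ ≤ (K * A) ^ d.degree := (besov_monomial_le χ hK hx hA d (hne d hd)).2
    _ = K ^ d.degree * A ^ d.degree := mul_pow _ _ _
    _ ≤ K ^ n * ∑ r ∈ Finset.Icc 1 n, A ^ r := by
        gcongr
        exact Finset.single_le_sum (f := fun r => A ^ r) (fun _ _ => zero_le)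
            (Finset.mem_Icc.2 ⟨hd1, hdn⟩)

end Algebra

end MHD

namespace MHD

open scoped NNReal

theorem besov_nonlinearity_le {N : ℕ} (χ : LPF (Euc N)) {a s p : ℝ} (hp : 1 ≤ p) {C : ℝ≥0}
    (hC : 1 ≤ C)
    (halg : ∀ f g : Euc N → ℝ, IsTest f → IsTest g →
      besov χ s p (fun x => ((f x * g x : ℝ) : ℂ)) ≤
        C * besov χ a p (fun x => (f x : ℂ)) * besov χ s p (fun x => (g x : ℂ)))
    (halg' : ∀ f g : Euc N → ℝ, IsTest f → IsTest g →
      besov χ a p (fun x => ((f x * g x : ℝ) : ℂ)) ≤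
        C * besov χ a p (fun x => (f x : ℂ)) * besov χ a p (fun x => (g x : ℂ)))
    (hder : ∀ (f : Euc N → ℝ) (i : Fin N), IsTest f →
      besov χ s p (fun x => ((pdv i f x : ℝ) : ℂ)) ≤ C * besov χ a p (fun x => (f x : ℂ)))
    (hgrad : ∀ f : Euc N → ℝ, IsTest f →
      besov χ a p (fun x => (f x : ℂ)) ≤ C * ∑ i, besov χ s p (fun x => ((pdv i f x : ℝ) : ℂ)))
    {P : Fin N → Fin N → Euc N → ℝ} (hP : ∀ i j, IsTest (P i j)) {S : ℝ≥0∞}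
    (hS : ∀ i j, besov χ a p (fun x => (P i j x : ℂ)) ≤ S)
    {w : Euc N → ℝ} (hw : IsTest w) :
    besov χ s p (fun y =>
        (((∑ i, ∑ j, ∑ k, P i k y * pdv i (fun z => P j k z * pdv j w z) y) +
          (∑ i, ∑ j, P i j y * pdv i (pdv j w) y) +
          ∑ i, ∑ j, pdv i (fun z => P j i z * pdv j w z) y : ℝ) : ℂ)) ≤
      (3 * N ^ 3 * C ^ 4) * ((S * S + S) *
        ∑ i, ∑ j, besov χ s p (fun y => ((pdv i (pdv j w) y : ℝ) : ℂ))) := by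
  set D := ∑ i, ∑ j, besov χ s p (fun y => ((pdv i (pdv j w) y : ℝ) : ℂ)) with hD
  have hC' : (1 : ℝ≥0∞) ≤ C := by exact_mod_cast hC
  have hDij : ∀ i j, besov χ s p (fun y => ((pdv i (pdv j w) y : ℝ) : ℂ)) ≤ D := fun i j =>
    (Finset.single_le_sum (f := fun j => besov χ s p (fun y => ((pdv i (pdv j w) y : ℝ) : ℂ)))
      (fun _ _ => zero_le) (Finset.mem_univ j)).trans
    (Finset.single_le_sum
      (f := fun i => ∑ j, besov χ s p (fun y => ((pdv i (pdv j w) y : ℝ) : ℂ)))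
      (fun _ _ => zero_le) (Finset.mem_univ i))
  have hg : ∀ j, besov χ a p (fun y => ((pdv j w y : ℝ) : ℂ)) ≤ C * D := fun j =>
    (hgrad _ (hw.pdv j)).trans (mul_le_mul_right
      (Finset.sum_le_sum fun i _ => Finset.single_le_sum
        (f := fun j => besov χ s p (fun y => ((pdv i (pdv j w) y : ℝ) : ℂ)))
        (fun _ _ => zero_le) (Finset.mem_univ j)) _)
  have hPg : ∀ i j k, IsTest fun z => P i j z * pdv k w z := fun i j k => (hP i j).mul (hw.pdv k)
  have hdPg : ∀ i j k l, besov χ s p (fun y => ((pdv l (fun z => P i j z * pdv k w z) y : ℝ) : ℂ)) ≤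
      C * (C * S * (C * D)) := fun i j k l =>
    (hder _ l (hPg i j k)).trans (mul_le_mul_right
      ((halg' _ _ (hP i j) (hw.pdv k)).trans
        (mul_le_mul' (mul_le_mul_right (hS i j) _) (hg k))) _)
  have hN : ∀ i : Fin N, (1 : ℝ≥0∞) ≤ N := fun i => by
    exact_mod_cast i.pos
  have hsum : ∀ (F : Fin N → ℝ≥0∞) (B : ℝ≥0∞), (∀ i, F i ≤ B) → ∑ i, F i ≤ N * B := fun F B h =>
    (Finset.sum_le_card_nsmul _ _ B fun i _ => h i).trans (by simp)
  set R := C ^ 4 * ((S * S + S) * D) with hR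
  have hR1 : C * S * (C * (C * S * (C * D))) ≤ R := by
    calc C * S * (C * (C * S * (C * D))) = C ^ 4 * (S * S * D) := by ring
      _ ≤ R := by rw [hR]; gcongr; exact le_self_add
  have hR3 : C * (C * S * (C * D)) ≤ R := by
    calc C * (C * S * (C * D)) = C ^ 3 * (S * D) := by ring
      _ ≤ R := by
        rw [hR]; gcongr
        · norm_num
        · exact le_add_self
  have hR2 : C * S * D ≤ R := by
    refine le_trans ?_ hR3
    calc C * S * D = 1 * (C * S * (1 * D)) := by ring
      _ ≤ _ := by gcongr
  have t1 : ∀ i j k, IsTest fun y => P i k y * pdv i (fun z => P j k z * pdv j w z) y :=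
    fun i j k => (hP i k).mul ((hPg j k j).pdv i)
  have t2 : ∀ i j, IsTest fun y => P i j y * pdv i (pdv j w) y :=
    fun i j => (hP i j).mul ((hw.pdv j).pdv i)
  have t3 : ∀ i j, IsTest fun y => pdv i (fun z => P j i z * pdv j w z) y :=
    fun i j => (hPg j i j).pdv i
  have T1 : IsTest fun y => ∑ i, ∑ j, ∑ k, P i k y * pdv i (fun z => P j k z * pdv j w z) y :=
    .sum fun i _ => .sum fun j _ => .sum fun k _ => t1 i j k
  have T2 : IsTest fun y => ∑ i, ∑ j, P i j y * pdv i (pdv j w) y :=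
    .sum fun i _ => .sum fun j _ => t2 i j
  have T3 : IsTest fun y => ∑ i, ∑ j, pdv i (fun z => P j i z * pdv j w z) y :=
    .sum fun i _ => .sum fun j _ => t3 i j
  have e1 : besov χ s p (fun y =>
      ((∑ i, ∑ j, ∑ k, P i k y * pdv i (fun z => P j k z * pdv j w z) y : ℝ) : ℂ)) ≤
      N * (N * (N * R)) := by
    refine (besov_sum_le χ s hp fun i _ => .sum fun j _ => .sum fun k _ => t1 i j k).trans
      (hsum _ _ fun i => ?_)
    refine (besov_sum_le χ s hp fun j _ => .sum fun k _ => t1 i j k).trans (hsum _ _ fun j => ?_)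
    refine (besov_sum_le χ s hp fun k _ => t1 i j k).trans (hsum _ _ fun k => ?_)
    exact (halg _ _ (hP i k) ((hPg j k j).pdv i)).trans
      ((mul_le_mul' (mul_le_mul_right (hS i k) _) (hdPg j k j i)).trans hR1)
  have e2 : besov χ s p (fun y => ((∑ i, ∑ j, P i j y * pdv i (pdv j w) y : ℝ) : ℂ)) ≤
      N * (N * (N * R)) := by
    refine (besov_sum_le χ s hp fun i _ => .sum fun j _ => t2 i j).trans (hsum _ _ fun i => ?_)
    refine (besov_sum_le χ s hp fun j _ => t2 i j).trans (hsum _ _ fun j => ?_)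
    refine le_trans ?_ (le_mul_of_one_le_left zero_le (hN i))
    exact (halg _ _ (hP i j) ((hw.pdv j).pdv i)).trans
      ((mul_le_mul' (mul_le_mul_right (hS i j) _) (hDij i j)).trans hR2)
  have e3 : besov χ s p (fun y =>
      ((∑ i, ∑ j, pdv i (fun z => P j i z * pdv j w z) y : ℝ) : ℂ)) ≤ N * (N * (N * R)) := by
    refine (besov_sum_le χ s hp fun i _ => .sum fun j _ => t3 i j).trans (hsum _ _ fun i => ?_)
    refine (besov_sum_le χ s hp fun j _ => t3 i j).trans (hsum _ _ fun j => ?_)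
    exact ((hdPg j i j i).trans hR3).trans (le_mul_of_one_le_left zero_le (hN i))
  refine (besov_add_le χ s hp (T1.add T2) T3).trans ?_
  refine (add_le_add ((besov_add_le χ s hp T1 T2).trans (add_le_add e1 e2)) e3).trans
    (le_of_eq ?_)
  rw [hR]
  ring

theorem mul_geom_sum_le {N : ℕ} (hN : 2 ≤ N) (E S : ℝ≥0∞) :
    ((S * ∑ r ∈ Finset.Icc 1 (N - 1), E ^ r) * (S * ∑ r ∈ Finset.Icc 1 (N - 1), E ^ r) +
        S * ∑ r ∈ Finset.Icc 1 (N - 1), E ^ r) * E ≤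
      (N ^ 2 * S ^ 2 + N * S) * ∑ r ∈ Finset.Icc 2 (2 * N - 1), E ^ r := by
  set G := ∑ r ∈ Finset.Icc 1 (N - 1), E ^ r with hG
  set F := ∑ r ∈ Finset.Icc 2 (2 * N - 1), E ^ r with hF
  have hmem : ∀ r, 2 ≤ r → r ≤ 2 * N - 1 → E ^ r ≤ F := fun r h1 h2 =>
    Finset.single_le_sum (f := fun r => E ^ r) (fun _ _ => zero_le) (Finset.mem_Icc.2 ⟨h1, h2⟩)
  have hsum : ∀ (f : ℕ → ℝ≥0∞) (B : ℝ≥0∞), (∀ r ∈ Finset.Icc 1 (N - 1), f r ≤ B) →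
      ∑ r ∈ Finset.Icc 1 (N - 1), f r ≤ N * B := fun f B h => by
    refine (Finset.sum_le_card_nsmul _ _ B h).trans ?_
    rw [Nat.card_Icc, nsmul_eq_mul]
    gcongr
    omega
  have h1 : G * E ≤ N * F := by
    rw [hG, Finset.sum_mul]
    refine hsum _ _ fun r hr => ?_
    rw [Finset.mem_Icc] at hr
    rw [← pow_succ]
    exact hmem _ (by omega) (by omega)
  have h2 : G * G * E ≤ N ^ 2 * F := by
    rw [hG, Finset.sum_mul_sum, Finset.sum_mul, pow_two, mul_assoc]
    refine hsum _ _ fun r hr => ?_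
    rw [Finset.sum_mul]
    refine hsum _ _ fun r' hr' => ?_
    rw [Finset.mem_Icc] at hr hr'
    rw [← pow_add, ← pow_succ]
    exact hmem _ (by omega) (by omega)
  calc (S * G * (S * G) + S * G) * E = S ^ 2 * (G * G * E) + S * (G * E) := by ring
    _ ≤ S ^ 2 * (N ^ 2 * F) + S * (N * F) := by gcongr
    _ = _ := by ring

theorem besov_integral_grad_le {N : ℕ} (χ : LPF (Euc N)) {a s p : ℝ} (hp : 1 ≤ p) {C : ℝ≥0}
    (hgrad : ∀ f : Euc N → ℝ, IsTest f →
      besov χ a p (fun x => (f x : ℂ)) ≤ C * ∑ i, besov χ s p (fun x => ((pdv i f x : ℝ) : ℂ)))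
    {u : ℝ → Euc N → Euc N} (hu : SmoothCpt N u) {t : ℝ} (ht : 0 ≤ t) (m l : Fin N) :
    besov χ a p (fun y => ((∫ τ in (0 : ℝ)..t, pdv l (fun z => u τ z m) y : ℝ) : ℂ)) ≤
      C * EE χ s p u := by
  have hul := (hu.isTimeTest m).pdv l
  refine (hul.besov_integral_le χ a hp ht).trans ?_
  refine (lintegral_mono fun τ => hgrad _ (hul.isTest τ)).trans ?_
  rw [lintegral_const_mul _ (Finset.measurable_sum _ fun i _ => (hul.pdv i).measurable_besov χ s hp),
    lintegral_finsetSum _ fun i _ => (hul.pdv i).measurable_besov χ s hp]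
  refine mul_le_mul_right ?_ _
  rw [EE]
  refine le_trans (Finset.sum_le_sum fun i _ => ?_) (Finset.single_le_sum
    (f := fun m => ∑ i, ∑ j, besovT χ s p (Set.Ioi 0) fun t y =>
      ((pdv i (pdv j fun z => u t z m) y : ℝ) : ℂ)) (fun _ _ => zero_le) (Finset.mem_univ m))
  exact Finset.single_le_sum (f := fun j => besovT χ s p (Set.Ioi 0) fun t y =>
    ((pdv i (pdv j fun z => u t z m) y : ℝ) : ℂ)) (fun _ _ => zero_le) (Finset.mem_univ l)

theorem exists_besov_Pmat_le {N : ℕ} (χ : LPF (Euc N)) {a s p : ℝ} (hp : 1 ≤ p) {C : ℝ≥0}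
    (hC : 1 ≤ C)
    (halg : ∀ f g : Euc N → ℝ, IsTest f → IsTest g →
      besov χ a p (fun x => ((f x * g x : ℝ) : ℂ)) ≤
        C * besov χ a p (fun x => (f x : ℂ)) * besov χ a p (fun x => (g x : ℂ)))
    (hgrad : ∀ f : Euc N → ℝ, IsTest f →
      besov χ a p (fun x => (f x : ℂ)) ≤ C * ∑ i, besov χ s p (fun x => ((pdv i f x : ℝ) : ℂ)))
    {Q : Fin N → Fin N → MvPolynomial (Fin N × Fin N) ℝ} (hQ : IsCofactorPoly N Q) :
    ∃ K : ℝ≥0, ∀ u : ℝ → Euc N → Euc N, SmoothCpt N u → ∀ t : ℝ, 0 ≤ t → ∀ i j,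
      IsTest (fun y => Pmat Q u t y i j) ∧
      besov χ a p (fun y => (Pmat Q u t y i j : ℂ)) ≤
        K * ∑ r ∈ Finset.Icc 1 (N - 1), EE χ s p u ^ r := by
  choose K hK using fun i j => exists_besov_eval_le χ hp hC halg (hQ i j).1
    (hQ.totalDegree_le i j)
  have hC' : (1 : ℝ≥0∞) ≤ C := by exact_mod_cast hC
  refine ⟨(∑ i, ∑ j, K i j) * C ^ N, fun u hu t ht i j => ?_⟩
  obtain ⟨h1, h2⟩ := hK i j
    (fun v y => ∫ τ in (0 : ℝ)..t, pdv v.2 (fun z => u τ z v.1) y)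
    fun v => ((hu.isTimeTest v.1).pdv v.2).isTest_integral ht
  refine ⟨h1, (h2 _ fun v => besov_integral_grad_le χ hp hgrad hu ht v.1 v.2).trans ?_⟩
  rw [ENNReal.coe_mul, ENNReal.coe_pow, mul_assoc, Finset.mul_sum (Finset.Icc 1 (N - 1)) _
    ((C : ℝ≥0∞) ^ N)]
  refine mul_le_mul' (ENNReal.coe_le_coe.2 ?_) (Finset.sum_le_sum fun r hr => ?_)
  · exact (Finset.single_le_sum (f := fun j => K i j) (fun _ _ => zero_le)
      (Finset.mem_univ j)).trans (Finset.single_le_sum (f := fun i => ∑ j, K i j)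
      (fun _ _ => zero_le) (Finset.mem_univ i))
  · rw [mul_pow]
    gcongr
    exact (Finset.mem_Icc.1 hr).2.trans (Nat.sub_le _ _)

end MHD

/-- **estimate (3.5).** For `N ≤ p < 2N − 1`,
`‖V₁(u)‖_{L¹(ℝ₊;Ḃ^{−1+N/p}_{p,1})} ≤ C ∑_{r=2}^{2N−1} E(u)^r`, where
`V₁(u) = ∑_{i,j,k} P_{ik} ∂_i(P_{jk} ∂_j u) + ∑_{i,j} P_{ij} ∂_i∂_j u + ∑_{i,j} ∂_i(P_{ji} ∂_j u)`. -/
theorem V1_estimate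
    (N : ℕ) (hN : 2 ≤ N) (p : ℝ) (hp1 : (N : ℝ) ≤ p) (hp2 : p < 2 * N - 1)
    (χ : LPF (Euc N))
    (Q : Fin N → Fin N → MvPolynomial (Fin N × Fin N) ℝ) (hQ : IsCofactorPoly N Q) :
    ∃ C : ℝ, 0 < C ∧
      ∀ u : ℝ → Euc N → Euc N, SmoothCpt N u →
        (∑ m : Fin N, besovT χ (-1 + N / p) p (Set.Ioi 0) (fun t y =>
          ((((∑ i : Fin N, ∑ j : Fin N, ∑ k : Fin N,
                Pmat Q u t y i k *
                  pdv i (fun z => Pmat Q u t z j k * pdv j (fun z' => u t z' m) z) y) +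
              (∑ i : Fin N, ∑ j : Fin N,
                Pmat Q u t y i j * pdv i (pdv j fun z => u t z m) y) +
              ∑ i : Fin N, ∑ j : Fin N,
                pdv i (fun z => Pmat Q u t z j i * pdv j (fun z' => u t z' m) z) y : ℝ)) : ℂ))) ≤
        ENNReal.ofReal C *
          ∑ r ∈ Finset.Icc 2 (2 * N - 1), EE χ (-1 + N / p) p u ^ r := by
  have hN' : (2 : ℝ) ≤ N := by exact_mod_cast hN
  have hp : 1 ≤ p := by linarith
  obtain ⟨C, hC, halg, halg', hder, hgrad⟩ := exists_besov_estimates hN hp1 (by linarith) χ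
  obtain ⟨K, hK⟩ := exists_besov_Pmat_le χ hp hC halg hgrad hQ
  set B : NNReal := 3 * N ^ 3 * C ^ 4 * (N ^ 2 * K ^ 2 + N * K) with hB
  refine ⟨B + 1, by positivity, fun u hu => ?_⟩
  set E := EE χ (-1 + N / p) p u with hE
  set S := K * ∑ r ∈ Finset.Icc 1 (N - 1), E ^ r with hS
  have hmeas : ∀ m i j : Fin N, Measurable fun t =>
      besov χ (-1 + N / p) p (fun y => ((pdv i (pdv j fun z => u t z m) y : ℝ) : ℂ)) :=
    fun m i j => (((hu.isTimeTest m).pdv j).pdv i).measurable_besov χ _ hp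
  have hslice : ∀ m : Fin N, besovT χ (-1 + N / p) p (Set.Ioi 0) (fun t y =>
      ((((∑ i : Fin N, ∑ j : Fin N, ∑ k : Fin N,
            Pmat Q u t y i k *
              pdv i (fun z => Pmat Q u t z j k * pdv j (fun z' => u t z' m) z) y) +
          (∑ i : Fin N, ∑ j : Fin N,
            Pmat Q u t y i j * pdv i (pdv j fun z => u t z m) y) +
          ∑ i : Fin N, ∑ j : Fin N,
            pdv i (fun z => Pmat Q u t z j i * pdv j (fun z' => u t z' m) z) y : ℝ)) : ℂ)) ≤
      3 * N ^ 3 * C ^ 4 * ((S * S + S) * ∑ i : Fin N, ∑ j : Fin N,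
        besovT χ (-1 + N / p) p (Set.Ioi 0)
          (fun t y => ((pdv i (pdv j fun z => u t z m) y : ℝ) : ℂ))) := by
    intro m
    refine (setLIntegral_mono' measurableSet_Ioi fun t ht =>
      besov_nonlinearity_le χ hp hC halg' halg hder hgrad
        (P := fun i j y => Pmat Q u t y i j) (fun i j => (hK u hu t (le_of_lt ht) i j).1)
        (fun i j => (hK u hu t (le_of_lt ht) i j).2) ((hu.isTimeTest m).isTest t)).trans
        (le_of_eq ?_)
    rw [lintegral_const_mul _ (by fun_prop), lintegral_const_mul _ (by fun_prop),
      lintegral_finsetSum _ fun i _ => Finset.measurable_sum _ fun j _ => hmeas m i j]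
    congr! 3
    exact lintegral_finsetSum _ fun j _ => hmeas m _ j
  calc _ ≤ ∑ m : Fin N, 3 * N ^ 3 * C ^ 4 * ((S * S + S) * ∑ i : Fin N, ∑ j : Fin N,
        besovT χ (-1 + N / p) p (Set.Ioi 0)
          (fun t y => ((pdv i (pdv j fun z => u t z m) y : ℝ) : ℂ))) :=
        Finset.sum_le_sum fun m _ => hslice m
    _ = 3 * N ^ 3 * C ^ 4 * ((S * S + S) * E) := by rw [← Finset.mul_sum, ← Finset.mul_sum]; rfl
    _ ≤ 3 * N ^ 3 * C ^ 4 * ((N ^ 2 * K ^ 2 + N * K) * ∑ r ∈ Finset.Icc 2 (2 * N - 1), E ^ r) :=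
        mul_le_mul_right (mul_geom_sum_le hN E K) _
    _ = (B : ENNReal) * ∑ r ∈ Finset.Icc 2 (2 * N - 1), E ^ r := by
        rw [hB]; push_cast; ring
    _ ≤ _ := by
        gcongr
        rw [← ENNReal.ofReal_coe_nnreal]
        exact ENNReal.ofReal_le_ofReal (by simp)
end
end
end
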